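/- Let u₀ satisfy (3.15) with unique zero x₁ ∈ (a,b), for each ε > 0 let u_{0ε} satisfy (3.16), let u_ε ∈ C^{2,1}(Q) ∩ C(Q̄) be the solution of the regularised problem (3.11), and let u be the unique classical solution of the limit problem (2.7). Then (u_ε)_x > 0 in Q, so that X_ε(u,t), defined by u_ε(X_ε(u,t), t) = u, is well defined; and there exist δ_ε > 0 with δ_ε → 0 as ε → 0 such that for every t ∈ (0,T], ( ∫_{−δ_ε}^{δ_ε} du/(ε + Φ_ε²(u)) )^{−1} · ∫_{−δ_ε}^{δ_ε} (∂_t X_ε)(u,t)/(ε + Φ_ε²(u)) du, multiplied by 2 log ε, converges to u_x(x₁⁺, t) − u_x(x₁⁻, t) as ε → 0. -/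

import Mathlib

open Set Filter MeasureTheory Topology

/-- Partial derivative in `x` of `u(x,t)`. -/
noncomputable def pdx (u : ℝ → ℝ → ℝ) (x t : ℝ) : ℝ := deriv (fun y => u y t) x

/-- Second partial derivative in `x` of `u(x,t)`. -/
noncomputable def pdxx (u : ℝ → ℝ → ℝ) (x t : ℝ) : ℝ := deriv (fun y => pdx u y t) x

/-- Partial derivative in `t` of `u(x,t)`, one-sided at `t = T`. -/
noncomputable def pdtW (T : ℝ) (u : ℝ → ℝ → ℝ) (x t : ℝ) : ℝ :=
  derivWithin (fun s => u x s) (Set.Iic T) t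

/-- `Q = (a,b) × (0,T]`. -/
def QT (a b T : ℝ) : Set (ℝ × ℝ) := Set.Ioo a b ×ˢ Set.Ioc 0 T

/-- `N = N₀ × [0,T]`. -/
def NSet (N₀ : Set ℝ) (T : ℝ) : Set (ℝ × ℝ) := N₀ ×ˢ Set.Icc 0 T

/-- Condition (2.8): `u₀` is continuous, `u₀(a) = -1`, `u₀(b) = 1`, the zeros of `u₀`
form the finite set `N₀ ⊆ (a,b)`, and `u₀` changes sign at each of its zeros. -/
structure InitData (a b : ℝ) (N₀ : Set ℝ) (u₀ : ℝ → ℝ) : Prop where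
  cont : ContinuousOn u₀ (Set.Icc a b)
  bdry_a : u₀ a = -1
  bdry_b : u₀ b = 1
  fin : N₀.Finite
  sub : N₀ ⊆ Set.Ioo a b
  zeros : ∀ x ∈ Set.Icc a b, (u₀ x = 0 ↔ x ∈ N₀)
  sign_change : ∀ x ∈ N₀, ∀ δ > 0,
    ∃ y ∈ Set.Ioo (x - δ) x, ∃ z ∈ Set.Ioo x (x + δ), u₀ y * u₀ z < 0

/-- A classical solution of the limit problem (2.7): `u ∈ C(Q̄)` vanishing exactly on `N`,
`C^{2,1}` on `Q ∖ N`, with boundary values `∓1`, initial value `u₀`, satisfying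
`u_t = |u| u_xx + u(1-|u|)` on `Q ∖ N`. -/
structure IsClassicalSol (a b T : ℝ) (N₀ : Set ℝ) (u₀ : ℝ → ℝ) (u : ℝ → ℝ → ℝ) : Prop where
  cont : ContinuousOn (fun p : ℝ × ℝ => u p.1 p.2) (Set.Icc a b ×ˢ Set.Icc 0 T)
  zero_iff : ∀ x ∈ Set.Icc a b, ∀ t ∈ Set.Icc 0 T, (u x t = 0 ↔ x ∈ N₀)
  diff_x : ∀ p ∈ QT a b T \ NSet N₀ T, DifferentiableAt ℝ (fun y => u y p.2) p.1
  diff_xx : ∀ p ∈ QT a b T \ NSet N₀ T, DifferentiableAt ℝ (fun y => pdx u y p.2) p.1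
  diff_t : ∀ p ∈ QT a b T \ NSet N₀ T,
    DifferentiableWithinAt ℝ (fun s => u p.1 s) (Set.Iic T) p.2
  cont_x : ContinuousOn (fun p : ℝ × ℝ => pdx u p.1 p.2) (QT a b T \ NSet N₀ T)
  cont_xx : ContinuousOn (fun p : ℝ × ℝ => pdxx u p.1 p.2) (QT a b T \ NSet N₀ T)
  cont_t : ContinuousOn (fun p : ℝ × ℝ => pdtW T u p.1 p.2) (QT a b T \ NSet N₀ T)
  bdry_a : ∀ t ∈ Set.Ioc 0 T, u a t = -1
  bdry_b : ∀ t ∈ Set.Ioc 0 T, u b t = 1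
  init : ∀ x ∈ Set.Ioo a b, u x 0 = u₀ x
  pde : ∀ p ∈ QT a b T \ NSet N₀ T,
    pdtW T u p.1 p.2 = |u p.1 p.2| * pdxx u p.1 p.2 + u p.1 p.2 * (1 - |u p.1 p.2|)

/-- `U_ε(φ) = 2∫₀^φ √(ε + s²) ds` (equation (1.3)); its inverse is `Φ_ε`. -/
noncomputable def Ureg (ε φ : ℝ) : ℝ := 2 * ∫ s in (0:ℝ)..φ, Real.sqrt (ε + s ^ 2)

/-- A (classical) solution of the regularised problem (3.11):
`u ∈ C(Q̄) ∩ C^{2,1}(Q)` with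
`u_t = (ε + Φ_ε²(u)) u_xx + Φ_ε(u)(1 - Φ_ε²(u)) √(ε + Φ_ε²(u))` in `Q`,
boundary values `∓u_{1ε}` and initial value `u_{0ε}`. -/
structure IsRegSol (a b T ε : ℝ) (Φ : ℝ → ℝ) (u1 : ℝ) (u₀ε : ℝ → ℝ)
    (u : ℝ → ℝ → ℝ) : Prop where
  cont : ContinuousOn (fun p : ℝ × ℝ => u p.1 p.2) (Set.Icc a b ×ˢ Set.Icc 0 T)
  diff_x : ∀ p ∈ QT a b T, DifferentiableAt ℝ (fun y => u y p.2) p.1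
  diff_xx : ∀ p ∈ QT a b T, DifferentiableAt ℝ (fun y => pdx u y p.2) p.1
  diff_t : ∀ p ∈ QT a b T, DifferentiableWithinAt ℝ (fun s => u p.1 s) (Set.Iic T) p.2
  cont_x : ContinuousOn (fun p : ℝ × ℝ => pdx u p.1 p.2) (QT a b T)
  cont_xx : ContinuousOn (fun p : ℝ × ℝ => pdxx u p.1 p.2) (QT a b T)
  cont_t : ContinuousOn (fun p : ℝ × ℝ => pdtW T u p.1 p.2) (QT a b T)
  bdry_a : ∀ t ∈ Set.Ioc 0 T, u a t = -u1
  bdry_b : ∀ t ∈ Set.Ioc 0 T, u b t = u1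
  init : ∀ x ∈ Set.Icc a b, u x 0 = u₀ε x
  pde : ∀ p ∈ QT a b T,
    pdtW T u p.1 p.2 = (ε + Φ (u p.1 p.2) ^ 2) * pdxx u p.1 p.2
      + Φ (u p.1 p.2) * (1 - Φ (u p.1 p.2) ^ 2) * Real.sqrt (ε + Φ (u p.1 p.2) ^ 2)

/-! ### The nonlinearity `Ureg` and its inverse -/

lemma hasDerivAt_Ureg (ε φ : ℝ) : HasDerivAt (Ureg ε) (2 * √(ε + φ ^ 2)) φ := by
  have hc : Continuous fun s : ℝ => √(ε + s ^ 2) := by fun_prop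
  exact (intervalIntegral.integral_hasDerivAt_right (hc.intervalIntegrable _ _)
    hc.aestronglyMeasurable.stronglyMeasurableAtFilter hc.continuousAt).const_mul 2

lemma Ureg_zero (ε : ℝ) : Ureg ε 0 = 0 := by simp [Ureg]

lemma Ureg_neg (ε φ : ℝ) : Ureg ε (-φ) = -Ureg ε φ := by
  have h := intervalIntegral.integral_comp_neg (a := 0) (b := φ) fun s : ℝ => √(ε + s ^ 2)
  simp only [neg_sq, neg_zero] at h
  rw [Ureg, Ureg, intervalIntegral.integral_symm, ← h]
  ring

lemma sqrt_eps_pos {ε : ℝ} (hε : 0 < ε) (s : ℝ) : 0 < √(ε + s ^ 2) :=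
  Real.sqrt_pos.2 (by positivity)

lemma strictMono_Ureg {ε : ℝ} (hε : 0 < ε) : StrictMono (Ureg ε) :=
  strictMono_of_hasDerivAt_pos (fun φ => hasDerivAt_Ureg ε φ)
    fun φ => mul_pos two_pos (sqrt_eps_pos hε φ)

lemma sqrt_eps_le {ε s : ℝ} (hε : 0 ≤ ε) (hs : 0 ≤ s) : √(ε + s ^ 2) ≤ √ε + s := by
  refine (Real.sqrt_le_left (by positivity)).2 ?_
  have := Real.sq_sqrt hε
  nlinarith [mul_nonneg (Real.sqrt_nonneg ε) hs]

lemma le_sqrt_eps {ε s : ℝ} (hε : 0 ≤ ε) : |s| ≤ √(ε + s ^ 2) :=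
  Real.le_sqrt_of_sq_le (by rw [sq_abs]; linarith)

lemma sq_le_Ureg {ε φ : ℝ} (hε : 0 ≤ ε) (hφ : 0 ≤ φ) : φ ^ 2 ≤ Ureg ε φ := by
  have hc : Continuous fun s : ℝ => √(ε + s ^ 2) := by fun_prop
  have h := intervalIntegral.integral_mono_on (μ := volume) hφ
    (continuous_id.intervalIntegrable 0 φ) (hc.intervalIntegrable 0 φ)
    fun s _ => (le_abs_self s).trans (le_sqrt_eps hε)
  simp only [id, integral_id] at h
  rw [Ureg]
  linarith

lemma Ureg_le {ε φ : ℝ} (hε : 0 ≤ ε) (hφ : 0 ≤ φ) : Ureg ε φ ≤ φ ^ 2 + 2 * √ε * φ := by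
  have hc : Continuous fun s : ℝ => √(ε + s ^ 2) := by fun_prop
  have hc' : Continuous fun s : ℝ => √ε + s := by fun_prop
  have h := intervalIntegral.integral_mono_on (μ := volume) hφ
    (hc.intervalIntegrable 0 φ) (hc'.intervalIntegrable 0 φ)
    fun s hs => sqrt_eps_le hε hs.1
  rw [intervalIntegral.integral_add (by simp) (by simp)] at h
  simp only [integral_id, intervalIntegral.integral_const, smul_eq_mul] at h
  rw [Ureg]
  linarith

/-- `φ` is the inverse of `Ureg ε`, where `ε > 0`. -/
structure IsUregInverse (ε : ℝ) (φ : ℝ → ℝ) : Prop where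
  pos : 0 < ε
  left : Function.LeftInverse φ (Ureg ε)
  right : Function.RightInverse φ (Ureg ε)

namespace IsUregInverse

variable {ε : ℝ} {φ : ℝ → ℝ}

lemma strictMono (h : IsUregInverse ε φ) : StrictMono φ := fun x y hxy => by
  rwa [← (strictMono_Ureg h.pos).lt_iff_lt, h.right x, h.right y]

lemma map_zero (h : IsUregInverse ε φ) : φ 0 = 0 := by
  simpa [Ureg_zero] using h.left 0

lemma map_neg (h : IsUregInverse ε φ) (v : ℝ) : φ (-v) = -φ v := by
  have := h.left (-φ v)
  rwa [Ureg_neg, h.right v] at this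

lemma nonneg (h : IsUregInverse ε φ) {v : ℝ} (hv : 0 ≤ v) : 0 ≤ φ v := by
  simpa [h.map_zero] using h.strictMono.monotone hv

lemma surjective (h : IsUregInverse ε φ) : Function.Surjective φ := fun y => ⟨_, h.left y⟩

lemma continuous (h : IsUregInverse ε φ) : Continuous φ :=
  h.strictMono.monotone.continuous_of_surjective h.surjective

lemma hasDerivAt (h : IsUregInverse ε φ) (v : ℝ) :
    HasDerivAt φ (2 * √(ε + φ v ^ 2))⁻¹ v :=
  (hasDerivAt_Ureg ε (φ v)).of_local_left_inverse h.continuous.continuousAt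
    (mul_pos two_pos (sqrt_eps_pos h.pos _)).ne' (Eventually.of_forall h.right)

lemma contDiff (h : IsUregInverse ε φ) : ContDiff ℝ 1 φ := by
  refine contDiff_one_iff_deriv.2 ⟨fun v => (h.hasDerivAt v).differentiableAt, ?_⟩
  rw [funext fun v => (h.hasDerivAt v).deriv]
  have := h.continuous
  exact Continuous.inv₀ (by fun_prop) fun v => (mul_pos two_pos (sqrt_eps_pos h.pos _)).ne'

lemma sq_le (h : IsUregInverse ε φ) {v : ℝ} (hv : 0 ≤ v) : φ v ^ 2 ≤ v := by
  simpa [h.right v] using sq_le_Ureg h.pos.le (h.nonneg hv)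

lemma le_sq_add (h : IsUregInverse ε φ) {v : ℝ} (hv : 0 ≤ v) :
    v ≤ φ v ^ 2 + 2 * √ε * φ v := by
  simpa [h.right v] using Ureg_le h.pos.le (h.nonneg hv)

end IsUregInverse

/-- The diffusion coefficient `ε + φ(v)²` of the regularised equation. -/
def regDiff (ε : ℝ) (φ : ℝ → ℝ) (v : ℝ) : ℝ := ε + φ v ^ 2

/-- The reaction term of the regularised equation. -/
noncomputable def regReac (ε : ℝ) (φ : ℝ → ℝ) (v : ℝ) : ℝ :=
  φ v * (1 - φ v ^ 2) * √(ε + φ v ^ 2)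

/-- The primitive of `1 / regDiff ε φ`. -/
noncomputable def regPrim (ε : ℝ) (φ : ℝ → ℝ) (v : ℝ) : ℝ := 2 * Real.arsinh (φ v / √ε)

namespace IsUregInverse

variable {ε : ℝ} {φ : ℝ → ℝ}

lemma regDiff_pos (h : IsUregInverse ε φ) (v : ℝ) : 0 < regDiff ε φ v := by
  have := h.pos
  unfold regDiff
  positivity

lemma regPrim_neg (h : IsUregInverse ε φ) (v : ℝ) : regPrim ε φ (-v) = -regPrim ε φ v := by
  simp [regPrim, h.map_neg, neg_div, Real.arsinh_neg]

lemma continuous_regDiff (h : IsUregInverse ε φ) : Continuous (regDiff ε φ) := by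
  have := h.continuous
  unfold regDiff
  fun_prop

lemma continuous_regReac (h : IsUregInverse ε φ) : Continuous (regReac ε φ) := by
  have := h.continuous
  unfold regReac
  fun_prop

lemma contDiff_regReac (h : IsUregInverse ε φ) : ContDiff ℝ 1 (regReac ε φ) := by
  have h1 := h.contDiff
  have h2 : ContDiff ℝ 1 fun v => √(ε + φ v ^ 2) :=
    ContDiff.sqrt (contDiff_const.add (h1.pow 2)) fun v => (h.regDiff_pos v).ne'
  exact (h1.mul (contDiff_const.sub (h1.pow 2))).mul h2

lemma hasDerivAt_regPrim (h : IsUregInverse ε φ) (v : ℝ) :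
    HasDerivAt (regPrim ε φ) (regDiff ε φ v)⁻¹ v := by
  have hε := h.pos
  have h1 : 0 < √ε := Real.sqrt_pos.2 hε
  have h2 := sqrt_eps_pos hε (φ v)
  have h3 := ((Real.hasDerivAt_arsinh (φ v / √ε)).comp v
    ((h.hasDerivAt v).div_const (√ε))).const_mul 2
  refine h3.congr_deriv ?_
  have h4 : √(1 + (φ v / √ε) ^ 2) = √(ε + φ v ^ 2) / √ε := by
    rw [← Real.sqrt_div' _ hε.le, div_pow, Real.sq_sqrt hε.le]
    congr 1
    field_simp
  have h5 : regDiff ε φ v = √(ε + φ v ^ 2) ^ 2 :=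
    (Real.sq_sqrt (h.regDiff_pos v).le).symm
  rw [h4, h5]
  field_simp

lemma regReac_le (h : IsUregInverse ε φ) {v : ℝ} (hv : |φ v| ≤ 1) :
    |regReac ε φ v| ≤ regDiff ε φ v := by
  have h1 := le_sqrt_eps (s := φ v) h.pos.le
  have h2 : √(ε + φ v ^ 2) * √(ε + φ v ^ 2) = regDiff ε φ v :=
    Real.mul_self_sqrt (h.regDiff_pos v).le
  have h3 : |1 - φ v ^ 2| ≤ 1 := by
    have := abs_le.1 hv
    rw [abs_le]
    constructor <;> nlinarith [sq_nonneg (φ v)]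
  rw [regReac, abs_mul, abs_mul, abs_of_nonneg (Real.sqrt_nonneg _), ← h2]
  gcongr
  calc |φ v| * |1 - φ v ^ 2| ≤ |φ v| * 1 := by gcongr
    _ ≤ _ := by linarith

lemma regReac_nonneg (h : IsUregInverse ε φ) {v : ℝ} (hv : 0 ≤ v) (hv1 : φ v ≤ 1) :
    0 ≤ regReac ε φ v := by
  have := h.nonneg hv
  exact mul_nonneg (mul_nonneg this (by nlinarith)) (Real.sqrt_nonneg _)

lemma regReac_neg_of_one_lt (h : IsUregInverse ε φ) {v : ℝ} (hv : 1 < φ v) :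
    regReac ε φ v < 0 :=
  mul_neg_of_neg_of_pos (mul_neg_of_pos_of_neg (by linarith) (by nlinarith))
    (sqrt_eps_pos h.pos _)

lemma le_two (h : IsUregInverse ε φ) {v : ℝ} (hv : 0 ≤ v) (hv4 : v ≤ 4) : φ v ≤ 2 := by
  have := h.sq_le hv
  nlinarith [h.nonneg hv]

lemma abs_sub_sq_le (h : IsUregInverse ε φ) {v : ℝ} (hv : 0 ≤ v) (hv4 : v ≤ 4) :
    |v - φ v ^ 2| ≤ 4 * √ε := by
  have h1 := h.sq_le hv
  have h2 := h.le_sq_add hv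
  have h3 := mul_le_mul_of_nonneg_left (h.le_two hv hv4) (Real.sqrt_nonneg ε)
  rw [abs_le]
  constructor <;> nlinarith [Real.sqrt_nonneg ε]

lemma abs_regDiff_sub_le (h : IsUregInverse ε φ) {v : ℝ} (hv : 0 ≤ v) (hv4 : v ≤ 4) :
    |regDiff ε φ v - v| ≤ ε + 4 * √ε := by
  have h1 := abs_le.1 (h.abs_sub_sq_le hv hv4)
  have := h.pos
  unfold regDiff
  rw [abs_le]
  constructor <;> linarith

lemma abs_regReac_sub_le (h : IsUregInverse ε φ) {v : ℝ} (hv : 0 ≤ v) (hv4 : v ≤ 4) :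
    |regReac ε φ v - v * (1 - v)| ≤ 36 * √ε := by
  have h0 := h.nonneg hv
  have h2 := h.le_two hv hv4
  have h3 := h.abs_sub_sq_le hv hv4
  have hs := Real.sqrt_nonneg ε
  have h4 := mul_le_mul_of_nonneg_left h2 hs
  have h5 := (le_abs_self _).trans (le_sqrt_eps (s := φ v) h.pos.le)
  have h6 := sqrt_eps_le (s := φ v) h.pos.le h0
  have h7 : |φ v * √(ε + φ v ^ 2) - v| ≤ 4 * √ε := by
    have a1 := mul_le_mul_of_nonneg_left h5 h0
    have a2 := mul_le_mul_of_nonneg_left h6 h0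
    have a3 := abs_le.1 h3
    have a4 := h.sq_le hv
    rw [abs_le]
    constructor <;> nlinarith
  have h8 : |1 - φ v ^ 2| ≤ 5 := by
    rw [abs_le]
    constructor <;> nlinarith
  have e : regReac ε φ v - v * (1 - v)
      = (φ v * √(ε + φ v ^ 2) - v) * (1 - φ v ^ 2) + v * (v - φ v ^ 2) := by
    rw [regReac]; ring
  rw [e]
  calc _ ≤ |φ v * √(ε + φ v ^ 2) - v| * |1 - φ v ^ 2| + |v| * |v - φ v ^ 2| := by
        rw [← abs_mul, ← abs_mul]; exact abs_add_le _ _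
    _ ≤ (4 * √ε) * 5 + 4 * (4 * √ε) := by
        gcongr
        rwa [abs_of_nonneg hv]
    _ = 36 * √ε := by ring

lemma Ureg_one_bounds (h : IsUregInverse ε φ) {w : ℝ} (hw : φ w = 1) :
    0 < w ∧ 1 ≤ w ∧ w ≤ 1 + 2 * √ε := by
  have h0 : 0 < w := by
    rw [← h.strictMono.lt_iff_lt, h.map_zero, hw]; exact one_pos
  have h1 := h.sq_le h0.le
  have h2 := h.le_sq_add h0.le
  rw [hw] at h1 h2
  exact ⟨h0, by linarith, by linarith⟩

end IsUregInverse

/-! ### Maximum principle -/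

lemma second_derivative_test {g g' : ℝ → ℝ} {g'' x : ℝ} (hmax : IsLocalMax g x)
    (h1 : ∀ᶠ y in 𝓝 x, HasDerivAt g (g' y) y) (h2 : HasDerivAt g' g'' x) :
    g' x = 0 ∧ g'' ≤ 0 := by
  have hx := h1.self_of_nhds
  have h0 : g' x = 0 := hmax.hasDerivAt_eq_zero hx
  refine ⟨h0, not_lt.1 fun hpos => ?_⟩
  have hd : deriv g =ᶠ[𝓝 x] g' := h1.mono fun y hy => hy.deriv
  have hdd : deriv (deriv g) x = g'' := by rw [hd.deriv_eq, h2.deriv]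
  have hmin : IsLocalMin g x :=
    isLocalMin_of_deriv_deriv_pos (by rwa [hdd]) (by rw [hx.deriv, h0]) hx.continuousAt
  have hconst : g =ᶠ[𝓝 x] fun _ => g x := by
    filter_upwards [hmin, hmax] with y hy hy' using le_antisymm hy' hy
  have h3 : deriv g =ᶠ[𝓝 x] fun _ => 0 := by simpa using hconst.deriv
  have h4 : deriv (deriv g) x = 0 := by rw [h3.deriv_eq]; simp
  linarith [hdd ▸ h4]

lemma HasDerivWithinAt.nonneg_of_isMaxOn_Icc {g : ℝ → ℝ} {g' s t : ℝ} (hst : s < t)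
    (hg : HasDerivWithinAt g g' (Iic t) t) (hmax : ∀ r ∈ Icc s t, g r ≤ g t) : 0 ≤ g' := by
  have h1 : HasDerivWithinAt g g' (Iio t) t := hg.mono Iio_subset_Iic_self
  have h2 := (hasDerivWithinAt_iff_tendsto_slope' (by simp)).1 h1
  refine ge_of_tendsto h2 ?_
  filter_upwards [Ioo_mem_nhdsLT hst] with r hr
  rw [slope_def_field]
  exact div_nonneg_of_nonpos (by linarith [hmax r ⟨hr.1.le, hr.2.le⟩]) (by linarith [hr.2])

/-- A parabolic maximum principle on `K × [s, T]`. -/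
theorem parabolic_max_principle {E : Type*} [TopologicalSpace E] {K : Set E} (hK : IsCompact K)
    {D : E → ℝ → ℝ} {s T : ℝ} (M : ℝ)
    (hD : ContinuousOn (fun p : E × ℝ => D p.1 p.2) (K ×ˢ Icc s T))
    (h0 : ∀ p ∈ K, D p s ≤ 0)
    (hstep : ∀ p ∈ K, ∀ t ∈ Ioc s T, 0 < D p t → IsMaxOn (fun q => D q t) K p →
      ∃ d, HasDerivWithinAt (fun r => D p r) d (Iic T) t ∧ d < M * D p t) :
    ∀ p ∈ K, ∀ t ∈ Icc s T, D p t ≤ 0 := by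
  by_contra! hcon
  obtain ⟨p₀, hp₀, t₀, ht₀, hpos⟩ := hcon
  have hcont : ContinuousOn (fun p : E × ℝ => Real.exp (-M * p.2) * D p.1 p.2) (K ×ˢ Icc s T) :=
    ContinuousOn.mul (by fun_prop) hD
  obtain ⟨⟨p, t⟩, ⟨hp, ht⟩, hmax⟩ :=
    (hK.prod isCompact_Icc).exists_isMaxOn ⟨(p₀, t₀), hp₀, ht₀⟩ hcont
  simp only at hp ht
  have hmax' : ∀ q ∈ K, ∀ r ∈ Icc s T,
      Real.exp (-M * r) * D q r ≤ Real.exp (-M * t) * D p t :=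
    fun q hq r hr => hmax (show (q, r) ∈ K ×ˢ Icc s T from ⟨hq, hr⟩)
  have hDpos : 0 < D p t := by
    have := hmax' p₀ hp₀ t₀ ht₀
    by_contra! hle
    nlinarith [Real.exp_pos (-M * t), Real.exp_pos (-M * t₀),
      mul_pos (Real.exp_pos (-M * t₀)) hpos,
      mul_nonneg (Real.exp_pos (-M * t)).le (neg_nonneg.2 hle)]
  have hst : s < t := lt_of_le_of_ne ht.1 fun h => by
    subst h
    exact absurd (h0 p hp) (not_le.2 hDpos)
  obtain ⟨d, hd, hlt⟩ := hstep p hp t ⟨hst, ht.2⟩ hDpos fun q hq =>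
    le_of_mul_le_mul_left (hmax' q hq t ht) (Real.exp_pos _)
  have he : HasDerivAt (fun r : ℝ => Real.exp (-M * r)) (Real.exp (-M * t) * -M) t := by
    simpa using ((hasDerivAt_id t).const_mul (-M)).exp
  have h1 := (he.hasDerivWithinAt (s := Iic t)).mul (hd.mono (Iic_subset_Iic.2 ht.2))
  have h2 := h1.nonneg_of_isMaxOn_Icc hst fun r hr => hmax' p hp r ⟨hr.1, hr.2.trans ht.2⟩
  nlinarith [Real.exp_pos (-M * t), mul_pos (Real.exp_pos (-M * t)) (sub_pos.2 hlt)]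

theorem parabolic_max_principle_Icc {D : ℝ → ℝ → ℝ} {c d s T : ℝ} (M : ℝ)
    (hD : ContinuousOn (fun p : ℝ × ℝ => D p.1 p.2) (Icc c d ×ˢ Icc s T))
    (h0 : ∀ x ∈ Icc c d, D x s ≤ 0) (hc : ∀ t ∈ Ioc s T, D c t ≤ 0)
    (hd : ∀ t ∈ Ioc s T, D d t ≤ 0)
    (hstep : ∀ x ∈ Ioo c d, ∀ t ∈ Ioc s T, 0 < D x t → IsLocalMax (fun y => D y t) x →
      ∃ m, HasDerivWithinAt (fun r => D x r) m (Iic T) t ∧ m < M * D x t) :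
    ∀ x ∈ Icc c d, ∀ t ∈ Icc s T, D x t ≤ 0 := by
  refine parabolic_max_principle isCompact_Icc M hD h0 fun x hx t ht hpos hmax => ?_
  have hxc : c < x := lt_of_le_of_ne hx.1 fun e => absurd (hc t ht) (not_le.2 (e ▸ hpos))
  have hxd : x < d := lt_of_le_of_ne hx.2 fun e => absurd (hd t ht) (not_le.2 (e ▸ hpos))
  exact hstep x ⟨hxc, hxd⟩ t ht hpos (hmax.isLocalMax (Icc_mem_nhds hxc hxd))

/-! ### Regularised and limit problems, and their reflections -/

/-- `v ↦ -v(-x, t)`. -/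
def reflect (v : ℝ → ℝ → ℝ) (x t : ℝ) : ℝ := -v (-x) t

lemma pdx_reflect (v : ℝ → ℝ → ℝ) (x t : ℝ) : pdx (reflect v) x t = pdx v (-x) t := by
  unfold pdx reflect
  rw [deriv.fun_neg, deriv_comp_neg (fun y => v y t), neg_neg]

lemma pdxx_reflect (v : ℝ → ℝ → ℝ) (x t : ℝ) : pdxx (reflect v) x t = -pdxx v (-x) t := by
  unfold pdxx
  simp only [pdx_reflect]
  exact deriv_comp_neg (fun y => pdx v y t) x

lemma pdtW_reflect (T : ℝ) (v : ℝ → ℝ → ℝ) (x t : ℝ) :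
    pdtW T (reflect v) x t = -pdtW T v (-x) t := by
  unfold pdtW reflect
  exact derivWithin.fun_neg

lemma reflect_mem_QT {a b T : ℝ} {p : ℝ × ℝ} (hp : p ∈ QT (-b) (-a) T) :
    (-p.1, p.2) ∈ QT a b T := by
  simp only [QT, mem_prod, mem_Ioo] at hp ⊢
  exact ⟨⟨by linarith [hp.1.2], by linarith [hp.1.1]⟩, hp.2⟩

lemma neg_mem_Icc {a b x : ℝ} (hx : x ∈ Icc (-b) (-a)) : -x ∈ Icc a b :=
  ⟨by linarith [hx.2], by linarith [hx.1]⟩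

lemma neg_mem_Ioo {a b x : ℝ} (hx : x ∈ Ioo (-b) (-a)) : -x ∈ Ioo a b :=
  ⟨by linarith [hx.2], by linarith [hx.1]⟩

lemma DifferentiableAt.reflect_x {f : ℝ → ℝ} {x : ℝ} (h : DifferentiableAt ℝ f (-x)) :
    DifferentiableAt ℝ (fun y => f (-y)) x :=
  DifferentiableAt.comp x h (differentiableAt_id.neg)

lemma ContinuousOn.reflect_x {f : ℝ × ℝ → ℝ} {s s' : Set (ℝ × ℝ)} (h : ContinuousOn f s)
    (hs : ∀ p ∈ s', (-p.1, p.2) ∈ s) : ContinuousOn (fun p : ℝ × ℝ => f (-p.1, p.2)) s' :=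
  h.comp (f := fun p : ℝ × ℝ => (-p.1, p.2)) (by fun_prop) hs

/-- The regularised problem for a single `ε`, with increasing initial value `v₀` vanishing
at `x₁`. -/
structure RegProblem (a b T x₁ ε : ℝ) (φ : ℝ → ℝ) (w : ℝ) (v₀ : ℝ → ℝ)
    (v : ℝ → ℝ → ℝ) : Prop where
  hab : a < b
  hT : 0 < T
  hx : x₁ ∈ Ioo a b
  inv : IsUregInverse ε φ
  one : φ w = 1
  growth : ∃ κ > 0, ∀ y ∈ Icc a b, ∀ x ∈ Icc a b, y ≤ x → κ * (x - y) ≤ v₀ x - v₀ y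
  left : v₀ a = -w
  right : v₀ b = w
  zero : v₀ x₁ = 0
  sol : IsRegSol a b T ε φ w v₀ v

lemma IsRegSol.reflect {a b T ε w : ℝ} {φ v₀ : ℝ → ℝ} {v : ℝ → ℝ → ℝ}
    (hφ : IsUregInverse ε φ) (h : IsRegSol a b T ε φ w v₀ v) :
    IsRegSol (-b) (-a) T ε φ w (fun x => -v₀ (-x)) (reflect v) where
  cont := (h.cont.reflect_x fun p hp => ⟨neg_mem_Icc hp.1, hp.2⟩).neg
  diff_x p hp := (h.diff_x _ (reflect_mem_QT hp)).reflect_x.neg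
  diff_xx p hp := by
    simp only [pdx_reflect]
    exact (h.diff_xx _ (reflect_mem_QT hp)).reflect_x
  diff_t p hp := (h.diff_t _ (reflect_mem_QT hp)).neg
  cont_x := by
    simp only [pdx_reflect]
    exact h.cont_x.reflect_x fun p => reflect_mem_QT
  cont_xx := by
    simp only [pdxx_reflect]
    exact (h.cont_xx.reflect_x fun p => reflect_mem_QT).neg
  cont_t := by
    simp only [pdtW_reflect]
    exact (h.cont_t.reflect_x fun p => reflect_mem_QT).neg
  bdry_a t ht := by simp [_root_.reflect, h.bdry_b t ht]
  bdry_b t ht := by simp [_root_.reflect, h.bdry_a t ht]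
  init x hx := by simp [_root_.reflect, h.init _ (neg_mem_Icc hx)]
  pde p hp := by
    have := h.pde _ (reflect_mem_QT hp)
    simp only [pdtW_reflect, pdxx_reflect, _root_.reflect, hφ.map_neg, this]
    ring_nf

lemma RegProblem.reflect {a b T x₁ ε w : ℝ} {φ v₀ : ℝ → ℝ} {v : ℝ → ℝ → ℝ}
    (h : RegProblem a b T x₁ ε φ w v₀ v) :
    RegProblem (-b) (-a) T (-x₁) ε φ w (fun x => -v₀ (-x)) (reflect v) where
  hab := neg_lt_neg h.hab
  hT := h.hT
  hx := ⟨neg_lt_neg h.hx.2, neg_lt_neg h.hx.1⟩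
  inv := h.inv
  one := h.one
  growth := by
    obtain ⟨κ, hκ, H⟩ := h.growth
    refine ⟨κ, hκ, fun y hy x hx hyx => ?_⟩
    have := H _ (neg_mem_Icc hx) _ (neg_mem_Icc hy) (neg_le_neg hyx)
    linarith
  left := by simp [h.right]
  right := by simp [h.left]
  zero := by simp [h.zero]
  sol := h.sol.reflect h.inv

lemma IsClassicalSol.reflect {a b T x₁ : ℝ} {u₀ : ℝ → ℝ} {u : ℝ → ℝ → ℝ}
    (h : IsClassicalSol a b T {x₁} u₀ u) :
    IsClassicalSol (-b) (-a) T {-x₁} (fun x => -u₀ (-x)) (reflect u) := by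
  have key : ∀ p ∈ QT (-b) (-a) T \ NSet {-x₁} T, (-p.1, p.2) ∈ QT a b T \ NSet {x₁} T := by
    rintro p ⟨hp, hn⟩
    refine ⟨reflect_mem_QT hp, fun hm => hn ?_⟩
    simp only [NSet, mem_prod, mem_singleton_iff] at hm ⊢
    exact ⟨by linarith [hm.1], hm.2⟩
  exact
  { cont := (h.cont.reflect_x fun p hp => ⟨neg_mem_Icc hp.1, hp.2⟩).neg
    zero_iff := fun x hx t ht => by
      rw [_root_.reflect, neg_eq_zero, h.zero_iff _ (neg_mem_Icc hx) t ht]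
      simp [neg_eq_iff_eq_neg]
    diff_x := fun p hp => (h.diff_x _ (key p hp)).reflect_x.neg
    diff_xx := fun p hp => by
      simp only [pdx_reflect]
      exact (h.diff_xx _ (key p hp)).reflect_x
    diff_t := fun p hp => (h.diff_t _ (key p hp)).neg
    cont_x := by
      simp only [pdx_reflect]
      exact h.cont_x.reflect_x key
    cont_xx := by
      simp only [pdxx_reflect]
      exact (h.cont_xx.reflect_x key).neg
    cont_t := by
      simp only [pdtW_reflect]
      exact (h.cont_t.reflect_x key).neg
    bdry_a := fun t ht => by simp [_root_.reflect, h.bdry_b t ht]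
    bdry_b := fun t ht => by simp [_root_.reflect, h.bdry_a t ht]
    init := fun x hx => by simp [_root_.reflect, h.init _ (neg_mem_Ioo hx)]
    pde := fun p hp => by
      have := h.pde _ (key p hp)
      simp only [pdtW_reflect, pdxx_reflect, _root_.reflect, this, abs_neg]
      ring_nf }

/-! ### Bounds and strict monotonicity for the regularised problem -/

namespace RegProblem

variable {a b T x₁ ε w : ℝ} {φ v₀ : ℝ → ℝ} {v : ℝ → ℝ → ℝ}

lemma hasDerivAt_x (h : RegProblem a b T x₁ ε φ w v₀ v) {x t : ℝ} (hx : x ∈ Ioo a b)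
    (ht : t ∈ Ioc 0 T) : HasDerivAt (fun y => v y t) (pdx v x t) x :=
  (h.sol.diff_x (x, t) ⟨hx, ht⟩).hasDerivAt

lemma hasDerivAt_xx (h : RegProblem a b T x₁ ε φ w v₀ v) {x t : ℝ} (hx : x ∈ Ioo a b)
    (ht : t ∈ Ioc 0 T) : HasDerivAt (fun y => pdx v y t) (pdxx v x t) x :=
  (h.sol.diff_xx (x, t) ⟨hx, ht⟩).hasDerivAt

lemma hasDerivWithinAt_t (h : RegProblem a b T x₁ ε φ w v₀ v) {x t : ℝ} (hx : x ∈ Ioo a b)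
    (ht : t ∈ Ioc 0 T) : HasDerivWithinAt (fun s => v x s) (pdtW T v x t) (Iic T) t :=
  (h.sol.diff_t (x, t) ⟨hx, ht⟩).hasDerivWithinAt

lemma pde (h : RegProblem a b T x₁ ε φ w v₀ v) {x t : ℝ} (hx : x ∈ Ioo a b)
    (ht : t ∈ Ioc 0 T) :
    pdtW T v x t = regDiff ε φ (v x t) * pdxx v x t + regReac ε φ (v x t) :=
  h.sol.pde (x, t) ⟨hx, ht⟩

lemma continuousOn_x (h : RegProblem a b T x₁ ε φ w v₀ v) {t : ℝ} (ht : t ∈ Icc 0 T) :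
    ContinuousOn (fun x => v x t) (Icc a b) :=
  h.sol.cont.comp (f := fun x => (x, t)) (by fun_prop) fun _ hx => ⟨hx, ht⟩

lemma a_mem (h : RegProblem a b T x₁ ε φ w v₀ v) : a ∈ Icc a b := left_mem_Icc.2 h.hab.le

lemma b_mem (h : RegProblem a b T x₁ ε φ w v₀ v) : b ∈ Icc a b := right_mem_Icc.2 h.hab.le

lemma eq_left (h : RegProblem a b T x₁ ε φ w v₀ v) {t : ℝ} (ht : t ∈ Icc 0 T) : v a t = -w := by
  rcases ht.1.eq_or_lt with rfl | ht0
  · rw [h.sol.init a h.a_mem, h.left]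
  · exact h.sol.bdry_a t ⟨ht0, ht.2⟩

lemma eq_right (h : RegProblem a b T x₁ ε φ w v₀ v) {t : ℝ} (ht : t ∈ Icc 0 T) : v b t = w := by
  rcases ht.1.eq_or_lt with rfl | ht0
  · rw [h.sol.init b h.b_mem, h.right]
  · exact h.sol.bdry_b t ⟨ht0, ht.2⟩

lemma monotoneOn_init (h : RegProblem a b T x₁ ε φ w v₀ v) : MonotoneOn v₀ (Icc a b) := by
  obtain ⟨κ, hκ, H⟩ := h.growth
  intro y hy x hx hyx
  nlinarith [H y hy x hx hyx, mul_nonneg hκ.le (sub_nonneg.2 hyx)]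

/-- Contact of `v` from below with a `C²` function. -/
lemma touch (h : RegProblem a b T x₁ ε φ w v₀ v) {x t : ℝ} (hx : x ∈ Ioo a b)
    (ht : t ∈ Ioc 0 T) {ψ ψ' : ℝ → ℝ} {ψ'' : ℝ}
    (h1 : ∀ᶠ y in 𝓝 x, HasDerivAt ψ (ψ' y) y) (h2 : HasDerivAt ψ' ψ'' x)
    (hmax : IsLocalMax (fun y => v y t - ψ y) x) : pdx v x t = ψ' x ∧ pdxx v x t ≤ ψ'' := by
  have key := second_derivative_test (g' := fun y => pdx v y t - ψ' y) hmax
    (by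
      filter_upwards [h1, Ioo_mem_nhds hx.1 hx.2] with y hy hy'
      exact (h.hasDerivAt_x hy' ht).sub hy) ((h.hasDerivAt_xx hx ht).sub h2)
  exact ⟨by linarith [key.1], by linarith [key.2]⟩

/-- Contact of `v` from above with a `C²` function. -/
lemma touch' (h : RegProblem a b T x₁ ε φ w v₀ v) {x t : ℝ} (hx : x ∈ Ioo a b)
    (ht : t ∈ Ioc 0 T) {ψ ψ' : ℝ → ℝ} {ψ'' : ℝ}
    (h1 : ∀ᶠ y in 𝓝 x, HasDerivAt ψ (ψ' y) y) (h2 : HasDerivAt ψ' ψ'' x)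
    (hmax : IsLocalMax (fun y => ψ y - v y t) x) : pdx v x t = ψ' x ∧ ψ'' ≤ pdxx v x t := by
  have key := second_derivative_test (g' := fun y => ψ' y - pdx v y t) hmax
    (by
      filter_upwards [h1, Ioo_mem_nhds hx.1 hx.2] with y hy hy'
      exact hy.sub (h.hasDerivAt_x hy' ht)) (h2.sub (h.hasDerivAt_xx hx ht))
  exact ⟨by linarith [key.1], by linarith [key.2]⟩

lemma le_w (h : RegProblem a b T x₁ ε φ w v₀ v) :
    ∀ x ∈ Icc a b, ∀ t ∈ Icc 0 T, v x t ≤ w := by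
  intro x hx t ht
  have key := parabolic_max_principle_Icc (D := fun x t => v x t - w) (c := a) (d := b)
    (s := 0) (T := T) 0 (h.sol.cont.sub continuousOn_const) ?_ ?_ ?_ ?_ x hx t ht
  · linarith
  · intro x hx
    have := h.monotoneOn_init hx h.b_mem hx.2
    rw [h.right] at this
    rw [h.sol.init x hx]
    linarith
  · intro t ht
    have := (h.inv.Ureg_one_bounds h.one).1
    rw [h.sol.bdry_a t ht]
    linarith
  · intro t ht
    rw [h.sol.bdry_b t ht, sub_self]
  · intro x hx t ht hpos hmax
    refine ⟨_, (h.hasDerivWithinAt_t hx ht).sub_const w, ?_⟩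
    obtain ⟨-, h2⟩ := h.touch hx ht (ψ := fun _ => w) (ψ' := fun _ => 0)
      (Eventually.of_forall fun y => hasDerivAt_const _ _) (hasDerivAt_const _ _) hmax
    have h3 : 1 < φ (v x t) := h.one ▸ h.inv.strictMono (by linarith)
    rw [h.pde hx ht, zero_mul]
    nlinarith [h.inv.regReac_neg_of_one_lt h3, h.inv.regDiff_pos (v x t)]

lemma mem_Icc (h : RegProblem a b T x₁ ε φ w v₀ v) {x t : ℝ} (hx : x ∈ Icc a b)
    (ht : t ∈ Icc 0 T) : v x t ∈ Icc (-w) w := by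
  refine ⟨?_, h.le_w x hx t ht⟩
  have := h.reflect.le_w (-x) ⟨neg_le_neg hx.2, neg_le_neg hx.1⟩ t ht
  simp only [_root_.reflect, neg_neg] at this
  linarith

lemma abs_inv_le (h : RegProblem a b T x₁ ε φ w v₀ v) {x t : ℝ} (hx : x ∈ Icc a b)
    (ht : t ∈ Icc 0 T) : |φ (v x t)| ≤ 1 := by
  have h1 := h.mem_Icc hx ht
  have h2 := h.inv.strictMono.monotone h1.1
  have h3 := h.inv.strictMono.monotone h1.2
  rw [h.inv.map_neg, h.one] at h2
  rw [h.one] at h3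
  exact abs_le.2 ⟨h2, h3⟩

lemma exists_lipschitz (h : RegProblem a b T x₁ ε φ w v₀ v) :
    ∃ L : ℝ, 0 ≤ L ∧ ∀ p ∈ Icc (-w) w, ∀ q ∈ Icc (-w) w,
      |regReac ε φ p - regReac ε φ q| ≤ L * |p - q| := by
  obtain ⟨K, hK⟩ := h.inv.contDiff_regReac.contDiffOn.exists_lipschitzOnWith one_ne_zero
    (convex_Icc (-w) w) isCompact_Icc
  exact ⟨K, K.2, fun p hp q hq => by simpa [Real.dist_eq] using hK.dist_le_mul p hp q hq⟩

lemma edge_bound (h : RegProblem a b T x₁ ε φ w v₀ v) {κ L : ℝ} (hκ : 0 < κ) (hL0 : 0 ≤ L)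
    (hgr : ∀ y ∈ Icc a b, ∀ x ∈ Icc a b, y ≤ x → κ * (x - y) ≤ v₀ x - v₀ y)
    (hL : ∀ p ∈ Icc (-w) w, ∀ q ∈ Icc (-w) w,
      |regReac ε φ p - regReac ε φ q| ≤ L * |p - q|) :
    ∀ x ∈ Icc a b, ∀ t ∈ Icc 0 T, κ * Real.exp (-L * t) * (x - a) ≤ v x t + w := by
  intro x hx t ht
  have key := parabolic_max_principle_Icc
    (D := fun x t => (κ * Real.exp (-L * t) * (x - a) - w) - v x t) (c := a) (d := b)
    (s := 0) (T := T) 1 (ContinuousOn.sub (by fun_prop) h.sol.cont) ?_ ?_ ?_ ?_ x hx t ht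
  · linarith
  · intro x hx
    have := hgr a h.a_mem x hx hx.1
    rw [h.left] at this
    rw [h.sol.init x hx]
    simp
    linarith
  · intro t ht
    rw [h.sol.bdry_a t ht]
    simp
  · intro t ht
    have h1 := hgr a h.a_mem b h.b_mem h.hab.le
    rw [h.left, h.right] at h1
    have h2 : Real.exp (-L * t) ≤ 1 := Real.exp_le_one_iff.2 (by nlinarith [ht.1])
    have h3 := mul_le_mul_of_nonneg_left h2 (mul_nonneg hκ.le (sub_nonneg.2 h.hab.le))
    rw [h.sol.bdry_b t ht]
    linarith
  · intro x hx t ht hpos hmax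
    have he : HasDerivAt (fun r : ℝ => Real.exp (-L * r)) (Real.exp (-L * t) * -L) t := by
      simpa using ((hasDerivAt_id t).const_mul (-L)).exp
    refine ⟨_, ((((he.const_mul κ).mul_const (x - a)).sub_const w).hasDerivWithinAt).sub
      (h.hasDerivWithinAt_t hx ht), ?_⟩
    obtain ⟨-, h2⟩ := h.touch' hx ht (ψ := fun y => κ * Real.exp (-L * t) * (y - a) - w)
      (ψ' := fun _ => κ * Real.exp (-L * t))
      (Eventually.of_forall fun y => by
        simpa using (((hasDerivAt_id y).sub_const a).const_mul (κ * Real.exp (-L * t))).sub_const w)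
      (hasDerivAt_const _ _) hmax
    have hm := h.mem_Icc (Ioo_subset_Icc_self hx) (Ioc_subset_Icc_self ht)
    have h3 := hL _ hm (-w) ⟨le_rfl, by linarith [(h.inv.Ureg_one_bounds h.one).1]⟩
    have h4 : regReac ε φ (-w) = 0 := by simp [regReac, h.inv.map_neg, h.one]
    rw [h4, sub_zero, sub_neg_eq_add, abs_of_nonneg (by linarith [hm.1] : 0 ≤ v x t + w)] at h3
    rw [h.pde hx ht]
    nlinarith [(abs_le.1 h3).1, mul_nonneg (h.inv.regDiff_pos (v x t)).le h2,
      mul_nonneg hL0 hpos.le]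

lemma exists_growth (h : RegProblem a b T x₁ ε φ w v₀ v) :
    ∃ κ > 0, ∀ t ∈ Icc 0 T, ∀ y ∈ Icc a b, ∀ x ∈ Icc a b, y ≤ x →
      κ * (x - y) ≤ v x t - v y t := by
  obtain ⟨κ, hκ, hgr⟩ := h.growth
  obtain ⟨L, hL0, hL⟩ := h.exists_lipschitz
  have edge := h.edge_bound hκ hL0 hgr hL
  have edge' : ∀ x ∈ Icc a b, ∀ t ∈ Icc 0 T,
      κ * Real.exp (-L * t) * (b - x) ≤ w - v x t := by
    intro x hx t ht
    have := h.reflect.edge_bound hκ hL0 (fun y hy x hx hyx => by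
      have := hgr _ (neg_mem_Icc hx) _ (neg_mem_Icc hy) (neg_le_neg hyx)
      linarith) hL (-x) ⟨neg_le_neg hx.2, neg_le_neg hx.1⟩ t ht
    simp only [_root_.reflect, neg_neg] at this
    linarith
  set K : Set (ℝ × ℝ) := (Icc a b ×ˢ Icc a b) ∩ {p | p.2 ≤ p.1} with hKdef
  have hK : IsCompact K := (isCompact_Icc.prod isCompact_Icc).inter_right
    (isClosed_le continuous_snd continuous_fst)
  have key : ∀ p ∈ K, ∀ t ∈ Icc 0 T,
      κ * Real.exp (-L * t) * (p.1 - p.2) - (v p.1 t - v p.2 t) ≤ 0 := by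
    refine parabolic_max_principle hK (L + 1) ?_ ?_ ?_
    · refine ContinuousOn.sub (by fun_prop) (ContinuousOn.sub ?_ ?_)
      · exact h.sol.cont.comp (f := fun p : (ℝ × ℝ) × ℝ => (p.1.1, p.2)) (by fun_prop)
          fun p hp => ⟨hp.1.1.1, hp.2⟩
      · exact h.sol.cont.comp (f := fun p : (ℝ × ℝ) × ℝ => (p.1.2, p.2)) (by fun_prop)
          fun p hp => ⟨hp.1.1.2, hp.2⟩
    · rintro ⟨x, y⟩ ⟨⟨hx, hy⟩, hyx⟩
      have := hgr y hy x hx hyx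
      simp only at hx hy ⊢
      rw [h.sol.init x hx, h.sol.init y hy]
      simp
      linarith
    · rintro ⟨x, y⟩ ⟨⟨hx, hy⟩, hyx⟩ t ht hpos hmax
      simp only [mem_ofPred_eq] at hx hy hyx hpos hmax
      have ht' := Ioc_subset_Icc_self ht
      have hlt : y < x := lt_of_le_of_ne hyx fun e => by
        subst e
        simp at hpos
      have hxb : x < b := lt_of_le_of_ne hx.2 fun e => by
        subst e
        have := edge' y hy t ht'
        rw [h.eq_right ht'] at hpos
        linarith
      have hya : a < y := lt_of_le_of_ne hy.1 fun e => by
        subst e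
        have := edge x hx t ht'
        rw [h.eq_left ht'] at hpos
        linarith
      have hxI : x ∈ Ioo a b := ⟨hya.trans hlt, hxb⟩
      have hyI : y ∈ Ioo a b := ⟨hya, hlt.trans hxb⟩
      have hmx : IsLocalMax (fun x' => (κ * Real.exp (-L * t) * (x' - y) + v y t) - v x' t) x := by
        filter_upwards [Ioo_mem_nhds hlt hxb] with x' hx'
        have : (x', y) ∈ K := ⟨⟨⟨hy.1.trans hx'.1.le, hx'.2.le⟩, hy⟩, hx'.1.le⟩
        have := hmax this
        simp only [mem_ofPred_eq] at this
        linarith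
      have hmy : IsLocalMax (fun y' => v y' t - (v x t - κ * Real.exp (-L * t) * (x - y'))) y := by
        filter_upwards [Ioo_mem_nhds hya hlt] with y' hy'
        have : (x, y') ∈ K := ⟨⟨hx, hy'.1.le, hy'.2.le.trans hx.2⟩, hy'.2.le⟩
        have := hmax this
        simp only [mem_ofPred_eq] at this
        linarith
      obtain ⟨-, hxx⟩ := h.touch' hxI ht (ψ' := fun _ => κ * Real.exp (-L * t))
        (Eventually.of_forall fun z => by
          simpa using (((hasDerivAt_id z).sub_const y).const_mul
            (κ * Real.exp (-L * t))).add_const (v y t)) (hasDerivAt_const _ _) hmx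
      obtain ⟨-, hyy⟩ := h.touch hyI ht (ψ' := fun _ => κ * Real.exp (-L * t))
        (Eventually.of_forall fun z => by
          simpa using (((hasDerivAt_id z).const_sub x).const_mul
            (κ * Real.exp (-L * t))).const_sub (v x t)) (hasDerivAt_const _ _) hmy
      have he : HasDerivAt (fun r : ℝ => Real.exp (-L * r)) (Real.exp (-L * t) * -L) t := by
        simpa using ((hasDerivAt_id t).const_mul (-L)).exp
      refine ⟨_, (((he.const_mul κ).mul_const (x - y)).hasDerivWithinAt).sub
        ((h.hasDerivWithinAt_t hxI ht).sub (h.hasDerivWithinAt_t hyI ht)), ?_⟩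
      simp only
      rw [h.pde hxI ht, h.pde hyI ht]
      have hl := (abs_le.1 (hL _ (h.mem_Icc hx ht') _ (h.mem_Icc hy ht'))).1
      have hB : 0 < κ * Real.exp (-L * t) * (x - y) :=
        mul_pos (mul_pos hκ (Real.exp_pos _)) (sub_pos.2 hlt)
      have e1 := mul_nonneg (h.inv.regDiff_pos (v x t)).le hxx
      have e2 := mul_nonneg (h.inv.regDiff_pos (v y t)).le (neg_nonneg.2 hyy)
      rcases le_total 0 (v x t - v y t) with h0 | h0
      · rw [abs_of_nonneg h0] at hl
        nlinarith [mul_nonneg hL0 hpos.le]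
      · rw [abs_of_nonpos h0] at hl
        nlinarith [mul_nonneg hL0 hB.le]
  refine ⟨κ * Real.exp (-L * T), mul_pos hκ (Real.exp_pos _), fun t ht y hy x hx hyx => ?_⟩
  have h1 := key (x, y) ⟨⟨hx, hy⟩, hyx⟩ t ht
  have h2 : Real.exp (-L * T) ≤ Real.exp (-L * t) := Real.exp_le_exp.2 (by nlinarith [ht.2])
  have h3 := mul_le_mul_of_nonneg_right (mul_le_mul_of_nonneg_left h2 hκ.le) (sub_nonneg.2 hyx)
  simp only at h1
  linarith

lemma pdx_pos (h : RegProblem a b T x₁ ε φ w v₀ v) {x t : ℝ} (hx : x ∈ Ioo a b)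
    (ht : t ∈ Ioc 0 T) : 0 < pdx v x t := by
  obtain ⟨κ, hκ, H⟩ := h.exists_growth
  refine hκ.trans_le ?_
  have h1 := (hasDerivWithinAt_iff_tendsto_slope' (by simp)).1
    ((h.hasDerivAt_x hx ht).hasDerivWithinAt (s := Ioi x))
  refine ge_of_tendsto h1 ?_
  filter_upwards [Ioo_mem_nhdsGT hx.2] with y hy
  rw [slope_def_field, le_div_iff₀ (sub_pos.2 hy.1)]
  exact H t (Ioc_subset_Icc_self ht) x (Ioo_subset_Icc_self hx) y
    ⟨hx.1.le.trans hy.1.le, hy.2.le⟩ hy.1.le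

lemma strictMonoOn (h : RegProblem a b T x₁ ε φ w v₀ v) {t : ℝ} (ht : t ∈ Icc 0 T) :
    StrictMonoOn (fun x => v x t) (Icc a b) := by
  obtain ⟨κ, hκ, H⟩ := h.exists_growth
  intro y hy x hx hyx
  nlinarith [H t ht y hy x hx hyx.le, mul_pos hκ (sub_pos.2 hyx)]

end RegProblem

/-! ### Barriers -/

lemma HasDerivAt.mul_sub_le_sub {Y Y' : ℝ → ℝ} {x y C : ℝ} (hxy : x ≤ y)
    (hY : ∀ r ∈ Icc x y, HasDerivAt Y (Y' r) r) (hC : ∀ r ∈ Icc x y, C ≤ Y' r) :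
    C * (y - x) ≤ Y y - Y x := by
  rcases hxy.eq_or_lt with rfl | hlt
  · simp
  obtain ⟨r, hr, he⟩ := exists_hasDerivAt_eq_slope Y Y' hlt
    (fun r hr => (hY r hr).continuousAt.continuousWithinAt)
    fun r hr => hY r (Ioo_subset_Icc_self hr)
  have := hC r (Ioo_subset_Icc_self hr)
  rwa [he, le_div_iff₀ (sub_pos.2 hlt)] at this

lemma HasDerivAt.sub_le_mul_sub {Y Y' : ℝ → ℝ} {x y C : ℝ} (hxy : x ≤ y)
    (hY : ∀ r ∈ Icc x y, HasDerivAt Y (Y' r) r) (hC : ∀ r ∈ Icc x y, Y' r ≤ C) :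
    Y y - Y x ≤ C * (y - x) := by
  have := HasDerivAt.mul_sub_le_sub (Y := fun r => -Y r) (Y' := fun r => -Y' r) (C := -C) hxy
    (fun r hr => (hY r hr).neg) fun r hr => neg_le_neg (hC r hr)
  linarith

/-- The slope of the travelling barrier as a function of its value. -/
noncomputable def barrierSlope (ε : ℝ) (φ : ℝ → ℝ) (w K k v : ℝ) : ℝ :=
  K - (K - k) / regPrim ε φ w * regPrim ε φ v

/-- The inverse of the profile of the travelling barrier. -/
noncomputable def barrierInv (ε : ℝ) (φ : ℝ → ℝ) (w K k v : ℝ) : ℝ :=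
  ∫ r in (0 : ℝ)..v, (max (barrierSlope ε φ w K k r) k)⁻¹

namespace IsUregInverse

variable {ε w K k : ℝ} {φ : ℝ → ℝ}

lemma strictMono_regPrim (h : IsUregInverse ε φ) : StrictMono (regPrim ε φ) :=
  strictMono_of_hasDerivAt_pos h.hasDerivAt_regPrim fun v => inv_pos.2 (h.regDiff_pos v)

lemma regPrim_zero (h : IsUregInverse ε φ) : regPrim ε φ 0 = 0 := by
  simp [regPrim, h.map_zero]

lemma regPrim_pos (h : IsUregInverse ε φ) {v : ℝ} (hv : 0 < v) : 0 < regPrim ε φ v :=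
  h.regPrim_zero ▸ h.strictMono_regPrim hv

lemma continuous_regPrim (h : IsUregInverse ε φ) : Continuous (regPrim ε φ) :=
  continuous_iff_continuousAt.2 fun v => (h.hasDerivAt_regPrim v).continuousAt

lemma hasDerivAt_barrierSlope (h : IsUregInverse ε φ) (v : ℝ) :
    HasDerivAt (barrierSlope ε φ w K k)
      (-((K - k) / regPrim ε φ w * (regDiff ε φ v)⁻¹)) v :=
  ((h.hasDerivAt_regPrim v).const_mul _).const_sub K

lemma antitone_barrierSlope (h : IsUregInverse ε φ) (hw : 0 < w) (hkK : k < K) :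
    Antitone (barrierSlope ε φ w K k) := fun x y hxy => by
  have h1 : 0 ≤ (K - k) / regPrim ε φ w :=
    div_nonneg (sub_nonneg.2 hkK.le) (h.regPrim_pos hw).le
  have h2 := mul_le_mul_of_nonneg_left (h.strictMono_regPrim.monotone hxy) h1
  unfold barrierSlope
  linarith

lemma barrierSlope_w (h : IsUregInverse ε φ) (hw : 0 < w) : barrierSlope ε φ w K k w = k := by
  have := (h.regPrim_pos hw).ne'
  unfold barrierSlope
  field_simp
  ring

lemma barrierSlope_zero (h : IsUregInverse ε φ) : barrierSlope ε φ w K k 0 = K := by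
  simp [barrierSlope, h.regPrim_zero]

lemma le_barrierSlope (h : IsUregInverse ε φ) (hw : 0 < w) (hkK : k < K) {v : ℝ} (hv : v ≤ w) :
    k ≤ barrierSlope ε φ w K k v :=
  (h.barrierSlope_w hw).symm.trans_le (h.antitone_barrierSlope hw hkK hv)

lemma hasDerivAt_barrierInv (h : IsUregInverse ε φ) (hw : 0 < w) (hk : 0 < k) (hkK : k < K)
    {v : ℝ} (hv : v ≤ w) :
    HasDerivAt (barrierInv ε φ w K k) (barrierSlope ε φ w K k v)⁻¹ v := by
  have h0 := h.continuous_regPrim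
  have hc : Continuous fun r => (max (barrierSlope ε φ w K k r) k)⁻¹ := by
    refine Continuous.inv₀ ?_ fun r => (hk.trans_le (le_max_right _ _)).ne'
    unfold barrierSlope
    fun_prop
  have := intervalIntegral.integral_hasDerivAt_right (hc.intervalIntegrable 0 v)
    hc.aestronglyMeasurable.stronglyMeasurableAtFilter hc.continuousAt
  rwa [max_eq_left (h.le_barrierSlope hw hkK hv)] at this

lemma barrierInv_zero : barrierInv ε φ w K k 0 = 0 := by simp [barrierInv]

lemma barrierInv_lower_of_nonpos (h : IsUregInverse ε φ) (hw : 0 < w) (hk : 0 < k) (hkK : k < K)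
    {v : ℝ} (hv : v ≤ 0) : v / K ≤ barrierInv ε φ w K k v := by
  have := HasDerivAt.sub_le_mul_sub hv
    (fun r hr => h.hasDerivAt_barrierInv hw hk hkK (hr.2.trans hw.le)) (C := K⁻¹)
    fun r hr => inv_anti₀ (hk.trans hkK)
      (h.barrierSlope_zero.symm.trans_le (h.antitone_barrierSlope hw hkK hr.2))
  rw [barrierInv_zero] at this
  rw [div_eq_inv_mul]
  linarith

lemma barrierInv_upper_of_nonpos (h : IsUregInverse ε φ) (hw : 0 < w) (hk : 0 < k) (hkK : k < K)
    {v : ℝ} (hv : v ≤ 0) : barrierInv ε φ w K k v ≤ 0 := by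
  have := HasDerivAt.mul_sub_le_sub hv
    (fun r hr => h.hasDerivAt_barrierInv hw hk hkK (hr.2.trans hw.le)) (C := 0)
    fun r hr => inv_nonneg.2 (hk.le.trans (h.le_barrierSlope hw hkK (hr.2.trans hw.le)))
  rw [barrierInv_zero] at this
  linarith

lemma barrierInv_mono (h : IsUregInverse ε φ) (hw : 0 < w) (hk : 0 < k) (hkK : k < K)
    {x v : ℝ} (hxv : x ≤ v) (hv : v ≤ w) :
    barrierInv ε φ w K k x ≤ barrierInv ε φ w K k v := by
  have := HasDerivAt.mul_sub_le_sub hxv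
    (fun r hr => h.hasDerivAt_barrierInv hw hk hkK (hr.2.trans hv)) (C := 0)
    fun r hr => inv_nonneg.2 (hk.le.trans (h.le_barrierSlope hw hkK (hr.2.trans hv)))
  linarith

lemma barrierInv_upper_of_nonneg (h : IsUregInverse ε φ) (hw : 0 < w) (hk : 0 < k) (hkK : k < K)
    {v : ℝ} (hv : 0 ≤ v) (hvw : v ≤ w) : barrierInv ε φ w K k v ≤ v / k := by
  have := HasDerivAt.sub_le_mul_sub hv
    (fun r hr => h.hasDerivAt_barrierInv hw hk hkK (hr.2.trans hvw)) (C := k⁻¹)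
    fun r hr => inv_anti₀ hk (h.le_barrierSlope hw hkK (hr.2.trans hvw))
  rw [barrierInv_zero] at this
  rw [div_eq_inv_mul]
  linarith

lemma barrierInv_lower_of_le (h : IsUregInverse ε φ) (hw : 0 < w) (hk : 0 < k) (hkK : k < K)
    {ρ v : ℝ} (hρ : 0 ≤ ρ) (hv : ρ ≤ v) (hvw : v ≤ w)
    (hs : barrierSlope ε φ w K k ρ ≤ 2 * k) :
    (v - ρ) / (2 * k) ≤ barrierInv ε φ w K k v := by
  have h0 := h.barrierInv_mono hw hk hkK hρ (hv.trans hvw)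
  have := HasDerivAt.mul_sub_le_sub hv
    (fun r hr => h.hasDerivAt_barrierInv hw hk hkK (hr.2.trans hvw)) (C := (2 * k)⁻¹)
    fun r hr => inv_anti₀ (hk.trans_le (h.le_barrierSlope hw hkK (hr.2.trans hvw)))
      ((h.antitone_barrierSlope hw hkK hr.1).trans hs)
  rw [barrierInv_zero] at h0
  rw [div_eq_inv_mul]
  linarith

end IsUregInverse

namespace RegProblem

variable {a b T x₁ ε w : ℝ} {φ v₀ : ℝ → ℝ} {v : ℝ → ℝ → ℝ}

lemma w_pos (h : RegProblem a b T x₁ ε φ w v₀ v) : 0 < w := (h.inv.Ureg_one_bounds h.one).1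

lemma travelling_barrier (h : RegProblem a b T x₁ ε φ w v₀ v) {K k y : ℝ} (hk : 0 < k)
    (hkK : k < K) (hK : 2 * (b - a) ≤ K) (hy : y ∈ Icc a b)
    (hinit : ∀ x ∈ Icc a b, (x - y) + (x - y) ^ 2 / (2 * K) ≤ barrierInv ε φ w K k (v₀ x)) :
    ∀ x ∈ Icc a b, ∀ t ∈ Icc 0 T,
      (x - y) + (x - y) ^ 2 / (2 * K) - 4 * ((K - k) / regPrim ε φ w) * t
        ≤ barrierInv ε φ w K k (v x t) := by
  intro x hx t ht
  have hw := h.w_pos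
  have hK0 : 0 < K := hk.trans hkK
  set σ := (K - k) / regPrim ε φ w with hσ
  have hσ0 : 0 < σ := div_pos (sub_pos.2 hkK) (h.inv.regPrim_pos hw)
  have hY : ∀ {r}, r ≤ w → HasDerivAt (barrierInv ε φ w K k) (barrierSlope ε φ w K k r)⁻¹ r :=
    fun hr => h.inv.hasDerivAt_barrierInv hw hk hkK hr
  have key := parabolic_max_principle_Icc
    (D := fun x t => (x - y) + (x - y) ^ 2 / (2 * K) - 4 * σ * t - barrierInv ε φ w K k (v x t))
    (c := a) (d := b) (s := 0) (T := T) 0 ?_ ?_ ?_ ?_ ?_ x hx t ht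
  · linarith
  · refine ContinuousOn.sub (by fun_prop) fun p hp => ?_
    exact ContinuousAt.comp_continuousWithinAt (f := fun p : ℝ × ℝ => v p.1 p.2)
      (hY (h.le_w _ hp.1 _ hp.2)).continuousAt (h.sol.cont p hp)
  · intro x hx
    have := hinit x hx
    rw [h.sol.init x hx]
    linarith
  · intro t ht
    have := hinit a h.a_mem
    rw [h.left] at this
    rw [h.sol.bdry_a t ht]
    nlinarith [mul_pos hσ0 ht.1]
  · intro t ht
    have := hinit b h.b_mem
    rw [h.right] at this
    rw [h.sol.bdry_b t ht]
    nlinarith [mul_pos hσ0 ht.1]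
  · intro x hx t ht hpos hmax
    have hxI := Ioo_subset_Icc_self hx
    have htI := Ioc_subset_Icc_self ht
    have hvw := h.le_w x hxI t htI
    have hp := h.inv.le_barrierSlope hw hkK hvw
    have hp0 := hk.trans_le hp
    have hξ : ∀ z, HasDerivAt (fun z => (z - y) + (z - y) ^ 2 / (2 * K) - 4 * σ * t)
        (1 + (z - y) / K) z := by
      intro z
      have h1 := (hasDerivAt_id z).sub_const y
      have := (h1.add ((h1.pow 2).div_const (2 * K))).sub_const (4 * σ * t)
      refine this.congr_deriv ?_
      simp
      field_simp
    have hξ' : HasDerivAt (fun z => 1 + (z - y) / K) (1 / K) x :=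
      (((hasDerivAt_id x).sub_const y).div_const K).const_add 1
    have hA := h.inv.regDiff_pos (v x t)
    have hslope : HasDerivAt (fun z => (barrierSlope ε φ w K k (v z t))⁻¹ * pdx v z t)
        (-(-(σ * (regDiff ε φ (v x t))⁻¹) * pdx v x t) / barrierSlope ε φ w K k (v x t) ^ 2
            * pdx v x t
          + (barrierSlope ε φ w K k (v x t))⁻¹ * pdxx v x t) x := by
      have h1 := (h.inv.hasDerivAt_barrierSlope (w := w) (K := K) (k := k) (v x t)).comp x
        (h.hasDerivAt_x hx ht)
      exact (h1.inv hp0.ne').mul (h.hasDerivAt_xx hx ht)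
    obtain ⟨h1, h2⟩ := second_derivative_test
      (g' := fun z => (1 + (z - y) / K) - (barrierSlope ε φ w K k (v z t))⁻¹ * pdx v z t) hmax
      (by
        filter_upwards [Ioo_mem_nhds hx.1 hx.2] with z hz
        have h1 := (hY (h.le_w z (Ioo_subset_Icc_self hz) t htI)).comp z (h.hasDerivAt_x hz ht)
        exact (hξ z).sub h1)
      (hξ'.sub hslope)
    have hd := ((((hasDerivAt_id t).const_mul (4 * σ)).const_sub
      ((x - y) + (x - y) ^ 2 / (2 * K))).hasDerivWithinAt (s := Iic T)).sub
      ((hY hvw).comp_hasDerivWithinAt t (h.hasDerivWithinAt_t hx ht))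
    refine ⟨_, hd, ?_⟩
    rw [h.pde hx ht, zero_mul]
    set p := barrierSlope ε φ w K k (v x t)
    set A := regDiff ε φ (v x t)
    set q := pdx v x t
    set F := regReac ε φ (v x t) with hF
    set g := 1 + (x - y) / K with hg
    have hq : q = p * g := by
      have : g = p⁻¹ * q := by linarith
      rw [this]
      field_simp
    have hg2 : g ^ 2 ≤ 9 / 4 := by
      have e1 : |(x - y) / K| ≤ 1 / 2 := by
        rw [abs_div, abs_of_pos hK0, div_le_iff₀ hK0, abs_le]
        constructor <;> linarith [hx.1, hx.2, hy.1, hy.2]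
      have := abs_le.1 e1
      nlinarith
    have h3 : 1 / K - σ * A⁻¹ * g ^ 2 ≤ p⁻¹ * pdxx v x t := by
      have e : -(-(σ * A⁻¹) * q) / p ^ 2 * q = σ * A⁻¹ * g ^ 2 := by
        rw [hq]
        field_simp
      rw [e] at h2
      linarith
    have h4 : A / K - σ * g ^ 2 ≤ p⁻¹ * (A * pdxx v x t) := by
      have := mul_le_mul_of_nonneg_left h3 hA.le
      have e : A * (1 / K - σ * A⁻¹ * g ^ 2) = A / K - σ * g ^ 2 := by
        field_simp
      rw [e] at this
      linarith
    have h5 : 0 ≤ A / K + p⁻¹ * F := by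
      have hab := abs_le.1 (h.abs_inv_le hxI htI)
      rcases le_total 0 (v x t) with hv | hv
      · exact add_nonneg (div_nonneg hA.le hK0.le)
          (mul_nonneg (inv_nonneg.2 hp0.le) (h.inv.regReac_nonneg hv hab.2))
      · have e1 : K ≤ p :=
          h.inv.barrierSlope_zero.symm.trans_le (h.inv.antitone_barrierSlope hw hkK hv)
        have e2 := (abs_le.1 (h.inv.regReac_le (h.abs_inv_le hxI htI))).1
        have e3 := mul_le_mul_of_nonneg_left e2 (inv_nonneg.2 hp0.le)
        have e4 := mul_le_mul_of_nonneg_right (inv_anti₀ hK0 e1) hA.le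
        rw [div_eq_inv_mul]
        linarith
    have h6 : σ * g ^ 2 ≤ σ * (9 / 4) := mul_le_mul_of_nonneg_left hg2 hσ0.le
    have h7 : p⁻¹ * (A * pdxx v x t + F) = p⁻¹ * (A * pdxx v x t) + p⁻¹ * F := by ring
    rw [h7]
    linarith

lemma stationary_barrier (h : RegProblem a b T x₁ ε φ w v₀ v) {c K : ℝ} (hc : c ∈ Ioo a b)
    (hneg : ∀ t ∈ Icc 0 T, v c t ≤ 0)
    (hinit : ∀ x ∈ Icc c b, v₀ x ≤ K * (x - c) - (x - c) ^ 2 / 2) :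
    ∀ x ∈ Icc c b, ∀ t ∈ Icc 0 T, v x t ≤ K * (x - c) - (x - c) ^ 2 / 2 := by
  intro x hx t ht
  have hsub : Icc c b ⊆ Icc a b := Icc_subset_Icc_left hc.1.le
  have key := parabolic_max_principle_Icc
    (D := fun x t => v x t - (K * (x - c) - (x - c) ^ 2 / 2)) (c := c) (d := b)
    (s := 0) (T := T) 1 ?_ ?_ ?_ ?_ ?_ x hx t ht
  · linarith
  · exact (h.sol.cont.mono (prod_mono_left hsub)).sub (by fun_prop)
  · intro x hx
    rw [h.sol.init x (hsub hx)]
    linarith [hinit x hx]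
  · intro t ht
    simpa using hneg t (Ioc_subset_Icc_self ht)
  · intro t ht
    have := hinit b (right_mem_Icc.2 hc.2.le)
    rw [h.right] at this
    rw [h.sol.bdry_b t ht]
    linarith
  · intro x hx t ht hpos hmax
    have hxI : x ∈ Ioo a b := ⟨hc.1.trans hx.1, hx.2⟩
    refine ⟨_, (h.hasDerivWithinAt_t hxI ht).sub_const _, ?_⟩
    obtain ⟨-, h2⟩ := h.touch hxI ht (ψ' := fun z => K - (z - c)) (ψ'' := -1)
      (Eventually.of_forall fun z => by
        have h1 := (hasDerivAt_id z).sub_const c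
        refine ((h1.const_mul K).sub ((h1.pow 2).div_const 2)).congr_deriv ?_
        simp)
      (((hasDerivAt_id x).sub_const c).const_sub K) hmax
    have e := (abs_le.1 (h.inv.regReac_le
      (h.abs_inv_le (Ioo_subset_Icc_self hxI) (Ioc_subset_Icc_self ht)))).2
    rw [h.pde hxI ht]
    nlinarith [h.inv.regDiff_pos (v x t)]

/-- Growth away from the initial value. -/
lemma quadratic_barrier (h : RegProblem a b T x₁ ε φ w v₀ v) (hε : ε ≤ 1) {y A K : ℝ}
    (hK : 0 ≤ K) (hinit : ∀ x ∈ Icc a b, v₀ x ≤ A + K * (x - y) ^ 2) :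
    ∀ x ∈ Icc a b, ∀ t ∈ Icc 0 T, v x t ≤ A + K * (x - y) ^ 2 + (4 * K + 2) * t := by
  intro x hx t ht
  have key := parabolic_max_principle_Icc
    (D := fun x t => v x t - (A + K * (x - y) ^ 2 + (4 * K + 2) * t)) (c := a) (d := b)
    (s := 0) (T := T) 1 (h.sol.cont.sub (by fun_prop)) ?_ ?_ ?_ ?_ x hx t ht
  · linarith
  · intro x hx
    rw [h.sol.init x hx]
    linarith [hinit x hx]
  · intro t ht
    have := hinit a h.a_mem
    rw [h.left] at this
    rw [h.sol.bdry_a t ht]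
    nlinarith [ht.1, mul_nonneg hK ht.1.le]
  · intro t ht
    have := hinit b h.b_mem
    rw [h.right] at this
    rw [h.sol.bdry_b t ht]
    nlinarith [ht.1, mul_nonneg hK ht.1.le]
  · intro x hx t ht hpos hmax
    have hd : HasDerivAt (fun r : ℝ => A + K * (x - y) ^ 2 + (4 * K + 2) * r) (4 * K + 2) t := by
      simpa using ((hasDerivAt_id t).const_mul (4 * K + 2)).const_add (A + K * (x - y) ^ 2)
    refine ⟨_, (h.hasDerivWithinAt_t hx ht).sub hd.hasDerivWithinAt, ?_⟩
    obtain ⟨-, h2⟩ := h.touch hx ht (ψ := fun z => A + K * (z - y) ^ 2 + (4 * K + 2) * t)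
      (ψ' := fun z => 2 * K * (z - y)) (ψ'' := 2 * K)
      (Eventually.of_forall fun z => by
        have h1 := (hasDerivAt_id z).sub_const y
        refine ((((h1.pow 2).const_mul K).const_add A).add_const _).congr_deriv ?_
        simp
        ring)
      (by simpa using ((hasDerivAt_id x).sub_const y).const_mul (2 * K)) hmax
    have h3 := h.abs_inv_le (Ioo_subset_Icc_self hx) (Ioc_subset_Icc_self ht)
    have h4 : regDiff ε φ (v x t) ≤ 2 := by
      have := (sq_le_one_iff_abs_le_one _).2 h3
      unfold regDiff
      linarith
    have e := (abs_le.1 (h.inv.regReac_le h3)).2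
    have hA := h.inv.regDiff_pos (v x t)
    rw [h.pde hx ht]
    nlinarith [mul_le_mul_of_nonneg_left h2 hA.le, mul_le_mul_of_nonneg_right h4 hK]

end RegProblem

/-! ### The family of regularised problems -/

/-- The data of the regularised problems for all `ε > 0`, with limiting initial value `u₀`. -/
structure RegFamily (a b T x₁ : ℝ) (u₀ : ℝ → ℝ) (Φ : ℝ → ℝ → ℝ) (u1 : ℝ → ℝ)
    (u0e : ℝ → ℝ → ℝ) (ue : ℝ → ℝ → ℝ → ℝ) : Prop where
  hab : a < b
  hT : 0 < T
  hx : x₁ ∈ Ioo a b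
  cont : ContinuousOn u₀ (Icc a b)
  mono : StrictMonoOn u₀ (Icc a b)
  left : u₀ a = -1
  right : u₀ b = 1
  zero : u₀ x₁ = 0
  prob : ∀ ε > 0, RegProblem a b T x₁ ε (Φ ε) (u1 ε) (u0e ε) (ue ε)
  conv : TendstoUniformlyOn u0e u₀ (𝓝[>] (0 : ℝ)) (Icc a b)

lemma eventually_pos_sqrt_lt {c : ℝ} (hc : 0 < c) : ∀ᶠ ε in 𝓝[>] (0 : ℝ), 0 < ε ∧ √ε < c := by
  refine (eventually_mem_nhdsWithin).and ?_
  have : Tendsto (fun ε : ℝ => √ε) (𝓝[>] 0) (𝓝 0) := by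
    simpa using (Real.continuous_sqrt.tendsto 0).mono_left nhdsWithin_le_nhds
  exact this.eventually_lt_const hc

lemma eventually_le_neg_log (c : ℝ) : ∀ᶠ ε in 𝓝[>] (0 : ℝ), c ≤ -Real.log ε / 2 := by
  have := Real.tendsto_log_nhdsGT_zero.eventually_le_atBot (-2 * c)
  filter_upwards [this] with ε h
  linarith

lemma log_sub_le_arsinh {ε s : ℝ} (hε : 0 < ε) (hs : 0 < s) :
    Real.log s - Real.log ε / 2 ≤ Real.arsinh (s / √ε) := by
  have h := Real.sqrt_pos.2 hε
  rw [← Real.log_sqrt hε.le, ← Real.log_div hs.ne' h.ne']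
  have : 0 ≤ √(1 + (s / √ε) ^ 2) := Real.sqrt_nonneg _
  exact Real.log_le_log (by positivity) (by linarith)

lemma arsinh_le_log_sub {ε s : ℝ} (hε : 0 < ε) (hs : √ε ≤ s) :
    Real.arsinh (s / √ε) ≤ Real.log (3 * s) - Real.log ε / 2 := by
  have h := Real.sqrt_pos.2 hε
  have hs0 : 0 < s := h.trans_le hs
  rw [← Real.log_sqrt hε.le, ← Real.log_div (by positivity) h.ne']
  have hz : 1 ≤ s / √ε := (one_le_div h).2 hs
  have : √(1 + (s / √ε) ^ 2) ≤ 2 * (s / √ε) := Real.sqrt_le_iff.2 ⟨by positivity, by nlinarith⟩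
  refine Real.log_le_log (by positivity) ?_
  rw [mul_div_assoc]
  linarith

lemma IsUregInverse.third_le {ε v : ℝ} {φ : ℝ → ℝ} (h : IsUregInverse ε φ) (hε : √ε ≤ 1)
    (hv : 0 ≤ v) (hv1 : v ≤ 1) : v / 3 ≤ φ v := by
  have h1 := h.le_sq_add hv
  have h2 := h.nonneg hv
  by_contra! h3
  nlinarith

namespace IsUregInverse

variable {ε w K k ρ : ℝ} {φ : ℝ → ℝ}

lemma neg_log_le_regPrim (h : IsUregInverse ε φ) (hw : φ w = 1) :
    -Real.log ε ≤ regPrim ε φ w := by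
  have := log_sub_le_arsinh h.pos one_pos
  rw [Real.log_one] at this
  rw [regPrim, hw]
  linarith

lemma regPrim_le_log (h : IsUregInverse ε φ) (hε : √ε ≤ 1) (hw : φ w = 1) :
    regPrim ε φ w ≤ 2 * Real.log 3 - Real.log ε := by
  have := arsinh_le_log_sub h.pos hε
  rw [mul_one] at this
  rw [regPrim, hw]
  linarith

lemma log_le_regPrim (h : IsUregInverse ε φ) (hε : √ε ≤ 1) (hρ : 0 < ρ) (hρ1 : ρ ≤ 1) :
    2 * Real.log (ρ / 3) - Real.log ε ≤ regPrim ε φ ρ := by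
  have h2 := log_sub_le_arsinh h.pos (s := ρ / 3) (by positivity)
  have h3 : Real.arsinh (ρ / 3 / √ε) ≤ Real.arsinh (φ ρ / √ε) :=
    Real.arsinh_le_arsinh.2 (by gcongr; exact h.third_le hε hρ.le hρ1)
  rw [regPrim]
  linarith

lemma barrierSlope_le_two_mul (h : IsUregInverse ε φ) (hε : √ε ≤ 1) (hw : φ w = 1) (hρ : 0 < ρ)
    (hρ1 : ρ ≤ 1) (hkK : k < K)
    (hl : (K - 2 * k) * Real.log 3 - (K - k) * Real.log (ρ / 3) ≤ k * (-Real.log ε / 2)) :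
    barrierSlope ε φ w K k ρ ≤ 2 * k := by
  have hΓ0 := h.regPrim_pos (h.Ureg_one_bounds hw).1
  rw [barrierSlope, div_mul_eq_mul_div, sub_le_iff_le_add, ← sub_le_iff_le_add', le_div_iff₀ hΓ0]
  rcases le_total 0 (K - 2 * k) with hK2 | hK2
  · have e1 := mul_le_mul_of_nonneg_left (h.regPrim_le_log hε hw) hK2
    have e2 := mul_le_mul_of_nonneg_left (h.log_le_regPrim hε hρ hρ1) (sub_nonneg.2 hkK.le)
    linarith
  · exact (mul_nonpos_of_nonpos_of_nonneg hK2 hΓ0.le).trans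
      (mul_nonneg (sub_nonneg.2 hkK.le) (h.regPrim_pos hρ).le)

end IsUregInverse

namespace RegFamily

variable {a b T x₁ : ℝ} {u₀ : ℝ → ℝ} {Φ : ℝ → ℝ → ℝ} {u1 : ℝ → ℝ} {u0e : ℝ → ℝ → ℝ}
  {ue : ℝ → ℝ → ℝ → ℝ}

lemma reflect (h : RegFamily a b T x₁ u₀ Φ u1 u0e ue) :
    RegFamily (-b) (-a) T (-x₁) (fun x => -u₀ (-x)) Φ u1 (fun ε x => -u0e ε (-x))
      (fun ε => _root_.reflect (ue ε)) where
  hab := neg_lt_neg h.hab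
  hT := h.hT
  hx := ⟨neg_lt_neg h.hx.2, neg_lt_neg h.hx.1⟩
  cont := (h.cont.comp (continuous_neg.continuousOn) fun x hx => neg_mem_Icc hx).neg
  mono x hx y hy hxy := neg_lt_neg (h.mono (neg_mem_Icc hy) (neg_mem_Icc hx) (neg_lt_neg hxy))
  left := by simp [h.right]
  right := by simp [h.left]
  zero := by simp [h.zero]
  prob ε hε := (h.prob ε hε).reflect
  conv := by
    rw [Metric.tendstoUniformlyOn_iff]
    intro θ hθ
    filter_upwards [Metric.tendstoUniformlyOn_iff.1 h.conv θ hθ] with ε hε x hx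
    simpa [dist_neg_neg] using hε (-x) (neg_mem_Icc hx)

lemma a_mem (h : RegFamily a b T x₁ u₀ Φ u1 u0e ue) : a ∈ Icc a b := left_mem_Icc.2 h.hab.le

lemma b_mem (h : RegFamily a b T x₁ u₀ Φ u1 u0e ue) : b ∈ Icc a b := right_mem_Icc.2 h.hab.le

lemma abs_init_sub_lt (h : RegFamily a b T x₁ u₀ Φ u1 u0e ue) {θ : ℝ} (hθ : 0 < θ) :
    ∀ᶠ ε in 𝓝[>] (0 : ℝ), ∀ x ∈ Icc a b, |u0e ε x - u₀ x| < θ := by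
  filter_upwards [Metric.tendstoUniformlyOn_iff.1 h.conv θ hθ] with ε hε x hx
  rw [← Real.dist_eq, dist_comm]
  exact hε x hx

lemma lower_right (h : RegFamily a b T x₁ u₀ Φ u1 u0e ue) {η : ℝ} (hη : 0 < η)
    (hηb : x₁ + η ≤ b) :
    ∃ m > 0, ∀ᶠ ε in 𝓝[>] (0 : ℝ), ∀ x ∈ Icc (x₁ + η) b, ∀ t ∈ Icc 0 T, m ≤ ue ε x t := by
  have hax := h.hx.1
  have hL : 0 < b - a := sub_pos.2 h.hab
  set y := x₁ + η / 2 with hy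
  have hyI : y ∈ Icc a b := ⟨by linarith, by linarith⟩
  set m₀ := u₀ y with hm₀
  have hm0 : 0 < m₀ := by
    rw [← h.zero]; exact h.mono (Ioo_subset_Icc_self h.hx) hyI (by linarith)
  have hm1 : m₀ ≤ 1 := by rw [← h.right]; exact h.mono.monotoneOn hyI h.b_mem hyI.2
  set K := 8 / η + 2 * (b - a) with hK
  set k := m₀ / (16 * (b - a)) with hk
  have hk0 : 0 < k := by positivity
  have h8 : 8 / (b - a) ≤ 8 / η := by gcongr; linarith
  have hkK : k < K := by
    have : k ≤ 8 / (b - a) := by rw [hk, div_le_div_iff₀ (by positivity) hL]; nlinarith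
    linarith
  have hη8 : 0 < 8 / η := by positivity
  have hK0 : 0 < K := by linarith
  have hKη : 8 ≤ K * η := by
    have : 8 / η * η = 8 := by field_simp
    nlinarith
  set ρ := m₀ / 4 with hρ
  refine ⟨k * η / 4, by positivity, ?_⟩
  filter_upwards [h.abs_init_sub_lt (half_pos hm0), eventually_pos_sqrt_lt (c := 1 / 2) (by positivity), eventually_le_neg_log (((K - 2 * k) * Real.log 3 - (K - k) * Real.log (ρ / 3)) / k),
    eventually_le_neg_log (8 * (K - k) * T / η)] with ε hinit hε hl1 hl2
  obtain ⟨hε0, hε1⟩ := hε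
  have hP := h.prob ε hε0
  set w := u1 ε
  have hw := hP.w_pos
  have hw2 : w ≤ 2 := by
    have := (hP.inv.Ureg_one_bounds hP.one).2.2
    linarith [hε1]
  have hε2 : √ε ≤ 1 := by linarith [hε1]
  have hΓ0 := hP.inv.regPrim_pos hw
  have hΓ' := hP.inv.neg_log_le_regPrim hP.one
  have hslope : barrierSlope ε (Φ ε) w K k ρ ≤ 2 * k :=
    hP.inv.barrierSlope_le_two_mul hε2 hP.one (by positivity) (by rw [hρ]; linarith) hkK
      (by rwa [div_le_iff₀' hk0] at hl1)
  have hσ : 4 * ((K - k) / regPrim ε (Φ ε) w) * T ≤ η / 4 := by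
    rw [div_le_iff₀ hη] at hl2
    rw [mul_div_assoc', div_mul_eq_mul_div, div_le_iff₀ hΓ0]
    have := mul_le_mul_of_nonneg_right hΓ' hη.le
    linarith
  have hquad : ∀ x ∈ Icc a b, |(x - y) / (2 * K)| ≤ 1 / 4 := fun x hx => by
    rw [abs_div, abs_of_pos (by positivity : 0 < 2 * K), div_le_iff₀ (by positivity), abs_le]
    constructor <;> linarith [hx.1, hx.2, hyI.1, hyI.2]
  have hxi : ∀ x, (x - y) + (x - y) ^ 2 / (2 * K) = (x - y) * (1 + (x - y) / (2 * K)) :=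
    fun x => by ring
  have key := hP.travelling_barrier (y := y) hk0 hkK (by linarith) hyI fun x hx => by
    have hq := abs_le.1 (hquad x hx)
    rw [hxi]
    have hvw : u0e ε x ≤ w := by rw [← hP.right]; exact hP.monotoneOn_init hx hP.b_mem hx.2
    rcases le_total y x with hyx | hxy
    · have e1 := hP.monotoneOn_init hyI hx hyx
      have e2 := (abs_lt.1 (hinit y hyI)).1
      have e3 : m₀ / 2 ≤ u0e ε x := by linarith
      have e4 := hP.inv.barrierInv_lower_of_le (v := u0e ε x) hw hk0 hkK (by positivity : 0 ≤ ρ)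
        (by rw [hρ]; linarith) hvw hslope
      have e5 : 2 * (b - a) ≤ (u0e ε x - ρ) / (2 * k) := by
        rw [le_div_iff₀ (by positivity), hk]
        have : 2 * (b - a) * (2 * (m₀ / (16 * (b - a)))) = m₀ / 4 := by field_simp; norm_num
        rw [this, hρ]
        linarith
      nlinarith [hx.2, hyI.1]
    · have e0 : (x - y) * (1 + (x - y) / (2 * K)) ≤ 3 / 4 * (x - y) := by nlinarith
      rcases le_total x₁ x with h1 | h1
      · have e1 := hP.monotoneOn_init (Ioo_subset_Icc_self h.hx) hx h1
        rw [hP.zero] at e1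
        have := hP.inv.barrierInv_mono hw hk0 hkK e1 hvw
        rw [IsUregInverse.barrierInv_zero] at this
        linarith
      · have e1 := hP.monotoneOn_init hx (Ioo_subset_Icc_self h.hx) h1
        rw [hP.zero] at e1
        have e2 := hP.inv.barrierInv_lower_of_nonpos hw hk0 hkK e1
        have e3 := hP.monotoneOn_init hP.a_mem hx hx.1
        rw [hP.left] at e3
        have e4 : -(η / 4) ≤ u0e ε x / K := by
          rw [le_div_iff₀ hK0]
          linarith
        linarith
  intro x hx t ht
  have hxI : x ∈ Icc a b := ⟨by linarith [hx.1], hx.2⟩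
  have hk1 := key x hxI t ht
  have hσ0 : 0 ≤ (K - k) / regPrim ε (Φ ε) w := div_nonneg (sub_nonneg.2 hkK.le) hΓ0.le
  have e1 : η / 4 ≤ barrierInv ε (Φ ε) w K k (ue ε x t) := by
    have : 0 ≤ (x - y) ^ 2 / (2 * K) := by positivity
    have e2 : 4 * ((K - k) / regPrim ε (Φ ε) w) * t ≤ 4 * ((K - k) / regPrim ε (Φ ε) w) * T := by
      gcongr; exact ht.2
    linarith [hx.1]
  rcases le_total (ue ε x t) 0 with hv | hv
  · linarith [hP.inv.barrierInv_upper_of_nonpos hw hk0 hkK hv]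
  · have := e1.trans (hP.inv.barrierInv_upper_of_nonneg hw hk0 hkK hv (hP.le_w x hxI t ht))
    rw [le_div_iff₀ hk0] at this
    linarith

end RegFamily

namespace RegFamily

variable {a b T x₁ : ℝ} {u₀ : ℝ → ℝ} {Φ : ℝ → ℝ → ℝ} {u1 : ℝ → ℝ} {u0e : ℝ → ℝ → ℝ}
  {ue : ℝ → ℝ → ℝ → ℝ}

lemma upper_left (h : RegFamily a b T x₁ u₀ Φ u1 u0e ue) {η : ℝ} (hη : 0 < η)
    (hηa : a ≤ x₁ - η) :
    ∃ m > 0, ∀ᶠ ε in 𝓝[>] (0 : ℝ), ∀ x ∈ Icc a (x₁ - η), ∀ t ∈ Icc 0 T, ue ε x t ≤ -m := by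
  obtain ⟨m, hm, H⟩ := h.reflect.lower_right hη (by linarith)
  refine ⟨m, hm, H.mono fun ε hε x hx t ht => ?_⟩
  have := hε (-x) ⟨by linarith [hx.2], by linarith [hx.1]⟩ t ht
  simp only [_root_.reflect, neg_neg] at this
  linarith

lemma upper_near (h : RegFamily a b T x₁ u₀ Φ u1 u0e ue) {θ : ℝ} (hθ : 0 < θ) :
    ∃ r > 0, x₁ + r < b ∧ ∀ᶠ ε in 𝓝[>] (0 : ℝ), ∀ x ∈ Icc a (x₁ + r), ∀ t ∈ Icc 0 T,
      ue ε x t ≤ θ := by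
  wlog hθ1 : θ ≤ 1 generalizing θ
  · obtain ⟨r, hr, hrb, H⟩ := this one_pos le_rfl
    exact ⟨r, hr, hrb, H.mono fun ε hε x hx t ht => (hε x hx t ht).trans (not_le.1 hθ1).le⟩
  have hx₁ := Ioo_subset_Icc_self h.hx
  have hL : 0 < b - a := sub_pos.2 h.hab
  obtain ⟨ρ, hρ, hρa, hρb, hρu⟩ : ∃ ρ > 0, ρ ≤ x₁ - a ∧ x₁ + ρ ≤ b ∧ u₀ (x₁ + ρ) ≤ θ / 8 := by
    have hc := Metric.continuousWithinAt_iff.1 (h.cont x₁ hx₁) (θ / 8) (by positivity)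
    obtain ⟨d, hd, H⟩ := hc
    have h1 : 0 < x₁ - a := sub_pos.2 h.hx.1
    have h2 : 0 < b - x₁ := sub_pos.2 h.hx.2
    have h3 : 0 < min (d / 2) (min (x₁ - a) (b - x₁)) := by positivity
    have h4 := min_le_left (d / 2) (min (x₁ - a) (b - x₁))
    have h5 := (min_le_right (d / 2) (min (x₁ - a) (b - x₁))).trans (min_le_left _ _)
    have h6 := (min_le_right (d / 2) (min (x₁ - a) (b - x₁))).trans (min_le_right _ _)
    refine ⟨_, h3, h5, by linarith, ?_⟩
    have := @H (x₁ + min (d / 2) (min (x₁ - a) (b - x₁))) ⟨by linarith [h.hx.1], by linarith⟩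
      (by rw [Real.dist_eq, add_sub_cancel_left, abs_of_pos h3]; linarith)
    rw [h.zero, Real.dist_eq, sub_zero] at this
    exact (abs_lt.1 this).2.le
  set K := 8 / ρ + (b - a) with hK
  have h8 : 8 / ρ * ρ = 8 := by field_simp
  have h80 : 0 < 8 / ρ := by positivity
  have hK0 : 0 < K := by positivity
  set η := θ / (2 * K) with hη
  have hη0 : 0 < η := by positivity
  have hηK : η * (2 * K) = θ := by rw [hη]; field_simp
  have hηρ : η < ρ := by
    rw [hη, div_lt_iff₀ (by positivity)]
    nlinarith
  set c := x₁ - η with hc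
  have hcI : c ∈ Ioo a b := ⟨by linarith, by linarith [h.hx.2]⟩
  obtain ⟨m, hm, hneg⟩ := h.upper_left hη0 (by linarith : a ≤ x₁ - η)
  refine ⟨η, hη0, by linarith, ?_⟩
  filter_upwards [hneg, h.abs_init_sub_lt (by positivity : 0 < θ / 8),
    eventually_pos_sqrt_lt (c := 1 / 2) (by positivity)] with ε hneg hinit hε
  have hP := h.prob ε hε.1
  have hw2 : u1 ε ≤ 2 := by linarith [(hP.inv.Ureg_one_bounds hP.one).2.2, hε.2]
  have key := hP.stationary_barrier (K := K) hcI
    (fun t ht => (hneg c ⟨hcI.1.le, le_rfl⟩ t ht).trans (by linarith)) fun x hx => by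
    have hxI : x ∈ Icc a b := ⟨by linarith [hcI.1, hx.1], hx.2⟩
    have hB : (x - c) * (8 / ρ + (b - a) / 2) ≤ K * (x - c) - (x - c) ^ 2 / 2 := by
      have : 0 ≤ (x - c) * ((b - a) - (x - c)) :=
        mul_nonneg (by linarith [hx.1]) (by linarith [hx.2, hcI.1])
      rw [hK]
      linarith
    refine le_trans ?_ hB
    have hxc := sub_nonneg.2 hx.1
    rcases le_total x x₁ with h1 | h1
    · have := hP.monotoneOn_init hxI hx₁ h1
      rw [hP.zero] at this
      exact this.trans (by positivity)
    rcases le_total x (x₁ + ρ) with h2 | h2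
    · have e1 := hP.monotoneOn_init hxI ⟨by linarith [hx₁.1], hρb⟩ h2
      have e2 := (abs_lt.1 (hinit (x₁ + ρ) ⟨by linarith [hx₁.1], hρb⟩)).2
      have e3 : η * (K / 2) ≤ (x - c) * (8 / ρ + (b - a) / 2) := by
        gcongr
        · linarith
        · rw [hK]; linarith
      linarith
    · have e1 := hP.monotoneOn_init hxI hP.b_mem hxI.2
      rw [hP.right] at e1
      have e2 : ρ * (8 / ρ) ≤ (x - c) * (8 / ρ + (b - a) / 2) := by
        gcongr
        · linarith
        · linarith
      linarith
  intro x hx t ht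
  have hr : x₁ + η ∈ Icc c b := ⟨by linarith, by linarith⟩
  have e1 := key (x₁ + η) hr t ht
  have e2 := (hP.strictMonoOn ht).monotoneOn ⟨hx.1, hx.2.trans hr.2⟩
    ⟨hcI.1.le.trans hr.1, hr.2⟩ hx.2
  have e3 : x₁ + η - c = 2 * η := by rw [hc]; ring
  rw [e3] at e1
  nlinarith [sq_nonneg η]

lemma initial_upper (h : RegFamily a b T x₁ u₀ Φ u1 u0e ue) {θ : ℝ} (hθ : 0 < θ) :
    ∃ L > 0, ∀ᶠ ε in 𝓝[>] (0 : ℝ), ∀ x ∈ Icc a b, ∀ t ∈ Icc 0 T,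
      ue ε x t ≤ u₀ x + θ + L * t := by
  obtain ⟨d, hd, hU⟩ := Metric.uniformContinuousOn_iff.1
    (isCompact_Icc.uniformContinuousOn_of_continuous h.cont) (θ / 2) (half_pos hθ)
  set K := 2 / d ^ 2 with hK
  have hK0 : 0 < K := by positivity
  refine ⟨4 * K + 2, by positivity, ?_⟩
  filter_upwards [h.abs_init_sub_lt (half_pos hθ),
    eventually_pos_sqrt_lt (c := 1) (by positivity)] with ε hinit hε x hx t ht
  have hP := h.prob ε hε.1
  have := hP.quadratic_barrier (by nlinarith [Real.sq_sqrt hε.1.le, Real.sqrt_nonneg ε])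
    (y := x) (A := u₀ x + θ) hK0.le (fun z hz => ?_) x hx t ht
  · simpa using this
  have e1 := (abs_lt.1 (hinit z hz)).2
  have e4 : 0 ≤ K * (z - x) ^ 2 := by positivity
  rcases lt_or_ge (dist z x) d with hzx | hzx
  · have := hU z hz x hx hzx
    rw [Real.dist_eq] at this
    linarith [(abs_lt.1 this).2]
  · have e2 : u₀ z ≤ 1 := by rw [← h.right]; exact h.mono.monotoneOn hz h.b_mem hz.2
    have e3 : -1 ≤ u₀ x := by rw [← h.left]; exact h.mono.monotoneOn h.a_mem hx hx.1
    have e5 : 2 ≤ K * (z - x) ^ 2 := by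
      rw [hK, div_mul_eq_mul_div, le_div_iff₀ (by positivity), ← sq_abs (z - x), ← Real.dist_eq]
      gcongr
    linarith

lemma initial_lower (h : RegFamily a b T x₁ u₀ Φ u1 u0e ue) {θ : ℝ} (hθ : 0 < θ) :
    ∃ L > 0, ∀ᶠ ε in 𝓝[>] (0 : ℝ), ∀ x ∈ Icc a b, ∀ t ∈ Icc 0 T,
      u₀ x - θ - L * t ≤ ue ε x t := by
  obtain ⟨L, hL, H⟩ := h.reflect.initial_upper hθ
  refine ⟨L, hL, H.mono fun ε hε x hx t ht => ?_⟩
  have := hε (-x) ⟨by linarith [hx.2], by linarith [hx.1]⟩ t ht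
  simp only [_root_.reflect, neg_neg] at this
  linarith

end RegFamily

/-! ### Comparison with the limit solution -/

namespace RegProblem

variable {a b T x₁ ε w : ℝ} {φ v₀ : ℝ → ℝ} {v : ℝ → ℝ → ℝ}

lemma le_of_supersolution (h : RegProblem a b T x₁ ε φ w v₀ v) (hw : w ≤ 4)
    {c d s C c₀ : ℝ} (hcd : Icc c d ⊆ Icc a b) (hs : 0 ≤ s) {V Vx Vxx Vt : ℝ → ℝ → ℝ}
    (hVc : ContinuousOn (fun p : ℝ × ℝ => V p.1 p.2) (Icc c d ×ˢ Icc s T))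
    (hVx : ∀ x ∈ Ioo c d, ∀ t ∈ Ioc s T, HasDerivAt (fun y => V y t) (Vx x t) x)
    (hVxx : ∀ x ∈ Ioo c d, ∀ t ∈ Ioc s T, HasDerivAt (fun y => Vx y t) (Vxx x t) x)
    (hVt : ∀ x ∈ Ioo c d, ∀ t ∈ Ioc s T, HasDerivWithinAt (fun r => V x r) (Vt x t) (Iic T) t)
    (hV0 : ∀ x ∈ Ioo c d, ∀ t ∈ Ioc s T, 0 ≤ V x t)
    (hC : ∀ x ∈ Ioo c d, ∀ t ∈ Ioc s T, |Vxx x t| ≤ C)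
    (hres : ∀ x ∈ Ioo c d, ∀ t ∈ Ioc s T, V x t * Vxx x t + V x t * (1 - V x t) + c₀ ≤ Vt x t)
    (hsmall : (ε + 4 * √ε) * C + 36 * √ε < c₀)
    (hinit : ∀ x ∈ Icc c d, v x s ≤ V x s)
    (hleft : ∀ t ∈ Ioc s T, v c t ≤ V c t) (hright : ∀ t ∈ Ioc s T, v d t ≤ V d t) :
    ∀ x ∈ Icc c d, ∀ t ∈ Icc s T, v x t ≤ V x t := by
  intro x hx t ht
  have key := parabolic_max_principle_Icc
    (D := fun x t => v x t - V x t) (c := c) (d := d)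
    (s := s) (T := T) (C + 1)
    ((h.sol.cont.mono (prod_mono hcd (Icc_subset_Icc_left hs))).sub hVc)
    (fun x hx => sub_nonpos.2 (hinit x hx)) (fun t ht => sub_nonpos.2 (hleft t ht))
    (fun t ht => sub_nonpos.2 (hright t ht)) ?_ x hx t ht
  · linarith
  intro x hx t ht hpos hmax
  have hxI : x ∈ Ioo a b := by
    have h1 := hcd (left_mem_Icc.2 (hx.1.trans hx.2).le)
    have h2 := hcd (right_mem_Icc.2 (hx.1.trans hx.2).le)
    exact ⟨h1.1.trans_lt hx.1, hx.2.trans_le h2.2⟩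
  have htI : t ∈ Ioc 0 T := ⟨hs.trans_lt ht.1, ht.2⟩
  refine ⟨_, (h.hasDerivWithinAt_t hxI htI).sub (hVt x hx t ht), ?_⟩
  obtain ⟨-, h2⟩ := h.touch hxI htI (ψ := fun z => V z t)
    (by filter_upwards [Ioo_mem_nhds hx.1 hx.2] with z hz using hVx z hz t ht)
    (hVxx x hx t ht) hmax
  rw [h.pde hxI htI]
  have e0 := hV0 x hx t ht
  have e1 : 0 ≤ v x t := by linarith
  have e2 : v x t ≤ 4 := (h.le_w x (Ioo_subset_Icc_self hxI) t (Ioc_subset_Icc_self htI)).trans hw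
  have e3 := h.inv.abs_regDiff_sub_le e1 e2
  have e4 := (abs_le.1 (h.inv.abs_regReac_sub_le e1 e2)).2
  have e5 := mul_le_mul_of_nonneg_left h2 (h.inv.regDiff_pos (v x t)).le
  have e6 : (regDiff ε φ (v x t) - v x t) * Vxx x t ≤ (ε + 4 * √ε) * C := by
    refine (le_abs_self _).trans ?_
    rw [abs_mul]
    gcongr
    · exact (abs_nonneg _).trans e3
    · exact hC x hx t ht
  have e7 : (v x t - V x t) * Vxx x t ≤ (v x t - V x t) * C :=
    mul_le_mul_of_nonneg_left ((le_abs_self _).trans (hC x hx t ht)) hpos.le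
  have e8 : (v x t - V x t) * (1 - v x t - V x t) ≤ (v x t - V x t) * 1 :=
    mul_le_mul_of_nonneg_left (by linarith) hpos.le
  linarith [hres x hx t ht]

lemma ge_of_subsolution (h : RegProblem a b T x₁ ε φ w v₀ v) (hw : w ≤ 4)
    {c d s C c₀ : ℝ} (hcd : Icc c d ⊆ Icc a b) (hs : 0 ≤ s) {V Vx Vxx Vt : ℝ → ℝ → ℝ}
    (hVc : ContinuousOn (fun p : ℝ × ℝ => V p.1 p.2) (Icc c d ×ˢ Icc s T))
    (hVx : ∀ x ∈ Ioo c d, ∀ t ∈ Ioc s T, HasDerivAt (fun y => V y t) (Vx x t) x)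
    (hVxx : ∀ x ∈ Ioo c d, ∀ t ∈ Ioc s T, HasDerivAt (fun y => Vx y t) (Vxx x t) x)
    (hVt : ∀ x ∈ Ioo c d, ∀ t ∈ Ioc s T, HasDerivWithinAt (fun r => V x r) (Vt x t) (Iic T) t)
    (hv0 : ∀ x ∈ Ioo c d, ∀ t ∈ Ioc s T, 0 ≤ v x t)
    (hC : ∀ x ∈ Ioo c d, ∀ t ∈ Ioc s T, |Vxx x t| ≤ C)
    (hres : ∀ x ∈ Ioo c d, ∀ t ∈ Ioc s T, Vt x t + c₀ ≤ V x t * Vxx x t + V x t * (1 - V x t))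
    (hsmall : (ε + 4 * √ε) * C + 36 * √ε < c₀)
    (hinit : ∀ x ∈ Icc c d, V x s ≤ v x s)
    (hleft : ∀ t ∈ Ioc s T, V c t ≤ v c t) (hright : ∀ t ∈ Ioc s T, V d t ≤ v d t) :
    ∀ x ∈ Icc c d, ∀ t ∈ Icc s T, V x t ≤ v x t := by
  intro x hx t ht
  have key := parabolic_max_principle_Icc
    (D := fun x t => V x t - v x t) (c := c) (d := d)
    (s := s) (T := T) (C + 1)
    (hVc.sub (h.sol.cont.mono (prod_mono hcd (Icc_subset_Icc_left hs))))
    (fun x hx => sub_nonpos.2 (hinit x hx)) (fun t ht => sub_nonpos.2 (hleft t ht))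
    (fun t ht => sub_nonpos.2 (hright t ht)) ?_ x hx t ht
  · linarith
  intro x hx t ht hpos hmax
  have hxI : x ∈ Ioo a b := by
    have h1 := hcd (left_mem_Icc.2 (hx.1.trans hx.2).le)
    have h2 := hcd (right_mem_Icc.2 (hx.1.trans hx.2).le)
    exact ⟨h1.1.trans_lt hx.1, hx.2.trans_le h2.2⟩
  have htI : t ∈ Ioc 0 T := ⟨hs.trans_lt ht.1, ht.2⟩
  refine ⟨_, (hVt x hx t ht).sub (h.hasDerivWithinAt_t hxI htI), ?_⟩
  obtain ⟨-, h2⟩ := h.touch' hxI htI (ψ := fun z => V z t)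
    (by filter_upwards [Ioo_mem_nhds hx.1 hx.2] with z hz using hVx z hz t ht)
    (hVxx x hx t ht) hmax
  rw [h.pde hxI htI]
  have e1 := hv0 x hx t ht
  have e0 : 0 ≤ V x t := by linarith
  have e2 : v x t ≤ 4 := (h.le_w x (Ioo_subset_Icc_self hxI) t (Ioc_subset_Icc_self htI)).trans hw
  have e3 := h.inv.abs_regDiff_sub_le e1 e2
  have e4 := (abs_le.1 (h.inv.abs_regReac_sub_le e1 e2)).1
  have e5 := mul_le_mul_of_nonneg_left h2 (h.inv.regDiff_pos (v x t)).le
  have e6 : -((regDiff ε φ (v x t) - v x t) * Vxx x t) ≤ (ε + 4 * √ε) * C := by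
    refine (neg_le_abs _).trans ?_
    rw [abs_mul]
    gcongr
    · exact (abs_nonneg _).trans e3
    · exact hC x hx t ht
  have e7 : (V x t - v x t) * Vxx x t ≤ (V x t - v x t) * C :=
    mul_le_mul_of_nonneg_left ((le_abs_self _).trans (hC x hx t ht)) hpos.le
  have e8 : (V x t - v x t) * (1 - v x t - V x t) ≤ (V x t - v x t) * 1 :=
    mul_le_mul_of_nonneg_left (by linarith) hpos.le
  linarith [hres x hx t ht]

end RegProblem

namespace IsClassicalSol

variable {a b T x₁ : ℝ} {u₀ : ℝ → ℝ} {u : ℝ → ℝ → ℝ}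

lemma mem_regular (hx₁ : x₁ ∈ Ioo a b) {x t : ℝ} (hx : x ∈ Ioo x₁ b) (ht : t ∈ Ioc 0 T) :
    (x, t) ∈ QT a b T \ NSet {x₁} T := by
  refine ⟨⟨⟨hx₁.1.trans hx.1, hx.2⟩, ht⟩, fun hm => hx.1.ne' ?_⟩
  simpa using hm.1

lemma hasDerivAt_x (hu : IsClassicalSol a b T {x₁} u₀ u) (hx₁ : x₁ ∈ Ioo a b) {x t : ℝ}
    (hx : x ∈ Ioo x₁ b) (ht : t ∈ Ioc 0 T) : HasDerivAt (fun y => u y t) (pdx u x t) x :=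
  (hu.diff_x _ (mem_regular hx₁ hx ht)).hasDerivAt

lemma hasDerivAt_xx (hu : IsClassicalSol a b T {x₁} u₀ u) (hx₁ : x₁ ∈ Ioo a b) {x t : ℝ}
    (hx : x ∈ Ioo x₁ b) (ht : t ∈ Ioc 0 T) : HasDerivAt (fun y => pdx u y t) (pdxx u x t) x :=
  (hu.diff_xx _ (mem_regular hx₁ hx ht)).hasDerivAt

lemma eq_init (hu : IsClassicalSol a b T {x₁} u₀ u) (hab : a < b) (hT : 0 < T)
    (hc : ContinuousOn u₀ (Icc a b)) : ∀ x ∈ Icc a b, u x 0 = u₀ x := by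
  have h1 : ContinuousOn (fun x => u x 0) (Icc a b) :=
    hu.cont.comp (f := fun x => (x, (0 : ℝ))) (by fun_prop)
      fun x hx => ⟨hx, left_mem_Icc.2 hT.le⟩
  have h2 : EqOn (fun x => u x 0) u₀ (Ioo a b) := hu.init
  exact h2.of_subset_closure h1 hc Ioo_subset_Icc_self (closure_Ioo hab.ne).ge

lemma eq_right (hu : IsClassicalSol a b T {x₁} u₀ u) (hab : a < b) (hT : 0 < T)
    (hc : ContinuousOn u₀ (Icc a b)) (hb : u₀ b = 1) : ∀ t ∈ Icc 0 T, u b t = 1 := by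
  intro t ht
  rcases ht.1.eq_or_lt with rfl | ht0
  · rw [hu.eq_init hab hT hc b (right_mem_Icc.2 hab.le), hb]
  · exact hu.bdry_b t ⟨ht0, ht.2⟩

lemma pos (hu : IsClassicalSol a b T {x₁} u₀ u) (hx₁ : x₁ ∈ Ioo a b) (hT : 0 < T)
    (hc : ContinuousOn u₀ (Icc a b)) (hb : u₀ b = 1) {x t : ℝ} (hx : x ∈ Ioc x₁ b)
    (ht : t ∈ Icc 0 T) : 0 < u x t := by
  by_contra! hle
  have hsub : Icc x b ⊆ Icc a b := Icc_subset_Icc_left (hx₁.1.trans hx.1).le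
  have h1 : ContinuousOn (fun z => u z t) (Icc x b) :=
    hu.cont.comp (f := fun z => (z, t)) (by fun_prop) fun z hz => ⟨hsub hz, ht⟩
  have hab := hx₁.1.trans hx₁.2
  obtain ⟨z, hz, hz0⟩ := intermediate_value_Icc hx.2 h1
    ⟨hle, by simp only [hu.eq_right hab hT hc hb t ht]; exact zero_le_one⟩
  have := (hu.zero_iff z (hsub hz) t ht).1 hz0
  exact (hx.1.trans_le hz.1).ne' this

lemma hasDerivWithinAt_t (hu : IsClassicalSol a b T {x₁} u₀ u) (hx₁ : x₁ ∈ Ioo a b)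
    (hc : ContinuousOn u₀ (Icc a b)) (hb : u₀ b = 1) {x t : ℝ}
    (hx : x ∈ Ioo x₁ b) (ht : t ∈ Ioc 0 T) :
    HasDerivWithinAt (fun r => u x r) (u x t * pdxx u x t + u x t * (1 - u x t)) (Iic T) t := by
  have h1 := (hu.diff_t _ (mem_regular hx₁ hx ht)).hasDerivWithinAt
  have h2 := hu.pde _ (mem_regular hx₁ hx ht)
  have h3 := hu.pos hx₁ (ht.1.trans_le ht.2) hc hb (Ioo_subset_Ioc_self hx)
    (Ioc_subset_Icc_self ht)
  simp only [abs_of_pos h3] at h2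
  rw [← h2]
  exact h1

/-- On a compact part of `{u > 0}` the solution is bounded below and `u_xx` is bounded. -/
lemma exists_bounds (hu : IsClassicalSol a b T {x₁} u₀ u) (hx₁ : x₁ ∈ Ioo a b) (hT : 0 < T)
    (hc : ContinuousOn u₀ (Icc a b)) (hb : u₀ b = 1) {c d s : ℝ} (hcx : x₁ < c) (hdb : d < b)
    (hs : 0 < s) :
    ∃ m > 0, ∃ C > 0, ∀ x ∈ Icc c d, ∀ t ∈ Icc s T, m ≤ u x t ∧ |pdxx u x t| ≤ C := by
  have hK : IsCompact (Icc c d ×ˢ Icc s T) := isCompact_Icc.prod isCompact_Icc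
  have hsub : Icc c d ×ˢ Icc s T ⊆ QT a b T \ NSet {x₁} T := fun p hp =>
    mem_regular hx₁ ⟨hcx.trans_le hp.1.1, hp.1.2.trans_lt hdb⟩ ⟨hs.trans_le hp.2.1, hp.2.2⟩
  have hsub' : Icc c d ×ˢ Icc s T ⊆ Icc a b ×ˢ Icc 0 T := fun p hp =>
    ⟨⟨(hx₁.1.trans (hcx.trans_le hp.1.1)).le, hp.1.2.trans hdb.le⟩, hs.le.trans hp.2.1, hp.2.2⟩
  obtain ⟨C, hC⟩ := hK.exists_bound_of_continuousOn (hu.cont_xx.mono hsub)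
  rcases (Icc c d ×ˢ Icc s T).eq_empty_or_nonempty with he | hne
  · refine ⟨1, one_pos, 1, one_pos, fun x hx t ht => ?_⟩
    have : (x, t) ∈ Icc c d ×ˢ Icc s T := ⟨hx, ht⟩
    simp [he] at this
  obtain ⟨p, hp, hmin⟩ := hK.exists_isMinOn hne (hu.cont.mono hsub')
  refine ⟨u p.1 p.2, hu.pos hx₁ hT hc hb ⟨hcx.trans_le hp.1.1, hp.1.2.trans hdb.le⟩
    ⟨hs.le.trans hp.2.1, hp.2.2⟩, |C| + 1, by positivity, fun x hx t ht => ⟨?_, ?_⟩⟩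
  · exact hmin (⟨hx, ht⟩ : (x, t) ∈ Icc c d ×ˢ Icc s T)
  · have := hC (x, t) ⟨hx, ht⟩
    rw [Real.norm_eq_abs] at this
    linarith [le_abs_self C]

end IsClassicalSol

lemma IsClassicalSol.scaled {a b T x₁ : ℝ} {u₀ : ℝ → ℝ} {u : ℝ → ℝ → ℝ}
    (hu : IsClassicalSol a b T {x₁} u₀ u) (hx₁ : x₁ ∈ Ioo a b)
    (hc : ContinuousOn u₀ (Icc a b)) (hb : u₀ b = 1) {κ l x t : ℝ} (hl : 0 < l)
    (hx : b - κ - l * (b - x) ∈ Ioo x₁ b) (ht : t ∈ Ioc 0 T) :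
    HasDerivAt (fun z => (l ^ 2)⁻¹ * u (b - κ - l * (b - z)) t)
      (l⁻¹ * pdx u (b - κ - l * (b - x)) t) x ∧
    HasDerivAt (fun z => l⁻¹ * pdx u (b - κ - l * (b - z)) t)
      (pdxx u (b - κ - l * (b - x)) t) x ∧
    HasDerivWithinAt (fun r => (l ^ 2)⁻¹ * u (b - κ - l * (b - x)) r)
      ((l ^ 2)⁻¹ * (u (b - κ - l * (b - x)) t * pdxx u (b - κ - l * (b - x)) t
        + u (b - κ - l * (b - x)) t * (1 - u (b - κ - l * (b - x)) t))) (Iic T) t := by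
  have hy : HasDerivAt (fun z => b - κ - l * (b - z)) l x := by
    have := (((hasDerivAt_id x).const_sub b).const_mul l).const_sub (b - κ)
    simpa using this
  refine ⟨?_, ?_, (hu.hasDerivWithinAt_t hx₁ hc hb hx ht).const_mul _⟩
  · refine (((hu.hasDerivAt_x hx₁ hx ht).comp x hy).const_mul _).congr_deriv ?_
    field_simp
  · refine (((hu.hasDerivAt_xx hx₁ hx ht).comp x hy).const_mul _).congr_deriv ?_
    field_simp

namespace RegFamily

variable {a b T x₁ : ℝ} {u₀ : ℝ → ℝ} {Φ : ℝ → ℝ → ℝ} {u1 : ℝ → ℝ} {u0e : ℝ → ℝ → ℝ}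
  {ue : ℝ → ℝ → ℝ → ℝ} {u : ℝ → ℝ → ℝ}

lemma eventually_small (C : ℝ) {c : ℝ} (hc : 0 < c) :
    ∀ᶠ ε in 𝓝[>] (0 : ℝ), (ε + 4 * √ε) * C + 36 * √ε < c := by
  have : Tendsto (fun ε : ℝ => (ε + 4 * √ε) * C + 36 * √ε) (𝓝[>] 0) (𝓝 0) := by
    have h : Continuous fun ε : ℝ => (ε + 4 * √ε) * C + 36 * √ε := by fun_prop
    simpa using (h.tendsto 0).mono_left nhdsWithin_le_nhds
  exact this.eventually_lt_const hc

lemma u1_bounds (h : RegFamily a b T x₁ u₀ Φ u1 u0e ue) {θ : ℝ} (hθ : 0 < θ) :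
    ∀ᶠ ε in 𝓝[>] (0 : ℝ), 1 ≤ u1 ε ∧ u1 ε ≤ 1 + θ := by
  filter_upwards [eventually_pos_sqrt_lt (half_pos hθ)] with ε hε
  have hP := h.prob ε hε.1
  have := hP.inv.Ureg_one_bounds hP.one
  exact ⟨this.2.1, by linarith [this.2.2, hε.2]⟩

/-- Modulus of continuity of the limit solution. -/
lemma exists_modulus (hu : IsClassicalSol a b T {x₁} u₀ u) {θ : ℝ} (hθ : 0 < θ) :
    ∃ d > 0, ∀ x ∈ Icc a b, ∀ y ∈ Icc a b, ∀ s ∈ Icc 0 T, ∀ t ∈ Icc 0 T,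
      |x - y| < d → |s - t| < d → |u x s - u y t| < θ := by
  obtain ⟨d, hd, H⟩ := Metric.uniformContinuousOn_iff.1
    ((isCompact_Icc.prod isCompact_Icc).uniformContinuousOn_of_continuous hu.cont) θ hθ
  refine ⟨d, hd, fun x hx y hy s hs t ht hxy hst => ?_⟩
  have := H (x, s) ⟨hx, hs⟩ (y, t) ⟨hy, ht⟩ (by
    rw [Prod.dist_eq]; exact max_lt (by rwa [Real.dist_eq]) (by rwa [Real.dist_eq]))
  rwa [Real.dist_eq] at this

set_option maxHeartbeats 400000 in
lemma le_scaled (h : RegFamily a b T x₁ u₀ Φ u1 u0e ue) (hu : IsClassicalSol a b T {x₁} u₀ u)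
    {l t₀ κ₀ : ℝ} (hl : 0 < l) (hl1 : l < 1) (ht₀ : 0 < t₀) (hκ₀ : 0 < κ₀) :
    ∃ κ ∈ Ioo 0 κ₀, x₁ < b - κ - l * (b - x₁) ∧ ∀ᶠ ε in 𝓝[>] (0 : ℝ),
      ∀ x ∈ Icc x₁ b, ∀ t ∈ Icc t₀ T, ue ε x t ≤ (l ^ 2)⁻¹ * u (b - κ - l * (b - x)) t := by
  have hx₁ := h.hx
  have hL : 0 < b - x₁ := sub_pos.2 hx₁.2
  set μ := (l ^ 2)⁻¹ with hμ
  have hμ1 : 1 < μ := (one_lt_inv₀ (by positivity)).2 (by nlinarith)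
  have hy0 : x₁ < b - l * (b - x₁) := by nlinarith
  have hy0I : b - l * (b - x₁) ∈ Icc a b :=
    ⟨(hx₁.1.trans hy0).le, by linarith [mul_nonneg hl.le hL.le]⟩
  set γ := (μ - 1) * u₀ (b - l * (b - x₁)) with hγ
  have hu0 : 0 < u₀ (b - l * (b - x₁)) := by
    rw [← h.zero]; exact h.mono (Ioo_subset_Icc_self hx₁) hy0I hy0
  have hu01 : u₀ (b - l * (b - x₁)) ≤ 1 := by
    rw [← h.right]; exact h.mono.monotoneOn hy0I h.b_mem hy0I.2
  have hγ0 : 0 < γ := mul_pos (by linarith) hu0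
  have hγ1 : γ ≤ μ - 1 := by nlinarith
  obtain ⟨d, hd, hmod⟩ := exists_modulus hu (θ := γ / (4 * μ)) (by positivity)
  obtain ⟨L, hL0, hini⟩ := h.initial_upper (θ := γ / 4) (by positivity)
  set κ := min (d / 2) (min (κ₀ / 2) ((1 - l) * (b - x₁) / 2)) with hκ
  have hκ1 : κ ≤ d / 2 := min_le_left _ _
  have hκ2 : κ ≤ κ₀ / 2 := (min_le_right _ _).trans (min_le_left _ _)
  have hκ3 : κ ≤ (1 - l) * (b - x₁) / 2 := (min_le_right _ _).trans (min_le_right _ _)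
  have h1l : 0 < 1 - l := by linarith
  have hκ0 : 0 < κ := by positivity
  have hyx : x₁ < b - κ - l * (b - x₁) := by nlinarith [mul_pos h1l hL]
  refine ⟨κ, ⟨hκ0, by linarith⟩, hyx, ?_⟩
  set s := min (d / 2) (min t₀ (min T (γ / (4 * L)))) with hs
  have hT := h.hT
  have hs0 : 0 < s := by positivity
  have hs1 : s ≤ d / 2 := min_le_left _ _
  have hs2 : s ≤ t₀ := (min_le_right _ _).trans (min_le_left _ _)
  have hs3 : s ≤ T := (min_le_right _ _).trans ((min_le_right _ _).trans (min_le_left _ _))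
  have hs4 : L * s ≤ γ / 4 := by
    have : s ≤ γ / (4 * L) :=
      (min_le_right _ _).trans ((min_le_right _ _).trans (min_le_right _ _))
    rw [le_div_iff₀ (by positivity)] at this
    linarith
  have hlx : ∀ x ∈ Icc x₁ b, 0 ≤ l * (b - x) ∧ l * (b - x) ≤ b - x ∧
      l * (b - x) ≤ l * (b - x₁) := fun x hx => by
    have hbx := sub_nonneg.2 hx.2
    exact ⟨mul_nonneg hl.le hbx, mul_le_of_le_one_left hbx hl1.le, by gcongr; exact hx.1⟩
  have hyI : ∀ x ∈ Icc x₁ b, b - κ - l * (b - x) ∈ Icc (b - κ - l * (b - x₁)) (b - κ) := by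
    intro x hx
    have := hlx x hx
    constructor <;> linarith
  have hyI' : ∀ x ∈ Icc x₁ b, b - κ - l * (b - x) ∈ Icc a b := fun x hx =>
    ⟨by linarith [(hyI x hx).1, hx₁.1], by linarith [(hyI x hx).2]⟩
  obtain ⟨m, hm, C, hC0, hbd⟩ := hu.exists_bounds hx₁ hT h.cont h.right hyx
    (by linarith : b - κ < b) hs0
  obtain ⟨r, hr, hrb, hnear⟩ := h.upper_near (θ := μ * m) (by positivity)
  have hc₀ : 0 < μ * m * (μ * m - m) :=
    mul_pos (by positivity) (by nlinarith)
  filter_upwards [hini, hnear, eventually_small C hc₀, h.u1_bounds (θ := γ / 2) (by positivity),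
    h.u1_bounds (θ := 3) (by positivity), self_mem_nhdsWithin] with ε hini hnear hsm hw hw4 hε
  have hP := h.prob ε hε
  have hsub : Icc x₁ b ⊆ Icc a b := Icc_subset_Icc_left hx₁.1.le
  have hyo : ∀ x ∈ Icc x₁ b, b - κ - l * (b - x) ∈ Ioo x₁ b := fun x hx =>
    ⟨hyx.trans_le (hyI x hx).1, by linarith [(hyI x hx).2]⟩
  have ht' : ∀ t ∈ Ioc s T, t ∈ Ioc 0 T := fun t ht => ⟨hs0.trans ht.1, ht.2⟩
  have key := hP.le_of_supersolution (c := x₁) (d := b) (s := s) (C := C)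
    (V := fun x t => μ * u (b - κ - l * (b - x)) t) (by linarith [hw4.2]) hsub hs0.le ?_
    (fun x hx t ht =>
      (hu.scaled hx₁ h.cont h.right hl (hyo x (Ioo_subset_Icc_self hx)) (ht' t ht)).1)
    (fun x hx t ht =>
      (hu.scaled hx₁ h.cont h.right hl (hyo x (Ioo_subset_Icc_self hx)) (ht' t ht)).2.1)
    (fun x hx t ht =>
      (hu.scaled hx₁ h.cont h.right hl (hyo x (Ioo_subset_Icc_self hx)) (ht' t ht)).2.2)
    ?_ ?_ ?_ hsm ?_ ?_ ?_
  · intro x hx t ht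
    exact key x hx t ⟨hs2.trans ht.1, ht.2⟩
  · refine continuousOn_const.mul (hu.cont.comp
      (f := fun p : ℝ × ℝ => (b - κ - l * (b - p.1), p.2)) (by fun_prop) fun p hp => ?_)
    exact ⟨hyI' _ hp.1, hs0.le.trans hp.2.1, hp.2.2⟩
  · intro x hx t ht
    have := (hbd _ (hyI x (Ioo_subset_Icc_self hx)) t (Ioc_subset_Icc_self ht)).1
    exact mul_nonneg (by positivity) (hm.le.trans this)
  · intro x hx t ht
    exact (hbd _ (hyI x (Ioo_subset_Icc_self hx)) t (Ioc_subset_Icc_self ht)).2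
  · intro x hx t ht
    have hum := (hbd _ (hyI x (Ioo_subset_Icc_self hx)) t (Ioc_subset_Icc_self ht)).1
    set z := u (b - κ - l * (b - x)) t
    have e1 : μ * m * (μ * m - m) ≤ μ * z * (μ * z - z) := by
      have : μ * m * (μ * m - m) = μ * (μ - 1) * m ^ 2 := by ring
      have e2 : μ * z * (μ * z - z) = μ * (μ - 1) * z ^ 2 := by ring
      rw [this, e2]
      have : 0 < μ - 1 := by linarith
      gcongr
    linarith
  · intro x hx
    have e1 := hini x (hsub hx) s ⟨hs0.le, hs3⟩
    have hy0 : b - l * (b - x) ∈ Icc a b :=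
      ⟨by linarith [(hyI' x hx).1], by linarith [hlx x hx]⟩
    have e2 := abs_lt.1 (hmod _ (hyI' x hx) _ hy0 s ⟨hs0.le, hs3⟩ 0 ⟨le_rfl, hT.le⟩
      (by rw [show b - κ - l * (b - x) - (b - l * (b - x)) = -κ by ring, abs_neg,
            abs_of_pos hκ0]; linarith)
      (by rw [sub_zero, abs_of_pos hs0]; linarith))
    rw [hu.eq_init h.hab hT h.cont _ hy0] at e2
    have e3 : u₀ x ≤ u₀ (b - l * (b - x)) := by
      refine h.mono.monotoneOn (hsub hx) hy0 ?_
      linarith [hlx x hx]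
    have e4 : u₀ (b - l * (b - x₁)) ≤ u₀ (b - l * (b - x)) := by
      refine h.mono.monotoneOn hy0I hy0 ?_
      linarith [hlx x hx]
    have e5 := mul_le_mul_of_nonneg_left e4 (by linarith : 0 ≤ μ - 1)
    have e6 := mul_lt_mul_of_pos_left e2.1 (by linarith : 0 < μ)
    have e7 : μ * -(γ / (4 * μ)) = -(γ / 4) := by field_simp
    linarith
  · intro t ht
    have e1 := hnear x₁ ⟨hx₁.1.le, by linarith⟩ t (Ioc_subset_Icc_self (ht' t ht))
    have e2 := (hbd _ (hyI x₁ ⟨le_rfl, hx₁.2.le⟩) t (Ioc_subset_Icc_self ht)).1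
    exact e1.trans (mul_le_mul_of_nonneg_left e2 (by positivity))
  · intro t ht
    have htI := Ioc_subset_Icc_self (ht' t ht)
    have hbb : b ∈ Icc x₁ b := ⟨hx₁.2.le, le_rfl⟩
    have e2 := abs_lt.1 (hmod _ (hyI' b hbb) _ h.b_mem t htI t htI
      (by rw [show b - κ - l * (b - b) - b = -κ by ring, abs_neg, abs_of_pos hκ0]; linarith)
      (by simpa using hd))
    rw [hu.eq_right h.hab hT h.cont h.right t htI] at e2
    rw [hP.eq_right htI]
    have e6 := mul_lt_mul_of_pos_left e2.1 (by linarith : 0 < μ)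
    have e7 : μ * -(γ / (4 * μ)) = -(γ / 4) := by field_simp
    linarith [hw.2]

end RegFamily

namespace RegFamily

variable {a b T x₁ : ℝ} {u₀ : ℝ → ℝ} {Φ : ℝ → ℝ → ℝ} {u1 : ℝ → ℝ} {u0e : ℝ → ℝ → ℝ}
  {ue : ℝ → ℝ → ℝ → ℝ} {u : ℝ → ℝ → ℝ}

set_option maxHeartbeats 400000 in
lemma scaled_le (h : RegFamily a b T x₁ u₀ Φ u1 u0e ue) (hu : IsClassicalSol a b T {x₁} u₀ u)
    {l t₀ κ₀ : ℝ} (hl : 1 < l) (ht₀ : 0 < t₀) (hκ₀ : 0 < κ₀) :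
    ∃ κ ∈ Ioo 0 κ₀, ∃ ρ ∈ Ioo 0 κ₀, ∀ᶠ ε in 𝓝[>] (0 : ℝ),
      ∀ x ∈ Icc a b, x₁ + ρ ≤ b - κ - l * (b - x) → ∀ t ∈ Icc t₀ T,
        (l ^ 2)⁻¹ * u (b - κ - l * (b - x)) t ≤ ue ε x t := by
  have hx₁ := h.hx
  have hT := h.hT
  have hl0 : 0 < l := one_pos.trans hl
  have hL : 0 < b - x₁ := sub_pos.2 hx₁.2
  set μ := (l ^ 2)⁻¹ with hμ
  have hμ0 : 0 < μ := by positivity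
  have hμ1 : μ < 1 := inv_lt_one_of_one_lt₀ (by nlinarith)
  have h1μ : 0 < 1 - μ := sub_pos.2 hμ1
  have hdiv : (b - x₁) / l < b - x₁ := div_lt_self hL hl
  have hdiv0 : 0 < (b - x₁) / l := by positivity
  obtain ⟨m, hm, hlow⟩ := h.lower_right (η := (b - x₁) - (b - x₁) / l) (by linarith)
    (by linarith)
  obtain ⟨d₁, hd₁, hmod₁⟩ := exists_modulus hu hm
  set ρ := min (d₁ / 2) (min (κ₀ / 2) ((b - x₁) / 4)) with hρ
  have hρ1 : ρ ≤ d₁ / 2 := min_le_left _ _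
  have hρ2 : ρ ≤ κ₀ / 2 := (min_le_right _ _).trans (min_le_left _ _)
  have hρ3 : ρ ≤ (b - x₁) / 4 := (min_le_right _ _).trans (min_le_right _ _)
  have hρ0 : 0 < ρ := by positivity
  have hρI : x₁ + ρ ∈ Icc a b := ⟨by linarith [hx₁.1], by linarith⟩
  set γ := (1 - μ) * u₀ (x₁ + ρ) with hγ
  have hu0 : 0 < u₀ (x₁ + ρ) := by
    rw [← h.zero]; exact h.mono (Ioo_subset_Icc_self hx₁) hρI (by linarith)
  have hu01 : u₀ (x₁ + ρ) ≤ 1 := by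
    rw [← h.right]; exact h.mono.monotoneOn hρI h.b_mem hρI.2
  have hγ0 : 0 < γ := mul_pos h1μ hu0
  have hγ1 : γ ≤ 1 - μ := mul_le_of_le_one_right h1μ.le hu01
  obtain ⟨d, hd, hmod⟩ := exists_modulus hu (θ := γ / 4) (by positivity)
  obtain ⟨L, hL0, hini⟩ := h.initial_lower (θ := γ / 4) (by positivity)
  set κ := min (d / 2) (min (κ₀ / 2) ((b - x₁) / 4)) with hκ
  have hκ1 : κ ≤ d / 2 := min_le_left _ _
  have hκ2 : κ ≤ κ₀ / 2 := (min_le_right _ _).trans (min_le_left _ _)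
  have hκ3 : κ ≤ (b - x₁) / 4 := (min_le_right _ _).trans (min_le_right _ _)
  have hκ0 : 0 < κ := by positivity
  refine ⟨κ, ⟨hκ0, by linarith⟩, ρ, ⟨hρ0, by linarith⟩, ?_⟩
  set s := min (d / 2) (min t₀ (min T (γ / (4 * L)))) with hs
  have hs0 : 0 < s := by positivity
  have hs1 : s ≤ d / 2 := min_le_left _ _
  have hs2 : s ≤ t₀ := (min_le_right _ _).trans (min_le_left _ _)
  have hs3 : s ≤ T := (min_le_right _ _).trans ((min_le_right _ _).trans (min_le_left _ _))
  have hs4 : L * s ≤ γ / 4 := by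
    have : s ≤ γ / (4 * L) :=
      (min_le_right _ _).trans ((min_le_right _ _).trans (min_le_right _ _))
    rw [le_div_iff₀ (by positivity)] at this
    linarith
  set xl := b - (b - κ - x₁ - ρ) / l with hxl
  have hyxl : b - κ - l * (b - xl) = x₁ + ρ := by rw [hxl]; field_simp; ring
  have hxlη : x₁ + ((b - x₁) - (b - x₁) / l) ≤ xl := by
    have : (b - κ - x₁ - ρ) / l ≤ (b - x₁) / l :=
      div_le_div_of_nonneg_right (by linarith) hl0.le
    linarith
  have hxlb : xl < b := by
    have : 0 < (b - κ - x₁ - ρ) / l := div_pos (by linarith) hl0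
    linarith
  have hsub : Icc xl b ⊆ Icc a b := Icc_subset_Icc_left (by linarith [hx₁.1])
  have hlx : ∀ x ∈ Icc xl b, 0 ≤ l * (b - x) ∧ b - x ≤ l * (b - x) ∧
      l * (b - x) ≤ l * (b - xl) := fun x hx => by
    have hbx := sub_nonneg.2 hx.2
    exact ⟨mul_nonneg hl0.le hbx, le_mul_of_one_le_left hbx hl.le, by gcongr; exact hx.1⟩
  have hyI : ∀ x ∈ Icc xl b, b - κ - l * (b - x) ∈ Icc (x₁ + ρ) (b - κ) := by
    intro x hx
    have := hlx x hx
    constructor <;> linarith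
  have hyI' : ∀ x ∈ Icc xl b, b - κ - l * (b - x) ∈ Icc a b := fun x hx =>
    ⟨by linarith [(hyI x hx).1, hx₁.1], by linarith [(hyI x hx).2]⟩
  obtain ⟨m', hm', C, hC0, hbd⟩ := hu.exists_bounds hx₁ hT h.cont h.right
    (by linarith : x₁ < x₁ + ρ) (by linarith : b - κ < b) hs0
  have hc₀ : 0 < μ * (1 - μ) * m' ^ 2 := by positivity
  filter_upwards [hini, hlow, eventually_small C hc₀, h.u1_bounds (θ := 3) (by positivity),
    self_mem_nhdsWithin] with ε hini hlow hsm hw hε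
  have hP := h.prob ε hε
  have hyo : ∀ x ∈ Icc xl b, b - κ - l * (b - x) ∈ Ioo x₁ b := fun x hx =>
    ⟨by linarith [(hyI x hx).1], by linarith [(hyI x hx).2]⟩
  have ht' : ∀ t ∈ Ioc s T, t ∈ Ioc 0 T := fun t ht => ⟨hs0.trans ht.1, ht.2⟩
  have key := hP.ge_of_subsolution (c := xl) (d := b) (s := s) (C := C)
    (V := fun x t => μ * u (b - κ - l * (b - x)) t) (by linarith [hw.2]) hsub hs0.le ?_
    (fun x hx t ht =>
      (hu.scaled hx₁ h.cont h.right hl0 (hyo x (Ioo_subset_Icc_self hx)) (ht' t ht)).1)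
    (fun x hx t ht =>
      (hu.scaled hx₁ h.cont h.right hl0 (hyo x (Ioo_subset_Icc_self hx)) (ht' t ht)).2.1)
    (fun x hx t ht =>
      (hu.scaled hx₁ h.cont h.right hl0 (hyo x (Ioo_subset_Icc_self hx)) (ht' t ht)).2.2)
    ?_ ?_ ?_ hsm ?_ ?_ ?_
  · intro x hx hyx t ht
    refine key x ⟨?_, hx.2⟩ t ⟨hs2.trans ht.1, ht.2⟩
    have : l * (b - x) ≤ l * (b - xl) := by linarith
    linarith [le_of_mul_le_mul_left this hl0]
  · refine continuousOn_const.mul (hu.cont.comp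
      (f := fun p : ℝ × ℝ => (b - κ - l * (b - p.1), p.2)) (by fun_prop) fun p hp => ?_)
    exact ⟨hyI' _ hp.1, hs0.le.trans hp.2.1, hp.2.2⟩
  · intro x hx t ht
    exact hm.le.trans (hlow x ⟨hxlη.trans hx.1.le, hx.2.le⟩ t (Ioc_subset_Icc_self (ht' t ht)))
  · intro x hx t ht
    exact (hbd _ (hyI x (Ioo_subset_Icc_self hx)) t (Ioc_subset_Icc_self ht)).2
  · intro x hx t ht
    have hum := (hbd _ (hyI x (Ioo_subset_Icc_self hx)) t (Ioc_subset_Icc_self ht)).1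
    set z := u (b - κ - l * (b - x)) t
    have e1 : μ * (1 - μ) * m' ^ 2 ≤ μ * (1 - μ) * z ^ 2 := by gcongr
    linarith
  · intro x hx
    have e1 := hini x (hsub hx) s ⟨hs0.le, hs3⟩
    have hy0 : b - l * (b - x) ∈ Icc a b :=
      ⟨by linarith [(hyI' x hx).1], by linarith [hlx x hx]⟩
    have e2 := abs_lt.1 (hmod _ (hyI' x hx) _ hy0 s ⟨hs0.le, hs3⟩ 0 ⟨le_rfl, hT.le⟩
      (by rw [show b - κ - l * (b - x) - (b - l * (b - x)) = -κ by ring, abs_neg,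
            abs_of_pos hκ0]; linarith)
      (by rw [sub_zero, abs_of_pos hs0]; linarith))
    rw [hu.eq_init h.hab hT h.cont _ hy0] at e2
    have e3 : u₀ (b - l * (b - x)) ≤ u₀ x :=
      h.mono.monotoneOn hy0 (hsub hx) (by linarith [hlx x hx])
    have e4 : u₀ (x₁ + ρ) ≤ u₀ (b - l * (b - x)) :=
      h.mono.monotoneOn hρI hy0 (by linarith [(hyI x hx).1])
    have e5 := mul_le_mul_of_nonneg_left e4 h1μ.le
    have e6 := mul_lt_mul_of_pos_left e2.2 hμ0
    have e7 : μ * (γ / 4) ≤ γ / 4 := mul_le_of_le_one_left (by positivity) hμ1.le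
    linarith
  · intro t ht
    have htI := Ioc_subset_Icc_self (ht' t ht)
    have e1 := hlow xl ⟨hxlη, hxlb.le⟩ t htI
    have hx₁I := Ioo_subset_Icc_self hx₁
    have e2 := abs_lt.1 (hmod₁ _ hρI _ hx₁I t htI t htI
      (by rw [add_sub_cancel_left, abs_of_pos hρ0]; linarith) (by simpa using hd₁))
    rw [(hu.zero_iff x₁ hx₁I t htI).2 rfl] at e2
    rw [hyxl]
    have e3 := mul_lt_mul_of_pos_left e2.2 hμ0
    have e4 : μ * m ≤ m := mul_le_of_le_one_left hm.le hμ1.le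
    linarith
  · intro t ht
    have htI := Ioc_subset_Icc_self (ht' t ht)
    have hbb : b ∈ Icc xl b := ⟨hxlb.le, le_rfl⟩
    have e2 := abs_lt.1 (hmod _ (hyI' b hbb) _ h.b_mem t htI t htI
      (by rw [show b - κ - l * (b - b) - b = -κ by ring, abs_neg, abs_of_pos hκ0]; linarith)
      (by simpa using hd))
    rw [hu.eq_right h.hab hT h.cont h.right t htI] at e2
    rw [hP.eq_right htI]
    have e6 := mul_lt_mul_of_pos_left e2.2 hμ0
    have e7 : μ * (γ / 4) ≤ γ / 4 := mul_le_of_le_one_left (by positivity) hμ1.le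
    linarith [hw.1]

/-- Uniform convergence to the limit solution away from `x₁` and from `t = 0`. -/
lemma abs_sub_le (h : RegFamily a b T x₁ u₀ Φ u1 u0e ue) (hu : IsClassicalSol a b T {x₁} u₀ u)
    {r t₀ θ : ℝ} (hr : 0 < r) (ht₀ : 0 < t₀) (hθ : 0 < θ) :
    ∀ᶠ ε in 𝓝[>] (0 : ℝ), ∀ x ∈ Icc (x₁ + r) b, ∀ t ∈ Icc t₀ T, |ue ε x t - u x t| ≤ θ := by
  have hx₁ := h.hx
  have hL : 0 < b - x₁ := sub_pos.2 hx₁.2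
  obtain ⟨B, hB⟩ := (isCompact_Icc.prod isCompact_Icc).exists_bound_of_continuousOn hu.cont
  have hB1 : ∀ x ∈ Icc a b, ∀ t ∈ Icc 0 T, |u x t| ≤ |B| := fun x hx t ht => by
    have := hB (x, t) ⟨hx, ht⟩
    rw [Real.norm_eq_abs] at this
    exact this.trans (le_abs_self _)
  obtain ⟨d, hd, hmod⟩ := exists_modulus hu (θ := θ / 2) (by positivity)
  have hlim : Tendsto (fun l : ℝ => |(l ^ 2)⁻¹ - 1| * |B|) (𝓝 1) (𝓝 0) := by
    have : ContinuousAt (fun l : ℝ => |(l ^ 2)⁻¹ - 1| * |B|) 1 := by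
      fun_prop (disch := norm_num)
    simpa [ContinuousAt] using this
  have hlim2 : Tendsto (fun l : ℝ => |1 - l| * (b - x₁)) (𝓝 1) (𝓝 0) := by
    have : Continuous fun l : ℝ => |1 - l| * (b - x₁) := by fun_prop
    simpa using this.tendsto 1
  have hev := ((hlim.eventually_lt_const (half_pos hθ)).and
    (hlim2.eventually_lt_const (by positivity : 0 < min (d / 2) (r / 4)))).and
    (lt_mem_nhds (zero_lt_one' ℝ))
  have hdist : ∀ {l κ : ℝ}, |1 - l| * (b - x₁) < min (d / 2) (r / 4) → κ ∈ Ioo 0 (min (d / 2) (r / 4)) →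
      ∀ x ∈ Icc x₁ b, |b - κ - l * (b - x) - x| < min d (r / 2) := by
    intro l κ h1 h2 x hx
    have e1 : |(1 - l) * (b - x)| ≤ |1 - l| * (b - x₁) := by
      rw [abs_mul, abs_of_nonneg (sub_nonneg.2 hx.2)]
      gcongr
      exact hx.1
    have e2 : b - κ - l * (b - x) - x = (1 - l) * (b - x) - κ := by ring
    rw [e2]
    have e3 := abs_sub ((1 - l) * (b - x)) κ
    rw [abs_of_pos h2.1] at e3
    have e4 := min_le_left (d / 2) (r / 4)
    have e5 := min_le_right (d / 2) (r / 4)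
    refine lt_min ?_ ?_ <;> linarith [h2.2]
  have hfin : ∀ {l y x t : ℝ}, |(l ^ 2)⁻¹ - 1| * |B| < θ / 2 → y ∈ Icc a b → x ∈ Icc a b →
      t ∈ Icc 0 T → |y - x| < d → |(l ^ 2)⁻¹ * u y t - u x t| ≤ θ := by
    intro l y x t h1 hy hx ht hyx
    have e1 := hmod y hy x hx t ht t ht hyx (by simpa using hd)
    have e2 : (l ^ 2)⁻¹ * u y t - u x t = ((l ^ 2)⁻¹ - 1) * u y t + (u y t - u x t) := by ring
    rw [e2]
    have e3 := abs_add_le (((l ^ 2)⁻¹ - 1) * u y t) (u y t - u x t)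
    rw [abs_mul] at e3
    have e4 := mul_le_mul_of_nonneg_left (hB1 y hy t ht) (abs_nonneg ((l ^ 2)⁻¹ - 1))
    linarith
  obtain ⟨l₁, ⟨⟨hl1, hl1'⟩, hl10⟩, hl11⟩ :=
    ((hev.filter_mono nhdsWithin_le_nhds).and (self_mem_nhdsWithin (a := (1 : ℝ)) (s := Iio 1))).exists
  obtain ⟨l₂, ⟨⟨hl2, hl2'⟩, -⟩, hl21⟩ :=
    ((hev.filter_mono nhdsWithin_le_nhds).and (self_mem_nhdsWithin (a := (1 : ℝ)) (s := Ioi 1))).exists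
  obtain ⟨κ₁, hκ₁, hy₁, H₁⟩ := h.le_scaled hu hl10 hl11 ht₀ (by positivity : 0 < min (d / 2) (r / 4))
  obtain ⟨κ₂, hκ₂, ρ, hρ, H₂⟩ := h.scaled_le hu hl21 ht₀ (by positivity : 0 < min (d / 2) (r / 4))
  filter_upwards [H₁, H₂] with ε H₁ H₂ x hx t ht
  have hxI : x ∈ Icc x₁ b := ⟨by linarith [hx.1], hx.2⟩
  have hxI' : x ∈ Icc a b := ⟨by linarith [hx.1, hx₁.1], hx.2⟩
  have htI : t ∈ Icc 0 T := ⟨ht₀.le.trans ht.1, ht.2⟩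
  have d1 := hdist hl1' hκ₁ x hxI
  have d2 := hdist hl2' hκ₂ x hxI
  have d1' := abs_lt.1 (d1.trans_le (min_le_right _ _))
  have d2' := abs_lt.1 (d2.trans_le (min_le_right _ _))
  have hbx : 0 ≤ b - x := sub_nonneg.2 hx.2
  have f1 := abs_le.1 (hfin hl1 ⟨by linarith [hx.1, hx₁.1], by
    linarith [mul_nonneg hl10.le hbx, hκ₁.1]⟩ hxI' htI (d1.trans_le (min_le_left _ _)))
  have f2 := abs_le.1 (hfin hl2 ⟨by linarith [hx.1, hx₁.1], by
    linarith [mul_nonneg (zero_le_one.trans (le_of_lt hl21)) hbx, hκ₂.1]⟩ hxI' htI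
    (d2.trans_le (min_le_left _ _)))
  have g1 := H₁ x hxI t ht
  have g2 := H₂ x hxI' (by linarith [hρ.2.trans_le (min_le_right _ _), hx.1]) t ht
  exact abs_le.2 ⟨by linarith, by linarith⟩

end RegFamily

/-- Doubling of the space variable: a one-sided bound for the gradient of a solution of a linear
parabolic equation in terms of its size. -/
lemma deriv_le_of_parabolic {w wx wxx A g : ℝ → ℝ → ℝ} {x₀ t₀ r τ m η : ℝ} (hr : 0 < r)
    (hτ : 0 < τ) (hm : 0 < m) (hη : 0 < η)
    (hc : ContinuousOn (fun p : ℝ × ℝ => w p.1 p.2)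
      (Icc (x₀ - r) (x₀ + r) ×ˢ Icc (t₀ - τ) t₀))
    (hb : ∀ x ∈ Icc (x₀ - r) (x₀ + r), ∀ t ∈ Icc (t₀ - τ) t₀, |w x t| ≤ η)
    (hx : ∀ x ∈ Ioo (x₀ - r) (x₀ + r), ∀ t ∈ Ioc (t₀ - τ) t₀,
      HasDerivAt (fun y => w y t) (wx x t) x)
    (hxx : ∀ x ∈ Ioo (x₀ - r) (x₀ + r), ∀ t ∈ Ioc (t₀ - τ) t₀,
      HasDerivAt (fun y => wx y t) (wxx x t) x)
    (ht : ∀ x ∈ Ioo (x₀ - r) (x₀ + r), ∀ t ∈ Ioc (t₀ - τ) t₀,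
      HasDerivWithinAt (fun s => w x s) (A x t * wxx x t + g x t) (Iic t₀) t)
    (hA : ∀ x ∈ Ioo (x₀ - r) (x₀ + r), ∀ t ∈ Ioc (t₀ - τ) t₀, m ≤ A x t)
    (hg : ∀ x ∈ Ioo (x₀ - r) (x₀ + r), ∀ t ∈ Ioc (t₀ - τ) t₀, |g x t| ≤ η) :
    wx x₀ t₀ ≤ 4 * r * (2 / r ^ 2 + (2 / τ + 3) / (4 * m)) * η := by
  set q := 2 / r ^ 2 with hq
  set C₃ := 2 / τ with hC₃
  set C₁ := q + (C₃ + 3) / (4 * m) with hC₁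
  have hq0 : 0 < q := by positivity
  have hC₃0 : 0 < C₃ := by positivity
  have hC₁0 : 0 < C₁ := by positivity
  have hqr : q * r ^ 2 = 2 := by rw [hq]; field_simp
  have hCτ : C₃ * τ = 2 := by rw [hC₃]; field_simp
  have hCm : 4 * m * (C₁ - q) = C₃ + 3 := by rw [hC₁]; field_simp; ring
  set Ψ : ℝ × ℝ → ℝ → ℝ := fun p t => η * (C₁ * (4 * r * (p.1 - p.2) - (p.1 - p.2) ^ 2)
    + q * ((p.1 - x₀) ^ 2 + (p.2 - x₀) ^ 2) + C₃ * (t₀ - t)) with hΨ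
  set K : Set (ℝ × ℝ) := (Icc (x₀ - r) (x₀ + r) ×ˢ Icc (x₀ - r) (x₀ + r)) ∩ {p | p.2 ≤ p.1}
    with hK
  have hKc : IsCompact K := (isCompact_Icc.prod isCompact_Icc).inter_right
    (isClosed_le continuous_snd continuous_fst)
  have hdiff : ∀ x ∈ Icc (x₀ - r) (x₀ + r), ∀ y ∈ Icc (x₀ - r) (x₀ + r),
      ∀ t ∈ Icc (t₀ - τ) t₀, w x t - w y t ≤ 2 * η := fun x hx y hy t ht => by
    have h1 := (abs_le.1 (hb x hx t ht)).2
    have h2 := (abs_le.1 (hb y hy t ht)).1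
    linarith
  have hconc : ∀ p ∈ K, 0 ≤ C₁ * (4 * r * (p.1 - p.2) - (p.1 - p.2) ^ 2) := fun p hp => by
    have h1 : 0 ≤ p.1 - p.2 := sub_nonneg.2 hp.2
    have h2 : p.1 - p.2 ≤ 4 * r := by linarith [hp.1.1.2, hp.1.2.1]
    have := mul_nonneg h1 (sub_nonneg.2 h2)
    exact mul_nonneg hC₁0.le (by nlinarith)
  have key := parabolic_max_principle hKc (D := fun p t => w p.1 t - w p.2 t - Ψ p t)
    (s := t₀ - τ) (T := t₀) 0 ?_ ?_ ?_
  · have hτ0 : t₀ ∈ Icc (t₀ - τ) t₀ := ⟨by linarith, le_rfl⟩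
    have hslope := (hx x₀ ⟨by linarith, by linarith⟩ t₀ ⟨by linarith, le_rfl⟩).tendsto_slope_zero_right
    have hlim : Tendsto (fun h : ℝ => η * (C₁ * (4 * r - h) + q * h)) (𝓝[>] 0)
        (𝓝 (η * (C₁ * (4 * r - 0) + q * 0))) :=
      (Continuous.tendsto (by fun_prop) 0).mono_left nhdsWithin_le_nhds
    have hle := le_of_tendsto_of_tendsto hslope hlim ?_
    · calc wx x₀ t₀ ≤ _ := hle
        _ = 4 * r * C₁ * η := by ring
    · filter_upwards [Ioo_mem_nhdsGT hr] with h hh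
      have h1 := key (x₀ + h, x₀) ⟨⟨⟨by linarith [hh.1], by linarith [hh.2]⟩,
        ⟨by linarith, by linarith⟩⟩, by simpa using hh.1.le⟩ t₀ hτ0
      simp only [hΨ, smul_eq_mul] at h1 ⊢
      rw [inv_mul_le_iff₀ hh.1]
      nlinarith
  · have h1 : ContinuousOn (fun p : (ℝ × ℝ) × ℝ => w p.1.1 p.2) (K ×ˢ Icc (t₀ - τ) t₀) :=
      hc.comp (f := fun p : (ℝ × ℝ) × ℝ => (p.1.1, p.2)) (by fun_prop)
        fun p hp => ⟨hp.1.1.1, hp.2⟩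
    have h2 : ContinuousOn (fun p : (ℝ × ℝ) × ℝ => w p.1.2 p.2) (K ×ˢ Icc (t₀ - τ) t₀) :=
      hc.comp (f := fun p : (ℝ × ℝ) × ℝ => (p.1.2, p.2)) (by fun_prop)
        fun p hp => ⟨hp.1.1.2, hp.2⟩
    exact (h1.sub h2).sub (by fun_prop)
  · intro p hp
    have h1 := hdiff p.1 hp.1.1 p.2 hp.1.2 (t₀ - τ) ⟨le_rfl, by linarith⟩
    have h2 : 0 ≤ q * ((p.1 - x₀) ^ 2 + (p.2 - x₀) ^ 2) := by positivity
    have h3 := hconc p hp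
    simp only [hΨ]
    have h4 := mul_nonneg hη.le (add_nonneg h3 h2)
    have h5 : C₃ * (t₀ - (t₀ - τ)) = 2 := by rw [← hCτ]; ring
    rw [h5]
    linarith
  · rintro ⟨x, y⟩ hp t ht' hpos hmax
    have htI : t ∈ Icc (t₀ - τ) t₀ := Ioc_subset_Icc_self ht'
    have h3 := hconc _ hp
    have hCt : 0 ≤ C₃ * (t₀ - t) := mul_nonneg hC₃0.le (by linarith [ht'.2])
    have hxy2 : w x t - w y t ≤ 2 * η := hdiff x hp.1.1 y hp.1.2 t htI
    simp only [hΨ] at hpos h3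
    have hyx : y < x := by
      refine lt_of_le_of_ne hp.2 fun e => ?_
      subst e
      have : 0 ≤ q * ((y - x₀) ^ 2 + (y - x₀) ^ 2) := by positivity
      have := mul_nonneg hη.le (add_nonneg (add_nonneg h3 this) hCt)
      linarith
    have hedge : (x - x₀) ^ 2 + (y - x₀) ^ 2 < r ^ 2 := by
      by_contra! hge
      have h4 := mul_le_mul_of_nonneg_left hge hq0.le
      rw [hqr] at h4
      nlinarith
    have hxr : |x - x₀| < r := abs_lt_of_sq_lt_sq (by nlinarith [sq_nonneg (y - x₀)]) hr.le
    have hyr : |y - x₀| < r := abs_lt_of_sq_lt_sq (by nlinarith [sq_nonneg (x - x₀)]) hr.le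
    rw [abs_lt] at hxr hyr
    have hxI : x ∈ Ioo (x₀ - r) (x₀ + r) := ⟨by linarith, by linarith⟩
    have hyI : y ∈ Ioo (x₀ - r) (x₀ + r) := ⟨by linarith, by linarith⟩
    have h2x : wxx x t ≤ η * (2 * q - 2 * C₁) := by
      have hl : IsLocalMax (fun z => w z t - w y t - Ψ (z, y) t) x := by
        filter_upwards [Ioo_mem_nhds hyx hxI.2] with z hz
        exact hmax (show (z, y) ∈ K from
          ⟨⟨⟨by linarith [hz.1, hyI.1], hz.2.le⟩, hp.1.2⟩, hz.1.le⟩)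
      have := (second_derivative_test (g' := fun z => wx z t - η * (C₁ * (4 * r - 2 * (z - y))
        + q * (2 * (z - x₀)))) (g'' := wxx x t - η * (2 * q - 2 * C₁)) hl ?_ ?_).2
      · linarith
      · filter_upwards [Ioo_mem_nhds hxI.1 hxI.2] with z hz
        have e := (hasDerivAt_id z)
        refine HasDerivAt.congr_deriv (((hx z hz t ht').sub_const (w y t)).sub
          (((((e.sub_const y).const_mul (4 * r)).sub ((e.sub_const y).pow 2)).const_mul C₁
            |>.add ((((e.sub_const x₀).pow 2).add_const ((y - x₀) ^ 2)).const_mul q)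
            |>.add_const (C₃ * (t₀ - t))).const_mul η)) ?_
        simp
      · have e := (hasDerivAt_id x)
        refine HasDerivAt.congr_deriv ((hxx x hxI t ht').sub
          (((((e.sub_const y).const_mul 2).const_sub (4 * r)).const_mul C₁
            |>.add (((e.sub_const x₀).const_mul 2).const_mul q)).const_mul η)) ?_
        ring
    have h2y : -wxx y t ≤ η * (2 * q - 2 * C₁) := by
      have hl : IsLocalMax (fun z => w x t - w z t - Ψ (x, z) t) y := by
        filter_upwards [Ioo_mem_nhds hyI.1 hyx] with z hz
        exact hmax (show (x, z) ∈ K from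
          ⟨⟨hp.1.1, ⟨hz.1.le, by linarith [hz.2, hxI.2]⟩⟩, hz.2.le⟩)
      have := (second_derivative_test (g' := fun z => -wx z t - η * (C₁ * (-4 * r + 2 * (x - z))
        + q * (2 * (z - x₀)))) (g'' := -wxx y t - η * (2 * q - 2 * C₁)) hl ?_ ?_).2
      · linarith
      · filter_upwards [Ioo_mem_nhds hyI.1 hyI.2] with z hz
        have e := (hasDerivAt_id z)
        refine HasDerivAt.congr_deriv (((hx z hz t ht').const_sub (w x t)).sub
          (((((e.const_sub x).const_mul (4 * r)).sub ((e.const_sub x).pow 2)).const_mul C₁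
            |>.add ((((e.sub_const x₀).pow 2).const_add ((x - x₀) ^ 2)).const_mul q)
            |>.add_const (C₃ * (t₀ - t))).const_mul η)) ?_
        simp
      · have e := (hasDerivAt_id y)
        refine HasDerivAt.congr_deriv ((hxx y hyI t ht').neg.sub
          (((((e.const_sub x).const_mul 2).const_add (-4 * r)).const_mul C₁
            |>.add (((e.sub_const x₀).const_mul 2).const_mul q)).const_mul η)) ?_
        ring
    refine ⟨A x t * wxx x t + g x t - (A y t * wxx y t + g y t) - η * (C₃ * (-1)), ?_, ?_⟩
    · exact ((ht x hxI t ht').sub (ht y hyI t ht')).sub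
        ((((hasDerivWithinAt_id t _).const_sub t₀).const_mul C₃ |>.const_add _).const_mul η)
    · have hS : η * (2 * q - 2 * C₁) < 0 := by
        refine mul_neg_of_pos_of_neg hη ?_
        have : 0 < C₁ - q := by
          refine pos_of_mul_pos_right (a := 4 * m) ?_ (by positivity)
          rw [hCm]; positivity
        linarith
      have hAx := hA x hxI t ht'
      have hAy := hA y hyI t ht'
      have e1 : A x t * wxx x t ≤ m * (η * (2 * q - 2 * C₁)) := by
        exact (mul_le_mul_of_nonneg_left h2x (hm.le.trans hAx)).trans
          (mul_le_mul_of_nonpos_right hAx hS.le)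
      have e2 : A y t * (-wxx y t) ≤ m * (η * (2 * q - 2 * C₁)) := by
        exact (mul_le_mul_of_nonneg_left h2y (hm.le.trans hAy)).trans
          (mul_le_mul_of_nonpos_right hAy hS.le)
      have e3 : 2 * (m * (η * (2 * q - 2 * C₁))) = -(η * (C₃ + 3)) := by rw [← hCm]; ring
      have g1 := (abs_le.1 (hg x hxI t ht')).2
      have g2 := (abs_le.1 (hg y hyI t ht')).1
      rw [zero_mul]
      simp only [mul_neg] at e2
      nlinarith only [e1, e2, e3, g1, g2, hη]

lemma abs_deriv_le_of_parabolic {w wx wxx A g : ℝ → ℝ → ℝ} {x₀ t₀ r τ m η : ℝ} (hr : 0 < r)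
    (hτ : 0 < τ) (hm : 0 < m) (hη : 0 < η)
    (hc : ContinuousOn (fun p : ℝ × ℝ => w p.1 p.2)
      (Icc (x₀ - r) (x₀ + r) ×ˢ Icc (t₀ - τ) t₀))
    (hb : ∀ x ∈ Icc (x₀ - r) (x₀ + r), ∀ t ∈ Icc (t₀ - τ) t₀, |w x t| ≤ η)
    (hx : ∀ x ∈ Ioo (x₀ - r) (x₀ + r), ∀ t ∈ Ioc (t₀ - τ) t₀,
      HasDerivAt (fun y => w y t) (wx x t) x)
    (hxx : ∀ x ∈ Ioo (x₀ - r) (x₀ + r), ∀ t ∈ Ioc (t₀ - τ) t₀,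
      HasDerivAt (fun y => wx y t) (wxx x t) x)
    (ht : ∀ x ∈ Ioo (x₀ - r) (x₀ + r), ∀ t ∈ Ioc (t₀ - τ) t₀,
      HasDerivWithinAt (fun s => w x s) (A x t * wxx x t + g x t) (Iic t₀) t)
    (hA : ∀ x ∈ Ioo (x₀ - r) (x₀ + r), ∀ t ∈ Ioc (t₀ - τ) t₀, m ≤ A x t)
    (hg : ∀ x ∈ Ioo (x₀ - r) (x₀ + r), ∀ t ∈ Ioc (t₀ - τ) t₀, |g x t| ≤ η) :
    |wx x₀ t₀| ≤ 4 * r * (2 / r ^ 2 + (2 / τ + 3) / (4 * m)) * η := by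
  refine abs_le'.2 ⟨deriv_le_of_parabolic hr hτ hm hη hc hb hx hxx ht hA hg, ?_⟩
  refine deriv_le_of_parabolic (w := fun x t => -w x t) (wx := fun x t => -wx x t)
    (wxx := fun x t => -wxx x t) (A := A) (g := fun x t => -g x t) hr hτ hm hη hc.neg
    (fun x h t h' => by simpa using hb x h t h') (fun x h t h' => (hx x h t h').neg)
    (fun x h t h' => (hxx x h t h').neg) (fun x h t h' => ?_) hA
    (fun x h t h' => by simpa using hg x h t h')
  refine (ht x h t h').neg.congr_deriv ?_
  ring

namespace RegFamily

variable {a b T x₁ : ℝ} {u₀ : ℝ → ℝ} {Φ : ℝ → ℝ → ℝ} {u1 : ℝ → ℝ} {u0e : ℝ → ℝ → ℝ}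
  {ue : ℝ → ℝ → ℝ → ℝ} {u : ℝ → ℝ → ℝ}

lemma abs_pdx_sub_le (h : RegFamily a b T x₁ u₀ Φ u1 u0e ue)
    (hu : IsClassicalSol a b T {x₁} u₀ u) {r t₀ θ : ℝ} (hr : 0 < r) (ht₀ : 0 < t₀)
    (hθ : 0 < θ) :
    ∀ᶠ ε in 𝓝[>] (0 : ℝ), ∀ x ∈ Icc (x₁ + r) (b - r), ∀ t ∈ Icc t₀ T,
      |pdx (ue ε) x t - pdx u x t| ≤ θ := by
  have hx₁ := h.hx
  obtain ⟨m, hm, C, hC, hmC⟩ := hu.exists_bounds hx₁ h.hT h.cont h.right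
    (c := x₁ + r / 2) (d := b - r / 2) (s := t₀ / 2) (by linarith) (by linarith) (by linarith)
  set C₀ := 4 * (r / 2) * (2 / (r / 2) ^ 2 + (2 / (t₀ / 2) + 3) / (4 * (m / 2))) with hC₀
  have hC₀0 : 0 < C₀ := by positivity
  set η := θ / C₀ with hη
  have hη0 : 0 < η := by positivity
  set κ := min (min 1 η) (min (m / 4) (η / (2 * (C + 10)))) with hκ
  have hκ0 : 0 < κ := by positivity
  have hκ1 : κ ≤ 1 := (min_le_left _ _).trans (min_le_left _ _)
  have hκ2 : κ ≤ η := (min_le_left _ _).trans (min_le_right _ _)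
  have hκ3 : κ ≤ m / 4 := (min_le_right _ _).trans (min_le_left _ _)
  have hκ4 : κ * (C + 10) ≤ η / 2 := by
    have : κ ≤ η / (2 * (C + 10)) := (min_le_right _ _).trans (min_le_right _ _)
    rw [le_div_iff₀ (by positivity)] at this
    linarith
  filter_upwards [h.abs_sub_le hu (r := r / 2) (t₀ := t₀ / 2) (by positivity) (by positivity) hκ0,
    eventually_small (C + 1) (c := min (η / 2) (m / 4)) (by positivity),
    h.u1_bounds one_pos, self_mem_nhdsWithin] with ε hclose hsmall hu1 hε x hx t ht
  have hε0 : (0 : ℝ) < ε := hε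
  have P := h.prob ε hε
  have hs0 := Real.sqrt_nonneg ε
  have hs1 : (ε + 4 * √ε) * (C + 1) + 36 * √ε < η / 2 := hsmall.trans_le (min_le_left _ _)
  have hs2 : (ε + 4 * √ε) * (C + 1) + 36 * √ε < m / 4 := hsmall.trans_le (min_le_right _ _)
  have hbox : ∀ y ∈ Icc (x - r / 2) (x + r / 2), y ∈ Icc (x₁ + r / 2) (b - r / 2) :=
    fun y hy => ⟨by linarith [hy.1, hx.1], by linarith [hy.2, hx.2]⟩
  have hbx : ∀ y ∈ Icc (x - r / 2) (x + r / 2), y ∈ Ioo x₁ b := fun y hy =>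
    ⟨by linarith [(hbox y hy).1], by linarith [(hbox y hy).2]⟩
  have hbox' : ∀ y ∈ Icc (x - r / 2) (x + r / 2), y ∈ Ioo a b := fun y hy =>
    ⟨hx₁.1.trans (hbx y hy).1, (hbx y hy).2⟩
  have htime : ∀ s ∈ Icc (t - t₀ / 2) t, s ∈ Icc (t₀ / 2) T := fun s hs =>
    ⟨by linarith [hs.1, ht.1], hs.2.trans ht.2⟩
  have htime' : ∀ s ∈ Icc (t - t₀ / 2) t, s ∈ Ioc 0 T := fun s hs =>
    ⟨by linarith [(htime s hs).1], (htime s hs).2⟩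
  have hcl : ∀ y ∈ Icc (x - r / 2) (x + r / 2), ∀ s ∈ Icc (t - t₀ / 2) t,
      |ue ε y s - u y s| ≤ κ := fun y hy s hs =>
    hclose y ⟨(hbox y hy).1, (hbx y hy).2.le⟩ s (htime s hs)
  have hbds : ∀ y ∈ Icc (x - r / 2) (x + r / 2), ∀ s ∈ Icc (t - t₀ / 2) t,
      m / 2 ≤ ue ε y s - (ε + 4 * √ε) ∧ ue ε y s ≤ 2 := fun y hy s hs => by
    have h1 := (abs_le.1 (hcl y hy s hs)).1
    have h2 := (hmC y (hbox y hy) s (htime s hs)).1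
    have h3 := P.le_w y (Ioo_subset_Icc_self (hbox' y hy)) s (Ioc_subset_Icc_self (htime' s hs))
    refine ⟨?_, by linarith [hu1.2]⟩
    nlinarith
  have key := abs_deriv_le_of_parabolic (w := fun y s => ue ε y s - u y s)
    (wx := fun y s => pdx (ue ε) y s - pdx u y s)
    (wxx := fun y s => pdxx (ue ε) y s - pdxx u y s)
    (A := fun y s => regDiff ε (Φ ε) (ue ε y s))
    (g := fun y s => (regDiff ε (Φ ε) (ue ε y s) - u y s) * pdxx u y s
      + (regReac ε (Φ ε) (ue ε y s) - u y s * (1 - u y s)))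
    (x₀ := x) (t₀ := t) (r := r / 2) (τ := t₀ / 2) (m := m / 2) (η := η)
    (by positivity) (by positivity) (by positivity) hη0 ?_ ?_ ?_ ?_ ?_ ?_ ?_
  · calc _ ≤ C₀ * η := key
      _ = θ := by rw [hη]; field_simp
  · exact (P.sol.cont.sub hu.cont).mono fun p hp =>
      ⟨Ioo_subset_Icc_self (hbox' _ hp.1), Ioc_subset_Icc_self (htime' _ hp.2)⟩
  · exact fun y hy s hs => (hcl y hy s hs).trans hκ2
  · intro y hy s hs
    have hy := Ioo_subset_Icc_self hy
    have hs := Ioc_subset_Icc_self hs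
    exact (P.hasDerivAt_x (hbox' y hy) (htime' s hs)).sub
      (hu.hasDerivAt_x hx₁ (hbx y hy) (htime' s hs))
  · intro y hy s hs
    have hy := Ioo_subset_Icc_self hy
    have hs := Ioc_subset_Icc_self hs
    exact (P.hasDerivAt_xx (hbox' y hy) (htime' s hs)).sub
      (hu.hasDerivAt_xx hx₁ (hbx y hy) (htime' s hs))
  · intro y hy s hs
    have hy := Ioo_subset_Icc_self hy
    have hs := Ioc_subset_Icc_self hs
    have e1 := P.hasDerivWithinAt_t (hbox' y hy) (htime' s hs)
    rw [P.pde (hbox' y hy) (htime' s hs)] at e1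
    have e2 := hu.hasDerivWithinAt_t hx₁ h.cont h.right (hbx y hy) (htime' s hs)
    refine ((e1.sub e2).mono (Iic_subset_Iic.2 ht.2)).congr_deriv ?_
    ring
  · intro y hy s hs
    have hy := Ioo_subset_Icc_self hy
    have hs := Ioc_subset_Icc_self hs
    obtain ⟨e1, e2⟩ := hbds y hy s hs
    have := (abs_le.1 (P.inv.abs_regDiff_sub_le (v := ue ε y s) (by linarith) (by linarith))).1
    linarith
  · intro y hy s hs
    have hy := Ioo_subset_Icc_self hy
    have hs := Ioc_subset_Icc_self hs
    obtain ⟨e1, e2⟩ := hbds y hy s hs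
    have e3 := P.inv.abs_regDiff_sub_le (v := ue ε y s) (by linarith) (by linarith)
    have e4 := P.inv.abs_regReac_sub_le (v := ue ε y s) (by linarith) (by linarith)
    have e5 := hcl y hy s hs
    obtain ⟨e6, e7⟩ := hmC y (hbox y hy) s (htime s hs)
    have f1 : |regDiff ε (Φ ε) (ue ε y s) - u y s| ≤ ε + 4 * √ε + κ :=
      (_root_.abs_sub_le _ (ue ε y s) _).trans (add_le_add e3 e5)
    have f2 : |(regDiff ε (Φ ε) (ue ε y s) - u y s) * pdxx u y s| ≤ (ε + 4 * √ε + κ) * C := by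
      rw [abs_mul]
      exact mul_le_mul f1 e7 (abs_nonneg _) (by positivity)
    have f3 : |ue ε y s * (1 - ue ε y s) - u y s * (1 - u y s)| ≤ κ * 10 := by
      rw [show ue ε y s * (1 - ue ε y s) - u y s * (1 - u y s)
        = (ue ε y s - u y s) * (1 - ue ε y s - u y s) by ring, abs_mul]
      have := abs_le.1 e5
      exact mul_le_mul e5 (abs_le.2 ⟨by linarith, by linarith⟩) (abs_nonneg _) hκ0.le
    have f4 : |regReac ε (Φ ε) (ue ε y s) - u y s * (1 - u y s)| ≤ 36 * √ε + κ * 10 :=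
      (_root_.abs_sub_le _ (ue ε y s * (1 - ue ε y s)) _).trans (add_le_add e4 f3)
    refine (abs_add_le _ _).trans ((add_le_add f2 f4).trans ?_)
    nlinarith

end RegFamily

namespace RegProblem

variable {a b T x₁ ε w : ℝ} {φ v₀ : ℝ → ℝ} {v : ℝ → ℝ → ℝ} {X : ℝ → ℝ → ℝ}

lemma abs_sub_le_of_growth {κ s : ℝ} (hκ : 0 < κ)
    (hgr : ∀ y ∈ Icc a b, ∀ x ∈ Icc a b, y ≤ x → κ * (x - y) ≤ v x s - v y s) {x y : ℝ}
    (hx : x ∈ Icc a b) (hy : y ∈ Icc a b) : |x - y| ≤ |v x s - v y s| / κ := by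
  rw [le_div_iff₀ hκ, mul_comm]
  rcases le_total y x with hle | hle
  · rw [abs_of_nonneg (sub_nonneg.2 hle)]
    exact (hgr y hy x hx hle).trans (le_abs_self _)
  · rw [abs_sub_comm x, abs_sub_comm (v x s), abs_of_nonneg (sub_nonneg.2 hle)]
    exact (hgr x hx y hy hle).trans (le_abs_self _)

lemma inverse_mem_Ioo (h : RegProblem a b T x₁ ε φ w v₀ v)
    (hX : ∀ t ∈ Icc 0 T, ∀ c ∈ Icc (-w) w, X c t ∈ Icc a b ∧ v (X c t) t = c) {t c : ℝ}
    (ht : t ∈ Icc 0 T) (hc : c ∈ Ioo (-w) w) : X c t ∈ Ioo a b := by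
  obtain ⟨h1, h2⟩ := hX t ht c (Ioo_subset_Icc_self hc)
  refine ⟨lt_of_le_of_ne h1.1 fun e => ?_, lt_of_le_of_ne h1.2 fun e => ?_⟩
  · rw [← e, h.eq_left ht] at h2
    exact hc.1.ne h2
  · rw [e, h.eq_right ht] at h2
    exact hc.2.ne' h2

/-- The time derivative of the inverse of `v(·,t)`. -/
lemma hasDerivWithinAt_inverse (h : RegProblem a b T x₁ ε φ w v₀ v)
    (hX : ∀ t ∈ Icc 0 T, ∀ c ∈ Icc (-w) w, X c t ∈ Icc a b ∧ v (X c t) t = c) {t c : ℝ}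
    (ht : t ∈ Ioc 0 T) (hc : c ∈ Ioo (-w) w) :
    HasDerivWithinAt (fun s => X c s) (-pdtW T v (X c t) t / pdx v (X c t) t) (Iic T) t := by
  have ht' := Ioc_subset_Icc_self ht
  set x := X c t with hx
  have hxI : x ∈ Ioo a b := h.inverse_mem_Ioo hX ht' hc
  have hvx : v x t = c := (hX t ht' c (Ioo_subset_Icc_self hc)).2
  obtain ⟨κ, hκ, hgr⟩ := h.exists_growth
  have hev : ∀ᶠ s in 𝓝[Iic T] t, s ∈ Ioc 0 T := by
    filter_upwards [self_mem_nhdsWithin, mem_nhdsWithin_of_mem_nhds (Ioi_mem_nhds ht.1)]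
      with s h1 h2 using ⟨h2, h1⟩
  have hdt := h.hasDerivWithinAt_t hxI ht
  have hXI : ∀ s ∈ Ioc 0 T, X c s ∈ Ioo a b := fun s hs =>
    h.inverse_mem_Ioo hX (Ioc_subset_Icc_self hs) hc
  have hXc : ∀ s ∈ Ioc 0 T, v (X c s) s = c := fun s hs =>
    (hX s (Ioc_subset_Icc_self hs) c (Ioo_subset_Icc_self hc)).2
  have hmv : ∀ s : ℝ, ∃ ξ : ℝ, s ∈ Ioc 0 T → ξ ∈ Ioo a b ∧ |ξ - x| ≤ |X c s - x| ∧
      v (X c s) s - v x s = pdx v ξ s * (X c s - x) := by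
    intro s
    by_cases hs : s ∈ Ioc 0 T
    · have hsub : ∀ y z : ℝ, y ∈ Ioo a b → z ∈ Ioo a b → Icc y z ⊆ Ioo a b :=
        fun y z hy hz => Icc_subset_Ioo hy.1 hz.2
      rcases lt_trichotomy x (X c s) with hlt | heq | hlt
      · have hs' := hsub _ _ hxI (hXI s hs)
        obtain ⟨ξ, hξ, e⟩ := exists_hasDerivAt_eq_slope (fun y => v y s) (fun y => pdx v y s) hlt
          (fun y hy => (h.hasDerivAt_x (hs' hy) hs).continuousAt.continuousWithinAt)
          (fun y hy => h.hasDerivAt_x (hs' (Ioo_subset_Icc_self hy)) hs)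
        refine ⟨ξ, fun _ => ⟨hs' (Ioo_subset_Icc_self hξ), ?_, ?_⟩⟩
        · rw [abs_of_pos (sub_pos.2 hξ.1), abs_of_pos (sub_pos.2 hlt)]
          linarith [hξ.2]
        · rw [e, div_mul_cancel₀ _ (sub_pos.2 hlt).ne']
      · exact ⟨x, fun _ => ⟨hxI, by simp, by rw [← heq]; simp⟩⟩
      · have hs' := hsub _ _ (hXI s hs) hxI
        obtain ⟨ξ, hξ, e⟩ := exists_hasDerivAt_eq_slope (fun y => v y s) (fun y => pdx v y s) hlt
          (fun y hy => (h.hasDerivAt_x (hs' hy) hs).continuousAt.continuousWithinAt)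
          (fun y hy => h.hasDerivAt_x (hs' (Ioo_subset_Icc_self hy)) hs)
        refine ⟨ξ, fun _ => ⟨hs' (Ioo_subset_Icc_self hξ), ?_, ?_⟩⟩
        · rw [abs_of_neg (sub_neg.2 hξ.2), abs_of_neg (sub_neg.2 hlt)]
          linarith [hξ.1]
        · have hne := (sub_pos.2 hlt).ne'
          rw [e]
          field_simp
          ring
    · exact ⟨0, fun hs' => absurd hs' hs⟩
  choose ξ hξ using hmv
  have hdist : ∀ᶠ s in 𝓝[Iic T] t, |ξ s - x| ≤ |v x s - v x t| / κ := by
    filter_upwards [hev] with s hs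
    obtain ⟨-, h2, -⟩ := hξ s hs
    refine h2.trans ?_
    have := abs_sub_le_of_growth hκ (hgr s (Ioc_subset_Icc_self hs))
      (Ioo_subset_Icc_self (hXI s hs)) (Ioo_subset_Icc_self hxI)
    have e : |c - v x s| = |v x s - v x t| := by rw [hvx, abs_sub_comm]
    rwa [hXc s hs, e] at this
  have hξlim : Tendsto ξ (𝓝[Iic T] t) (𝓝 x) := by
    rw [tendsto_iff_dist_tendsto_zero]
    refine squeeze_zero' (Eventually.of_forall fun _ => dist_nonneg) hdist ?_
    have h1 : Tendsto (fun s => |v x s - v x t| / κ) (𝓝[Iic T] t) (𝓝 (|v x t - v x t| / κ)) :=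
      ((hdt.continuousWithinAt.tendsto.sub_const _).abs).div_const κ
    simpa using h1
  have hp : Tendsto (fun s => pdx v (ξ s) s) (𝓝[Iic T] t) (𝓝 (pdx v x t)) := by
    have h1 : Tendsto (fun s => (ξ s, s)) (𝓝[Iic T] t) (𝓝[QT a b T] (x, t)) := by
      refine tendsto_nhdsWithin_iff.2 ⟨hξlim.prodMk_nhds nhdsWithin_le_nhds, ?_⟩
      filter_upwards [hev] with s hs using ⟨(hξ s hs).1, hs⟩
    exact (h.sol.cont_x (x, t) ⟨hxI, ht⟩).tendsto.comp h1
  rw [hasDerivWithinAt_iff_tendsto_slope] at hdt ⊢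
  have hle : 𝓝[Iic T \ {t}] t ≤ 𝓝[Iic T] t := nhdsWithin_mono _ sdiff_subset
  refine (hdt.neg.div (hp.mono_left hle) (h.pdx_pos hxI ht).ne').congr' ?_
  filter_upwards [hle hev, self_mem_nhdsWithin] with s hs hst
  obtain ⟨h1, -, h3⟩ := hξ s hs
  have hpos := (h.pdx_pos h1 hs).ne'
  have hne : s - t ≠ 0 := sub_ne_zero.2 hst.2
  rw [hXc s hs] at h3
  simp only [slope_def_field, Pi.div_apply]
  rw [div_eq_iff hpos, ← hx, hvx]
  field_simp
  linarith

/-- The average of the time derivative of the inverse, written as a jump of the gradient. -/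
lemma abs_integral_inverse_add_le (h : RegProblem a b T x₁ ε φ w v₀ v)
    (hX : ∀ t ∈ Icc 0 T, ∀ c ∈ Icc (-w) w, X c t ∈ Icc a b ∧ v (X c t) t = c) {t δ : ℝ}
    (ht : t ∈ Ioc 0 T) (hδ : 0 < δ) (hδw : δ < w) :
    |(∫ c in (-δ)..δ, derivWithin (fun s => X c s) (Iic T) t / (ε + φ c ^ 2))
      + (pdx v (X δ t) t - pdx v (X (-δ) t) t)| ≤ X δ t - X (-δ) t := by
  have ht' := Ioc_subset_Icc_self ht
  have hsub : Icc (-δ) δ ⊆ Ioo (-w) w := Icc_subset_Ioo (by linarith) hδw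
  have hδ2 : -δ ≤ δ := by linarith
  have hmem : ∀ c ∈ Icc (-δ) δ, X c t ∈ Ioo a b := fun c hc => h.inverse_mem_Ioo hX ht' (hsub hc)
  have hval : ∀ c ∈ Icc (-δ) δ, v (X c t) t = c := fun c hc =>
    (hX t ht' c (Ioo_subset_Icc_self (hsub hc))).2
  have hmono := h.strictMonoOn ht'
  set α := X (-δ) t with hα
  set β := X δ t with hβ
  have hαI : α ∈ Ioo a b := hmem _ ⟨le_rfl, hδ2⟩
  have hβI : β ∈ Ioo a b := hmem _ ⟨hδ2, le_rfl⟩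
  have hvα : v α t = -δ := hval _ ⟨le_rfl, hδ2⟩
  have hvβ : v β t = δ := hval _ ⟨hδ2, le_rfl⟩
  have hαβ : α ≤ β := by
    refine (hmono.le_iff_le (Ioo_subset_Icc_self hαI) (Ioo_subset_Icc_self hβI)).1 ?_
    simp only [hvα, hvβ, hδ2]
  have hI : Icc α β ⊆ Ioo a b := Icc_subset_Ioo hαI.1 hβI.2
  obtain ⟨κ, hκ, hgr⟩ := h.exists_growth
  have hXcont : ContinuousOn (fun c => X c t) (Icc (-δ) δ) := by
    have : LipschitzOnWith (Real.toNNReal (1 / κ)) (fun c => X c t) (Icc (-δ) δ) := by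
      refine LipschitzOnWith.of_dist_le_mul fun c hc d hd => ?_
      have := abs_sub_le_of_growth hκ (hgr t ht') (Ioo_subset_Icc_self (hmem c hc))
        (Ioo_subset_Icc_self (hmem d hd))
      rw [hval c hc, hval d hd] at this
      rw [Real.coe_toNNReal _ (by positivity), Real.dist_eq, Real.dist_eq]
      exact this.trans_eq (by ring)
    exact this.continuousOn
  have hslice : ∀ f : ℝ × ℝ → ℝ, ContinuousOn f (QT a b T) →
      ContinuousOn (fun x => f (x, t)) (Ioo a b) := fun f hf =>
    hf.comp (f := fun x => (x, t)) (by fun_prop) fun x hx => ⟨hx, ht⟩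
  have hcx : ContinuousOn (fun x => pdx v x t) (Ioo a b) := hslice _ h.sol.cont_x
  have hcxx : ContinuousOn (fun x => pdxx v x t) (Ioo a b) := hslice _ h.sol.cont_xx
  have hct : ContinuousOn (fun x => pdtW T v x t) (Ioo a b) := hslice _ h.sol.cont_t
  have hDpos : ∀ c, regDiff ε φ c ≠ 0 := fun c => (h.inv.regDiff_pos c).ne'
  set G : ℝ → ℝ := fun c => -pdtW T v (X c t) t / pdx v (X c t) t / regDiff ε φ c with hG
  have hGc : ContinuousOn G (Icc (-δ) δ) :=
    (((hct.comp hXcont hmem).neg).div (hcx.comp hXcont hmem)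
      fun c hc => (h.pdx_pos (hmem c hc) ht).ne').div h.inv.continuous_regDiff.continuousOn
      fun c _ => hDpos c
  have himg : (fun x => v x t) '' Icc α β ⊆ Icc (-δ) δ := by
    rintro _ ⟨x, hx, rfl⟩
    have hxI := Ioo_subset_Icc_self (hI hx)
    rw [← hvα, ← hvβ]
    exact ⟨hmono.monotoneOn (Ioo_subset_Icc_self hαI) hxI hx.1,
      hmono.monotoneOn hxI (Ioo_subset_Icc_self hβI) hx.2⟩
  have hXv : ∀ x ∈ Icc α β, X (v x t) t = x := fun x hx => by
    have hv := himg ⟨x, hx, rfl⟩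
    exact hmono.injOn (Ioo_subset_Icc_self (hmem _ hv)) (Ioo_subset_Icc_self (hI hx))
      (hval _ hv)
  have e1 : ∫ c in (-δ)..δ, derivWithin (fun s => X c s) (Iic T) t / (ε + φ c ^ 2)
      = ∫ c in (-δ)..δ, G c := by
    refine intervalIntegral.integral_congr fun c hc => ?_
    rw [uIcc_of_le hδ2] at hc
    have := (h.hasDerivWithinAt_inverse hX ht (hsub hc)).derivWithin
      (uniqueDiffOn_Iic T t ht.2)
    simp only [this, hG, regDiff]
  have e2 := intervalIntegral.integral_comp_mul_deriv' (a := α) (b := β) (f := fun x => v x t)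
    (f' := fun x => pdx v x t) (g := G)
    (fun x hx => h.hasDerivAt_x (hI (by rwa [uIcc_of_le hαβ] at hx)) ht)
    (by rw [uIcc_of_le hαβ]; exact hcx.mono hI)
    (by rw [uIcc_of_le hαβ]; exact hGc.mono himg)
  simp only [hvα, hvβ, Function.comp_apply] at e2
  set H : ℝ → ℝ := fun x => regReac ε φ (v x t) / regDiff ε φ (v x t) with hH
  have hvc : ContinuousOn (fun x => v x t) (Icc α β) :=
    (h.continuousOn_x ht').mono (hI.trans Ioo_subset_Icc_self)
  have hHc : ContinuousOn H (Icc α β) :=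
    (h.inv.continuous_regReac.comp_continuousOn hvc).div
      (h.inv.continuous_regDiff.comp_continuousOn hvc) fun x _ => hDpos _
  have hxxi : IntervalIntegrable (fun x => pdxx v x t) volume α β :=
    ContinuousOn.intervalIntegrable (by rw [uIcc_of_le hαβ]; exact hcxx.mono hI)
  have hHi : IntervalIntegrable H volume α β :=
    ContinuousOn.intervalIntegrable (by rw [uIcc_of_le hαβ]; exact hHc)
  have e3 : ∫ x in α..β, G (v x t) * pdx v x t = ∫ x in α..β, (-pdxx v x t - H x) := by
    refine intervalIntegral.integral_congr fun x hx => ?_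
    rw [uIcc_of_le hαβ] at hx
    have h1 := (h.pdx_pos (hI hx) ht).ne'
    have h2 := hDpos (v x t)
    simp only [hG, hH, hXv x hx, h.pde (hI hx) ht]
    field_simp
    ring
  have e4 : ∫ x in α..β, pdxx v x t = pdx v β t - pdx v α t :=
    intervalIntegral.integral_eq_sub_of_hasDerivAt
      (fun x hx => h.hasDerivAt_xx (hI (by rwa [uIcc_of_le hαβ] at hx)) ht) hxxi
  have e5 : ∫ x in α..β, (-pdxx v x t - H x) = -(pdx v β t - pdx v α t) - ∫ x in α..β, H x := by
    rw [← e4, ← intervalIntegral.integral_neg]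
    exact intervalIntegral.integral_sub hxxi.neg hHi
  have e6 : |∫ x in α..β, H x| ≤ β - α := by
    have := intervalIntegral.norm_integral_le_of_norm_le_const (a := α) (b := β) (f := H)
      (C := 1) fun x hx => ?_
    · rwa [Real.norm_eq_abs, one_mul, abs_of_nonneg (sub_nonneg.2 hαβ)] at this
    · rw [uIoc_of_le hαβ] at hx
      have hx := hI (Ioc_subset_Icc_self hx)
      rw [Real.norm_eq_abs, hH, abs_div, abs_of_pos (h.inv.regDiff_pos _)]
      exact div_le_one_of_le₀ (h.inv.regReac_le (h.abs_inv_le (Ioo_subset_Icc_self hx) ht'))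
        (h.inv.regDiff_pos _).le
  rw [e1, ← e2, e3, e5]
  rwa [show -(pdx v β t - pdx v α t) - (∫ x in α..β, H x) + (pdx v β t - pdx v α t)
    = -∫ x in α..β, H x by ring, abs_neg]

end RegProblem

lemma IsUregInverse.integral_inv_regDiff {ε : ℝ} {φ : ℝ → ℝ} (h : IsUregInverse ε φ) (δ : ℝ) :
    ∫ c in (-δ)..δ, (ε + φ c ^ 2)⁻¹ = 2 * regPrim ε φ δ := by
  have := intervalIntegral.integral_eq_sub_of_hasDerivAt (a := -δ) (b := δ)
    (fun x _ => h.hasDerivAt_regPrim x)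
    (h.continuous_regDiff.inv₀ fun c => (h.regDiff_pos c).ne').continuousOn.intervalIntegrable
  rw [h.regPrim_neg] at this
  rw [two_mul, ← sub_neg_eq_add, ← this]
  rfl

/-- Diagonal extraction along the right neighbourhoods of zero. -/
lemma exists_diagonal {P : ℕ → ℝ → Prop} (hP : ∀ n, ∀ᶠ ε in 𝓝[>] (0 : ℝ), P n ε) :
    ∃ N : ℝ → ℕ, Tendsto N (𝓝[>] 0) atTop ∧ ∀ᶠ ε in 𝓝[>] (0 : ℝ), P (N ε) ε := by
  classical
  refine ⟨fun ε => Nat.findGreatest (fun n => P n ε) ⌊ε⁻¹⌋₊, tendsto_atTop.2 fun n => ?_, ?_⟩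
  · filter_upwards [hP n,
      (tendsto_nat_floor_atTop.comp tendsto_inv_nhdsGT_zero).eventually_ge_atTop n] with ε h1 h2
    exact Nat.le_findGreatest h2 h1
  · filter_upwards [hP 0] with ε h
    exact Nat.findGreatest_spec (P := fun n => P n ε) (Nat.zero_le _) h

namespace RegFamily

variable {a b T x₁ : ℝ} {u₀ : ℝ → ℝ} {Φ : ℝ → ℝ → ℝ} {u1 : ℝ → ℝ} {u0e : ℝ → ℝ → ℝ}
  {ue : ℝ → ℝ → ℝ → ℝ} {u : ℝ → ℝ → ℝ}

lemma tendsto_log_div_regPrim (h : RegFamily a b T x₁ u₀ Φ u1 u0e ue) {δ : ℝ} (hδ : 0 < δ)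
    (hδ1 : δ ≤ 1) :
    Tendsto (fun ε => Real.log ε / regPrim ε (Φ ε) δ) (𝓝[>] 0) (𝓝 (-1)) := by
  have hlog : Tendsto (fun ε : ℝ => (Real.log ε)⁻¹) (𝓝[>] 0) (𝓝 0) :=
    tendsto_inv_atBot_zero.comp Real.tendsto_log_nhdsGT_zero
  have h0 : Tendsto (fun ε => (regPrim ε (Φ ε) δ + Real.log ε) * (Real.log ε)⁻¹) (𝓝[>] 0)
      (𝓝 0) := by
    refine bdd_le_mul_tendsto_zero' (|2 * Real.log (δ / 3)| + |2 * Real.log 3|) ?_ hlog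
    filter_upwards [eventually_pos_sqrt_lt one_pos] with ε hε
    have P := h.prob ε hε.1
    have h1 := P.inv.log_le_regPrim hε.2.le hδ hδ1
    have h2 := P.inv.regPrim_le_log hε.2.le P.one
    have h3 := P.inv.strictMono_regPrim.monotone
      (hδ1.trans (P.inv.Ureg_one_bounds P.one).2.1)
    rw [abs_le]
    have h4 := neg_abs_le (2 * Real.log (δ / 3))
    have h5 := abs_nonneg (2 * Real.log (δ / 3))
    have h6 := le_abs_self (2 * Real.log 3)
    have h7 := abs_nonneg (2 * Real.log 3)
    constructor <;> linarith
  have h1 : Tendsto (fun ε => regPrim ε (Φ ε) δ / Real.log ε) (𝓝[>] 0) (𝓝 (-1)) := by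
    have := h0.sub_const 1
    rw [zero_sub] at this
    refine this.congr' ?_
    filter_upwards [Real.tendsto_log_nhdsGT_zero.eventually_lt_atBot 0] with ε hε
    have := hε.ne
    field_simp
    ring
  have := h1.inv₀ (by norm_num)
  rw [show (-1 : ℝ)⁻¹ = -1 by norm_num] at this
  exact this.congr fun ε => inv_div _ _

/-- The level sets `{ue ε = d}`, for small `d > 0`, lie to the right of `x₁` and close to it; there
the gradient of `ue ε` is close to that of the limit. -/
lemma exists_level_right (h : RegFamily a b T x₁ u₀ Φ u1 u0e ue)
    (hu : IsClassicalSol a b T {x₁} u₀ u) {e : ℝ} (he : 0 < e) :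
    ∃ d₀ > 0, ∀ d ∈ Ioc 0 d₀, ∀ᶠ ε in 𝓝[>] (0 : ℝ), ∀ t ∈ Icc 0 T, ∀ x ∈ Icc a b,
      ue ε x t = d → x ∈ Ioo x₁ (x₁ + e) ∧
        (e ≤ t → |pdx (ue ε) x t - pdx u x t| ≤ e) := by
  have hL : 0 < b - x₁ := sub_pos.2 h.hx.2
  set η := min e ((b - x₁) / 2) with hη
  have hη0 : 0 < η := by positivity
  have hηe : η ≤ e := min_le_left _ _
  have hηb : η ≤ (b - x₁) / 2 := min_le_right _ _
  obtain ⟨m, hm, Hm⟩ := h.lower_right hη0 (by linarith)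
  refine ⟨m / 2, by positivity, fun d hd => ?_⟩
  obtain ⟨r, hr, -, Hr⟩ := h.upper_near (half_pos hd.1)
  set r' := min r ((b - x₁) / 2) with hr'
  have hr0 : 0 < r' := by positivity
  have hr1 : r' ≤ r := min_le_left _ _
  have hr2 : r' ≤ (b - x₁) / 2 := min_le_right _ _
  filter_upwards [Hm, Hr, h.abs_pdx_sub_le hu hr0 he he] with ε h1 h2 h3 t ht x hx hval
  have hlow : x₁ + r < x := by
    by_contra! hle
    linarith [h2 x ⟨hx.1, hle⟩ t ht, hd.1]
  have hup : x < x₁ + η := by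
    by_contra! hle
    linarith [h1 x ⟨hle, hx.2⟩ t ht, hd.2]
  exact ⟨⟨by linarith, by linarith⟩,
    fun het => h3 x ⟨by linarith, by linarith⟩ t ⟨het, ht.2⟩⟩

lemma exists_level_left (h : RegFamily a b T x₁ u₀ Φ u1 u0e ue)
    (hu : IsClassicalSol a b T {x₁} u₀ u) {e : ℝ} (he : 0 < e) :
    ∃ d₀ > 0, ∀ d ∈ Ioc 0 d₀, ∀ᶠ ε in 𝓝[>] (0 : ℝ), ∀ t ∈ Icc 0 T, ∀ x ∈ Icc a b,
      ue ε x t = -d → x ∈ Ioo (x₁ - e) x₁ ∧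
        (e ≤ t → |pdx (ue ε) x t - pdx u x t| ≤ e) := by
  obtain ⟨d₀, hd₀, H⟩ := h.reflect.exists_level_right hu.reflect he
  refine ⟨d₀, hd₀, fun d hd => (H d hd).mono fun ε hε t ht x hx hval => ?_⟩
  obtain ⟨h1, h2⟩ := hε t ht (-x) ⟨neg_le_neg hx.2, neg_le_neg hx.1⟩
    (by simp only [_root_.reflect, neg_neg, hval])
  simp only [pdx_reflect, neg_neg] at h2
  exact ⟨⟨by linarith [h1.2], by linarith [h1.1]⟩, h2⟩

/-- The weighted averages of the time derivative of the inverses converge to the jump of the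
gradient of the limit. -/
theorem tendsto_average (h : RegFamily a b T x₁ u₀ Φ u1 u0e ue)
    (hu : IsClassicalSol a b T {x₁} u₀ u) {X : ℝ → ℝ → ℝ → ℝ}
    (hX : ∀ ε > 0, ∀ t ∈ Icc 0 T, ∀ c ∈ Icc (-(u1 ε)) (u1 ε),
      X ε c t ∈ Icc a b ∧ ue ε (X ε c t) t = c) {uxp uxm : ℝ → ℝ}
    (huxp : ∀ t ∈ Ioc 0 T, Tendsto (fun y => pdx u y t) (𝓝[>] x₁) (𝓝 (uxp t)))
    (huxm : ∀ t ∈ Ioc 0 T, Tendsto (fun y => pdx u y t) (𝓝[<] x₁) (𝓝 (uxm t))) :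
    ∃ δ : ℝ → ℝ, (∀ ε > 0, 0 < δ ε) ∧ Tendsto δ (𝓝[>] 0) (𝓝 0) ∧ ∀ t ∈ Ioc 0 T,
      Tendsto (fun ε => 2 * Real.log ε * ((∫ c in (-(δ ε))..(δ ε), (ε + Φ ε c ^ 2)⁻¹)⁻¹ *
        ∫ c in (-(δ ε))..(δ ε), derivWithin (fun s => X ε c s) (Iic T) t / (ε + Φ ε c ^ 2)))
        (𝓝[>] 0) (𝓝 (uxp t - uxm t)) := by
  set e : ℕ → ℝ := fun n => 1 / ((n : ℝ) + 1) with he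
  have he0 : ∀ n, 0 < e n := fun n => by positivity
  have helim : Tendsto e atTop (𝓝 0) := tendsto_one_div_add_atTop_nhds_zero_nat
  choose dr hdr Hr using fun n => h.exists_level_right hu (he0 n)
  choose dl hdl Hl using fun n => h.exists_level_left hu (he0 n)
  set d : ℕ → ℝ := fun n => min (e n / 2) (min (dr n) (dl n)) with hd
  have hd0 : ∀ n, 0 < d n := fun n => lt_min (half_pos (he0 n)) (lt_min (hdr n) (hdl n))
  have hde : ∀ n, d n ≤ e n / 2 := fun n => min_le_left _ _
  have hd1 : ∀ n, d n < 1 := fun n => by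
    have : e n ≤ 1 := div_le_one_of_le₀ (by simp) (by positivity)
    linarith [hde n]
  have hdrn : ∀ n, d n ∈ Ioc 0 (dr n) := fun n =>
    ⟨hd0 n, (min_le_right _ _).trans (min_le_left _ _)⟩
  have hdln : ∀ n, d n ∈ Ioc 0 (dl n) := fun n =>
    ⟨hd0 n, (min_le_right _ _).trans (min_le_right _ _)⟩
  obtain ⟨N, hN, hP⟩ := exists_diagonal fun n => ((Hr n (d n) (hdrn n)).and
    (Hl n (d n) (hdln n))).and (Metric.tendsto_nhds.1
      (h.tendsto_log_div_regPrim (hd0 n) (hd1 n).le) (e n) (he0 n))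
  have heN : Tendsto (fun ε => e (N ε)) (𝓝[>] 0) (𝓝 0) := helim.comp hN
  refine ⟨fun ε => d (N ε), fun ε _ => hd0 _, squeeze_zero (fun ε => (hd0 _).le)
    (fun ε => (hde _).trans (half_le_self (he0 _).le)) heN, fun t ht => ?_⟩
  have ht' := Ioc_subset_Icc_self ht
  have hlev : ∀ ε > 0, ∀ c ∈ Icc (-(d (N ε))) (d (N ε)), c ∈ Icc (-(u1 ε)) (u1 ε) :=
    fun ε hε c hc => by
    have P := h.prob ε hε
    have := (P.inv.Ureg_one_bounds P.one).2.1
    have := hd1 (N ε)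
    exact ⟨by linarith [hc.1], by linarith [hc.2]⟩
  have hXr : ∀ ε > 0, X ε (d (N ε)) t ∈ Icc a b ∧ ue ε (X ε (d (N ε)) t) t = d (N ε) :=
    fun ε hε => hX ε hε t ht' _ (hlev ε hε _ ⟨by linarith [hd0 (N ε)], le_rfl⟩)
  have hXl : ∀ ε > 0, X ε (-d (N ε)) t ∈ Icc a b ∧ ue ε (X ε (-d (N ε)) t) t = -d (N ε) :=
    fun ε hε => hX ε hε t ht' _ (hlev ε hε _ ⟨le_rfl, by linarith [hd0 (N ε)]⟩)
  have hpos : ∀ᶠ ε in 𝓝[>] (0 : ℝ), 0 < ε := eventually_mem_nhdsWithin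
  have hlocr : ∀ᶠ ε in 𝓝[>] (0 : ℝ), X ε (d (N ε)) t ∈ Ioo x₁ (x₁ + e (N ε)) := by
    filter_upwards [hpos, hP] with ε hε hPε
    exact (hPε.1.1 t ht' _ (hXr ε hε).1 (hXr ε hε).2).1
  have hlocl : ∀ᶠ ε in 𝓝[>] (0 : ℝ), X ε (-d (N ε)) t ∈ Ioo (x₁ - e (N ε)) x₁ := by
    filter_upwards [hpos, hP] with ε hε hPε
    exact (hPε.1.2 t ht' _ (hXl ε hε).1 (hXl ε hε).2).1
  have hlimr : Tendsto (fun ε => X ε (d (N ε)) t) (𝓝[>] 0) (𝓝[>] x₁) := by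
    refine tendsto_nhdsWithin_iff.2 ⟨?_, hlocr.mono fun _ hx => hx.1⟩
    refine tendsto_of_tendsto_of_tendsto_of_le_of_le' tendsto_const_nhds
      (by simpa using heN.const_add x₁) (hlocr.mono fun _ hx => hx.1.le)
      (hlocr.mono fun _ hx => hx.2.le)
  have hliml : Tendsto (fun ε => X ε (-d (N ε)) t) (𝓝[>] 0) (𝓝[<] x₁) := by
    refine tendsto_nhdsWithin_iff.2 ⟨?_, hlocl.mono fun _ hx => hx.2⟩
    refine tendsto_of_tendsto_of_tendsto_of_le_of_le' (by simpa using heN.const_sub x₁)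
      tendsto_const_nhds (hlocl.mono fun _ hx => hx.1.le) (hlocl.mono fun _ hx => hx.2.le)
  have het : ∀ᶠ ε in 𝓝[>] (0 : ℝ), e (N ε) ≤ t :=
    (heN.eventually_lt_const ht.1).mono fun _ => le_of_lt
  have hpr : Tendsto (fun ε => pdx (ue ε) (X ε (d (N ε)) t) t) (𝓝[>] 0) (𝓝 (uxp t)) := by
    have h1 : Tendsto (fun ε => pdx (ue ε) (X ε (d (N ε)) t) t - pdx u (X ε (d (N ε)) t) t)
        (𝓝[>] 0) (𝓝 0) := by
      refine squeeze_zero_norm' ?_ heN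
      filter_upwards [hpos, hP, het] with ε hε hPε hle
      exact (hPε.1.1 t ht' _ (hXr ε hε).1 (hXr ε hε).2).2 hle
    simpa using h1.add ((huxp t ht).comp hlimr)
  have hpl : Tendsto (fun ε => pdx (ue ε) (X ε (-d (N ε)) t) t) (𝓝[>] 0) (𝓝 (uxm t)) := by
    have h1 : Tendsto (fun ε => pdx (ue ε) (X ε (-d (N ε)) t) t - pdx u (X ε (-d (N ε)) t) t)
        (𝓝[>] 0) (𝓝 0) := by
      refine squeeze_zero_norm' ?_ heN
      filter_upwards [hpos, hP, het] with ε hε hPε hle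
      exact (hPε.1.2 t ht' _ (hXl ε hε).1 (hXl ε hε).2).2 hle
    simpa using h1.add ((huxm t ht).comp hliml)
  have hint : Tendsto (fun ε => ∫ c in (-(d (N ε)))..(d (N ε)),
      derivWithin (fun s => X ε c s) (Iic T) t / (ε + Φ ε c ^ 2)) (𝓝[>] 0)
      (𝓝 (-(uxp t - uxm t))) := by
    have h1 : Tendsto (fun ε => (∫ c in (-(d (N ε)))..(d (N ε)),
        derivWithin (fun s => X ε c s) (Iic T) t / (ε + Φ ε c ^ 2))
        + (pdx (ue ε) (X ε (d (N ε)) t) t - pdx (ue ε) (X ε (-d (N ε)) t) t)) (𝓝[>] 0)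
        (𝓝 0) := by
      refine squeeze_zero_norm' (a := fun ε => e (N ε) + e (N ε)) ?_ (by simpa using heN.add heN)
      filter_upwards [hpos, hlocr, hlocl] with ε hε h2 h3
      have P := h.prob ε hε
      have h4 := P.abs_integral_inverse_add_le (hX ε hε) ht (hd0 (N ε))
        ((hd1 _).trans_le (P.inv.Ureg_one_bounds P.one).2.1)
      rw [Real.norm_eq_abs]
      linarith [h2.2, h3.1]
    simpa using h1.sub (hpr.sub hpl)
  have hratio : Tendsto (fun ε => Real.log ε / regPrim ε (Φ ε) (d (N ε))) (𝓝[>] 0)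
      (𝓝 (-1)) := by
    rw [tendsto_iff_dist_tendsto_zero]
    exact squeeze_zero' (Eventually.of_forall fun _ => dist_nonneg)
      (hP.mono fun ε hPε => hPε.2.le) heN
  have := hratio.mul hint
  rw [neg_one_mul, neg_neg] at this
  refine this.congr' ?_
  filter_upwards [hpos] with ε hε
  have P := h.prob ε hε
  have hne := (P.inv.regPrim_pos (hd0 (N ε))).ne'
  rw [P.inv.integral_inv_regDiff]
  field_simp

end RegFamily

/-! ### The theorem -/

lemma exists_growth_of_derivWithin_pos {a b : ℝ} (hab : a < b) {f : ℝ → ℝ}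
    (hf : ContDiffOn ℝ (⊤ : ℕ∞) f (Icc a b)) (hpos : ∀ x ∈ Icc a b, 0 < derivWithin f (Icc a b) x) :
    ∃ κ > 0, ∀ y ∈ Icc a b, ∀ x ∈ Icc a b, y ≤ x → κ * (x - y) ≤ f x - f y := by
  have hd : ContDiffOn ℝ 1 f (Icc a b) := hf.of_le (by exact_mod_cast le_top)
  obtain ⟨z, hz, hmin⟩ := isCompact_Icc.exists_isMinOn (nonempty_Icc.2 hab.le)
    (hd.continuousOn_derivWithin (uniqueDiffOn_Icc hab) le_rfl)
  have heq : ∀ x ∈ interior (Icc a b), derivWithin f (Icc a b) x = deriv f x := fun x hx =>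
    derivWithin_of_mem_nhds (mem_interior_iff_mem_nhds.1 hx)
  refine ⟨_, hpos z hz, fun y hy x hx hyx => ?_⟩
  refine (convex_Icc a b).mul_sub_le_image_sub_of_le_deriv hf.continuousOn
    ((hd.differentiableOn one_ne_zero).mono interior_subset) (fun x hx => ?_) y hy x hx hyx
  rw [← heq x hx]
  exact hmin (interior_subset hx)

lemma RegProblem.exists_eq {a b T x₁ ε w : ℝ} {φ v₀ : ℝ → ℝ} {v : ℝ → ℝ → ℝ}
    (h : RegProblem a b T x₁ ε φ w v₀ v) {t c : ℝ} (ht : t ∈ Icc 0 T) (hc : c ∈ Icc (-w) w) :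
    ∃ x ∈ Icc a b, v x t = c := by
  rw [← h.eq_left ht, ← h.eq_right ht] at hc
  exact intermediate_value_Icc h.hab.le (h.continuousOn_x ht) hc

/-- Theorem 3.3: for strictly increasing data, `(u_ε)_x > 0` in `Q`, so
`X_ε(u,t)` with `u_ε(X_ε(u,t),t) = u` is well defined, and there are `δ_ε → 0` such that
the weighted average of `∂_t X_ε` on `(-δ_ε, δ_ε)`, multiplied by `2 log ε`, converges to
`u_x(x₁⁺,t) - u_x(x₁⁻,t)` for every `t ∈ (0,T]`. -/
theorem stmt6 (a b T x₁ : ℝ) (hab : a < b) (hT : 0 < T)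
    (u₀ : ℝ → ℝ) (h₀c : ContinuousOn u₀ (Set.Icc a b))
    (h₀m : StrictMonoOn u₀ (Set.Icc a b))
    (h₀a : u₀ a = -1) (h₀b : u₀ b = 1)
    (hx₁ : x₁ ∈ Set.Ioo a b) (h₀z : u₀ x₁ = 0)
    (Φ : ℝ → ℝ → ℝ)
    (hΦ : ∀ ε > (0:ℝ), Function.LeftInverse (Φ ε) (Ureg ε) ∧
      Function.RightInverse (Φ ε) (Ureg ε))
    (u1 : ℝ → ℝ) (hu1 : ∀ ε > (0:ℝ), 0 < u1 ε ∧ Φ ε (u1 ε) = 1)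
    (u0e : ℝ → ℝ → ℝ)
    (h0e : ∀ ε > (0:ℝ), ContDiffOn ℝ (⊤ : ℕ∞) (u0e ε) (Set.Icc a b) ∧
      (∀ x ∈ Set.Icc a b, 0 < derivWithin (u0e ε) (Set.Icc a b) x) ∧
      u0e ε a = -u1 ε ∧ u0e ε b = u1 ε ∧ u0e ε x₁ = 0)
    (h0conv : TendstoUniformlyOn (fun ε => u0e ε) u₀ (𝓝[>] (0:ℝ)) (Set.Icc a b))
    (ue : ℝ → ℝ → ℝ → ℝ)
    (hue : ∀ ε > (0:ℝ), IsRegSol a b T ε (Φ ε) (u1 ε) (u0e ε) (ue ε))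
    (u : ℝ → ℝ → ℝ) (hu : IsClassicalSol a b T {x₁} u₀ u)
    (uxp uxm : ℝ → ℝ)
    (huxp : ∀ t ∈ Set.Ioc (0:ℝ) T, Tendsto (fun y => pdx u y t) (𝓝[>] x₁) (𝓝 (uxp t)))
    (huxm : ∀ t ∈ Set.Ioc (0:ℝ) T, Tendsto (fun y => pdx u y t) (𝓝[<] x₁) (𝓝 (uxm t))) :
    (∀ ε > (0:ℝ), ∀ p ∈ QT a b T, 0 < pdx (ue ε) p.1 p.2) ∧
    ∃ X : ℝ → ℝ → ℝ → ℝ,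
      (∀ ε > (0:ℝ), ∀ t ∈ Set.Icc (0:ℝ) T, ∀ v ∈ Set.Icc (-(u1 ε)) (u1 ε),
        X ε v t ∈ Set.Icc a b ∧ ue ε (X ε v t) t = v) ∧
      ∃ δ : ℝ → ℝ, (∀ ε > (0:ℝ), 0 < δ ε) ∧ Tendsto δ (𝓝[>] (0:ℝ)) (𝓝 0) ∧
        ∀ t ∈ Set.Ioc (0:ℝ) T,
          Tendsto (fun ε =>
              2 * Real.log ε *
                ((∫ v in (-(δ ε))..(δ ε), (ε + Φ ε v ^ 2)⁻¹)⁻¹ *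
                  ∫ v in (-(δ ε))..(δ ε),
                    derivWithin (fun s => X ε v s) (Set.Iic T) t / (ε + Φ ε v ^ 2)))
            (𝓝[>] (0:ℝ)) (𝓝 (uxp t - uxm t)) := by
  have fam : RegFamily a b T x₁ u₀ Φ u1 u0e ue :=
    { hab := hab, hT := hT, hx := hx₁, cont := h₀c, mono := h₀m, left := h₀a, right := h₀b
      zero := h₀z, conv := h0conv
      prob := fun ε hε =>
        { hab := hab, hT := hT, hx := hx₁, inv := ⟨hε, (hΦ ε hε).1, (hΦ ε hε).2⟩
          one := (hu1 ε hε).2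
          growth := exists_growth_of_derivWithin_pos hab (h0e ε hε).1 (h0e ε hε).2.1
          left := (h0e ε hε).2.2.1
          right := (h0e ε hε).2.2.2.1
          zero := (h0e ε hε).2.2.2.2
          sol := hue ε hε } }
  refine ⟨fun ε hε p hp => (fam.prob ε hε).pdx_pos hp.1 hp.2, ?_⟩
  have hex : ∀ ε v t, ∃ x, 0 < ε → t ∈ Icc 0 T → v ∈ Icc (-(u1 ε)) (u1 ε) →
      x ∈ Icc a b ∧ ue ε x t = v := fun ε v t => by
    by_cases H : 0 < ε ∧ t ∈ Icc 0 T ∧ v ∈ Icc (-(u1 ε)) (u1 ε)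
    · obtain ⟨x, hx⟩ := (fam.prob ε H.1).exists_eq H.2.1 H.2.2
      exact ⟨x, fun _ _ _ => hx⟩
    · exact ⟨0, fun h1 h2 h3 => absurd ⟨h1, h2, h3⟩ H⟩
  choose X hX using hex
  have hX' : ∀ ε > (0:ℝ), ∀ t ∈ Icc (0:ℝ) T, ∀ v ∈ Icc (-(u1 ε)) (u1 ε),
      X ε v t ∈ Icc a b ∧ ue ε (X ε v t) t = v := fun ε hε t ht v hv => hX ε v t hε ht hv
  exact ⟨X, hX', fam.tendsto_average hu hX' huxp huxm⟩
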